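/- arXiv:1702.03340 — 4 statements merged into one kernel-verified Lean document; each statement's English description precedes it below -/
import Mathlib

section
/- Let φ be a Finsler metric on an open set U ⊆ ℝ² that is monochromatic (for all x, y ∈ U there is a linear bijection A : ℝ² → ℝ² with φ(y, A(v)) = φ(x, v) for all v ∈ ℝ²) and non-Riemannian: for some x₀ ∈ U the norm φ(x₀, ·) is not Euclidean. Let (V, Φ) be a 3-dimensional Banach–Minkowski space and f : U → V an isometric embedding of (U, φ). Then the second fundamental form of f is degenerate at every point: for every p ∈ U there exists w ∈ ℝ²∖{0} such that D²f_p(w, u) ∈ range(Df_p) for all u ∈ ℝ². -/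
noncomputable section

def IsBanachMinkowski {V : Type*} [NormedAddCommGroup V] [NormedSpace ℝ V] (Φ : V → ℝ) : Prop :=
  Φ 0 = 0 ∧
  (∀ v : V, v ≠ 0 → 0 < Φ v) ∧
  (∀ t : ℝ, 0 ≤ t → ∀ v : V, Φ (t • v) = t * Φ v) ∧
  (∀ v w : V, Φ (v + w) ≤ Φ v + Φ w) ∧
  ContDiffOn ℝ (⊤ : ℕ∞) Φ {(0 : V)}ᶜ ∧
  (∀ v : V, v ≠ 0 → ∀ w : V, w ≠ 0 →
    0 < iteratedFDeriv ℝ 2 (fun u => Φ u ^ 2) v ![w, w])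

def IsEuclideanNorm {V : Type*} [NormedAddCommGroup V] [NormedSpace ℝ V] (Φ : V → ℝ) : Prop :=
  ∃ Q : QuadraticForm ℝ V, Q.PosDef ∧ ∀ v : V, Φ v ^ 2 = Q v

def IsFinslerMetric (U : Set (ℝ × ℝ)) (φ : ℝ × ℝ → ℝ × ℝ → ℝ) : Prop :=
  ContDiffOn ℝ (⊤ : ℕ∞) (fun q : (ℝ × ℝ) × ℝ × ℝ => φ q.1 q.2) (U ×ˢ {(0 : ℝ × ℝ)}ᶜ) ∧
  ∀ x ∈ U, IsBanachMinkowski (φ x)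

def IsIsometricEmbedding (U : Set (ℝ × ℝ)) (φ : ℝ × ℝ → ℝ × ℝ → ℝ)
    {V : Type*} [NormedAddCommGroup V] [NormedSpace ℝ V] (Φ : V → ℝ)
    (f : ℝ × ℝ → V) : Prop :=
  ContDiffOn ℝ (⊤ : ℕ∞) f U ∧ Set.InjOn f U ∧ ∀ x ∈ U, ∀ v : ℝ × ℝ, Φ (fderiv ℝ f x v) = φ x v

section SecProof
open Filter Topology Set

def Good {V : Type*} [NormedAddCommGroup V] [NormedSpace ℝ V] (Θ : V → ℝ) : Prop :=
  (∀ v, v ≠ 0 → 0 < Θ v) ∧ (∀ t : ℝ, 0 ≤ t → ∀ v, Θ (t • v) = t ^ 2 * Θ v) ∧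
    ContDiffOn ℝ 2 Θ {(0 : V)}ᶜ

section
variable {V : Type*} [NormedAddCommGroup V] [NormedSpace ℝ V]

lemma Good.contDiffAt {Θ : V → ℝ} (h : Good Θ) {v : V} (hv : v ≠ 0) : ContDiffAt ℝ 2 Θ v :=
  h.2.2.contDiffAt (isOpen_compl_singleton.mem_nhds hv)

lemma Good.hasFDerivAt {Θ : V → ℝ} (h : Good Θ) {v : V} (hv : v ≠ 0) :
    HasFDerivAt Θ (fderiv ℝ Θ v) v :=
  ((h.contDiffAt hv).differentiableAt (by norm_num)).hasFDerivAt

lemma Good.hasFDerivAt2 {Θ : V → ℝ} (h : Good Θ) {v : V} (hv : v ≠ 0) :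
    HasFDerivAt (fderiv ℝ Θ) (fderiv ℝ (fderiv ℝ Θ) v) v :=
  (((h.contDiffAt hv).fderiv_right (m := 1) (by norm_num)).differentiableAt
    (by norm_num)).hasFDerivAt

lemma Good.zero {Θ : V → ℝ} (h : Good Θ) : Θ 0 = 0 := by
  have := h.2.1 0 le_rfl 0
  simpa using this

lemma Good.euler {Θ : V → ℝ} (h : Good Θ) {v : V} (hv : v ≠ 0) :
    fderiv ℝ Θ v v = 2 * Θ v := by
  have h1 : HasDerivAt (fun t : ℝ => t • v) v 1 := by
    simpa using (hasDerivAt_id (1 : ℝ)).smul_const v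
  have h2 : HasDerivAt (fun t : ℝ => Θ (t • v)) (fderiv ℝ Θ v v) 1 := by
    have h0 : HasFDerivAt Θ (fderiv ℝ Θ v) ((1 : ℝ) • v) := by
      rw [one_smul]; exact h.hasFDerivAt hv
    exact HasFDerivAt.comp_hasDerivAt (f := fun t : ℝ => t • v) (1 : ℝ) h0 h1
  have h3 : HasDerivAt (fun t : ℝ => t ^ 2 * Θ v) (2 * Θ v) 1 := by
    simpa using (hasDerivAt_pow 2 (1 : ℝ)).mul_const (Θ v)
  have h4 : (fun t : ℝ => Θ (t • v)) =ᶠ[𝓝 1] fun t : ℝ => t ^ 2 * Θ v := by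
    filter_upwards [lt_mem_nhds (show (0:ℝ) < 1 by norm_num)] with t ht
    exact h.2.1 t ht.le v
  exact h2.unique (h3.congr_of_eventuallyEq h4)

lemma Good.comp {W : Type*} [NormedAddCommGroup W] [NormedSpace ℝ W] {Θ : V → ℝ} (h : Good Θ)
    (T : W →L[ℝ] V) (hT : ∀ v, T v = 0 → v = 0) : Good (fun v => Θ (T v)) := by
  refine ⟨fun v hv => h.1 _ fun h0 => hv (hT v h0), fun t ht v => ?_, ?_⟩
  · show Θ (T (t • v)) = t ^ 2 * Θ (T v)
    rw [T.map_smul, h.2.1 t ht]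
  · exact h.2.2.comp T.contDiff.contDiffOn fun v hv h0 => hv (hT v h0)

lemma Good.fderiv_comp {W : Type*} [NormedAddCommGroup W] [NormedSpace ℝ W] {Θ : V → ℝ}
    (h : Good Θ) (T : W →L[ℝ] V) (hT : ∀ v, T v = 0 → v = 0) {v : W} (hv : v ≠ 0) (w : W) :
    fderiv ℝ (fun v => Θ (T v)) v w = fderiv ℝ Θ (T v) (T w) := by
  have h1 := (h.hasFDerivAt (v := T v) (fun h0 => hv (hT v h0))).comp v T.hasFDerivAt
  have h2 : fderiv ℝ (fun v => Θ (T v)) v = (fderiv ℝ Θ (T v)).comp T := h1.fderiv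
  rw [h2]; rfl

lemma Good.bounds [FiniteDimensional ℝ V] {Θ : V → ℝ} (h : Good Θ) :
    ∃ c C : ℝ, 0 < c ∧ 0 < C ∧ ∀ w, c * ‖w‖ ^ 2 ≤ Θ w ∧ Θ w ≤ C * ‖w‖ ^ 2 := by
  have hc : ContinuousOn Θ (Metric.sphere (0 : V) 1) := fun v hv => by
    have hv0 : v ≠ 0 := by
      rintro rfl; simp at hv
    exact (h.contDiffAt hv0).continuousAt.continuousWithinAt
  have hK : IsCompact (Metric.sphere (0 : V) 1) := isCompact_sphere 0 1
  rcases (Metric.sphere (0 : V) 1).eq_empty_or_nonempty with he | hne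
  · refine ⟨1, 1, one_pos, one_pos, fun w => ?_⟩
    have : w = 0 := by
      by_contra hw
      have : ‖w‖⁻¹ • w ∈ Metric.sphere (0 : V) 1 := by
        simp [norm_smul, hw]
      rw [he] at this; exact this
    subst this; simp [h.zero]
  · obtain ⟨a, ha, hmin⟩ := hK.exists_isMinOn hne hc
    obtain ⟨b, hb, hmax⟩ := hK.exists_isMaxOn hne hc
    have hn : ∀ a ∈ Metric.sphere (0 : V) 1, a ≠ 0 := by
      rintro a ha rfl; simp at ha
    refine ⟨Θ a, Θ b, h.1 _ (hn a ha), h.1 _ (hn b hb), fun w => ?_⟩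
    by_cases hw : w = 0
    · subst hw; simp [h.zero]
    have hs : ‖w‖⁻¹ • w ∈ Metric.sphere (0 : V) 1 := by
      simp [norm_smul, hw]
    have hw' : w = ‖w‖ • (‖w‖⁻¹ • w) := by
      rw [smul_smul, mul_inv_cancel₀ (norm_ne_zero_iff.2 hw), one_smul]
    have e : Θ w = ‖w‖ ^ 2 * Θ (‖w‖⁻¹ • w) := by
      conv_lhs => rw [hw', h.2.1 _ (norm_nonneg w)]
    rw [e, mul_comm (Θ a), mul_comm (Θ b)]
    exact ⟨mul_le_mul_of_nonneg_left (hmin hs) (by positivity),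
      mul_le_mul_of_nonneg_left (hmax hs) (by positivity)⟩

lemma Good.continuous [FiniteDimensional ℝ V] {Θ : V → ℝ} (h : Good Θ) : Continuous Θ := by
  rw [continuous_iff_continuousAt]
  intro v
  by_cases hv : v = 0
  · subst hv
    obtain ⟨c, C, hc, hC, hb⟩ := h.bounds
    rw [ContinuousAt, h.zero]
    have h1 : Tendsto (fun w : V => C * ‖w‖ ^ 2) (𝓝 0) (𝓝 0) := by
      have : Continuous (fun w : V => C * ‖w‖ ^ 2) := by fun_prop
      simpa using this.tendsto 0
    exact tendsto_of_tendsto_of_tendsto_of_le_of_le tendsto_const_nhds h1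
      (fun w => le_trans (by positivity) (hb w).1) (fun w => (hb w).2)
  · exact (h.contDiffAt hv).continuousAt

lemma Good.tendsto_fderiv {Θ : V → ℝ} (h : Good Θ) {v : V} (hv : v ≠ 0) :
    ContinuousAt (fderiv ℝ Θ) v := (h.hasFDerivAt2 hv).continuousAt
end

def NE (F : ℝ × ℝ → ℝ) : Prop :=
  ¬ ∃ Q : QuadraticForm ℝ (ℝ × ℝ), Q.PosDef ∧ ∀ v, F v = Q v

def wedge (a b : ℝ × ℝ) : ℝ := a.1 * b.2 - a.2 * b.1

lemma wedge_par {a b : ℝ × ℝ} (ha : a ≠ 0) (h : wedge a b = 0) : ∃ l : ℝ, b = l • a := by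
  unfold wedge at h
  have : a.1 ^ 2 + a.2 ^ 2 ≠ 0 := by
    intro h0
    apply ha
    have h1 : a.1 = 0 := by nlinarith [sq_nonneg a.1, sq_nonneg a.2]
    have h2 : a.2 = 0 := by nlinarith [sq_nonneg a.1, sq_nonneg a.2]
    exact Prod.ext h1 h2
  refine ⟨(a.1 * b.1 + a.2 * b.2) / (a.1 ^ 2 + a.2 ^ 2), Prod.ext ?_ ?_⟩
  · simp; field_simp; linear_combination (-a.2) * h
  · simp; field_simp; linear_combination a.1 * h

lemma wedge_span {a b : ℝ × ℝ} (h : wedge a b ≠ 0) (v : ℝ × ℝ) :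
    v = (wedge v b / wedge a b) • a + (wedge a v / wedge a b) • b := by
  ext
  · simp only [Prod.fst_add, Prod.smul_fst, smul_eq_mul]
    field_simp
    simp only [wedge]; ring
  · simp only [Prod.snd_add, Prod.smul_snd, smul_eq_mul]
    field_simp
    simp only [wedge]; ring

lemma par_zero {F : ℝ × ℝ → ℝ} (hF : Good F) {v w : ℝ × ℝ} (hv : v ≠ 0)
    (hw : wedge v w = 0) (h : fderiv ℝ F v w = 0) : w = 0 := by
  obtain ⟨l, rfl⟩ := wedge_par hv hw
  rw [map_smul, hF.euler hv, smul_eq_mul] at h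
  have := hF.1 v hv
  have : l = 0 := by
    rcases mul_eq_zero.1 h with h | h
    · exact h
    · linarith
  simp [this]

lemma lemma_L {F : ℝ × ℝ → ℝ} (hF : Good F) (hN : NE F) (L : (ℝ × ℝ) →L[ℝ] (ℝ × ℝ))
    (hL : ∀ v, v ≠ 0 → fderiv ℝ F v (L v) = 0) : L = 0 := by
  by_contra hL0
  -- L injective
  have hinj : ∀ k, k ≠ 0 → L k ≠ 0 := by
    intro k hk hLk
    obtain ⟨w, hw⟩ : ∃ w, L w ≠ 0 := by
      by_contra hh; push Not at hh
      exact hL0 (ContinuousLinearMap.ext hh)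
    have hkw : wedge k w ≠ 0 := by
      intro h0
      obtain ⟨l, rfl⟩ := wedge_par hk h0
      simp [hLk] at hw
    set a := L w with ha
    have hLa : L a = 0 := by
      apply par_zero hF hw _ (hL a hw)
      conv_lhs => rw [wedge_span hkw a]
      have : L (((wedge a w / wedge k w) • k + (wedge k a / wedge k w) • w))
        = (wedge k a / wedge k w) • a := by simp [hLk, ha]
      have h2 : L a = (wedge k a / wedge k w) • a := by
        rw [← this, ← wedge_span hkw a]
      rw [← wedge_span hkw a, h2]
      simp [wedge]; ring
    have key : ∀ᶠ t : ℝ in 𝓝[≠] 0, fderiv ℝ F (a + t • w) a = 0 := by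
      have hne : ∀ᶠ t : ℝ in 𝓝[≠] 0, a + t • w ≠ 0 := by
        have : ContinuousAt (fun t : ℝ => a + t • w) 0 := by fun_prop
        exact (this.eventually_ne (by simpa using hw)).filter_mono nhdsWithin_le_nhds
      filter_upwards [hne, self_mem_nhdsWithin] with t h1 h2
      have := hL _ h1
      rw [map_add, map_smul, hLa, zero_add, ← ha, map_smul, smul_eq_mul] at this
      exact (mul_eq_zero.1 this).resolve_left h2
    have ht : Tendsto (fun t : ℝ => fderiv ℝ F (a + t • w) a) (𝓝[≠] 0) (𝓝 (fderiv ℝ F a a)) := by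
      have h1 : ContinuousAt (fun t : ℝ => a + t • w) 0 := by fun_prop
      have h2 : ContinuousAt (fderiv ℝ F) (a + (0:ℝ) • w) := by
        simpa using hF.tendsto_fderiv hw
      have h3 : ContinuousAt (fun t : ℝ => fderiv ℝ F (a + t • w)) 0 :=
        ContinuousAt.comp (f := fun t : ℝ => a + t • w) h2 h1
      have h4 := (h3.clm_apply (continuousAt_const (y := a))).tendsto
      simp only [zero_smul, add_zero] at h4
      exact h4.mono_left nhdsWithin_le_nhds
    have h0 := tendsto_nhds_unique (ht.congr' key) tendsto_const_nhds
    rw [hF.euler hw] at h0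
    have := hF.1 a hw
    linarith
  have hQ0 : ∀ v, v ≠ 0 → wedge v (L v) ≠ 0 := fun v hv h0 =>
    hinj v hv (par_zero hF hv h0 (hL v hv))
  have hQc : Continuous fun v : ℝ × ℝ => wedge v (L v) := by unfold wedge; fun_prop
  have hconn : IsPreconnected ({0}ᶜ : Set (ℝ × ℝ)) :=
    (isConnected_compl_singleton_of_one_lt_rank (by
      rw [← Module.finrank_eq_rank]; norm_num) 0).isPreconnected
  -- choose sign
  obtain ⟨s, hs⟩ : ∃ s : ℝ, ∀ v, v ≠ 0 → 0 < s * wedge v (L v) := by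
    have e1 : ((1, 0) : ℝ × ℝ) ≠ 0 := by simp
    rcases lt_or_gt_of_ne (hQ0 _ e1) with h1 | h1
    · refine ⟨-1, fun v hv => ?_⟩
      by_contra hneg
      have := hconn.intermediate_value (a := (1,0)) (b := v) e1 hv hQc.continuousOn
      obtain ⟨z, hz, hz0⟩ := this (show (0:ℝ) ∈ _ from ⟨h1.le, by linarith⟩)
      exact hQ0 z hz hz0
    · refine ⟨1, fun v hv => ?_⟩
      by_contra hneg
      have := hconn.intermediate_value (b := (1,0)) (a := v) hv e1 hQc.continuousOn
      obtain ⟨z, hz, hz0⟩ := this (show (0:ℝ) ∈ _ from ⟨by linarith, h1.le⟩)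
      exact hQ0 z hz hz0
  -- quadratic form
  set q : ℝ × ℝ → ℝ := fun v => s * wedge v (L v) with hq
  have hqd : ∀ v, HasFDerivAt q (s • (v.1 • (ContinuousLinearMap.snd ℝ ℝ ℝ).comp L
      + (L v).2 • ContinuousLinearMap.fst ℝ ℝ ℝ
      - (v.2 • (ContinuousLinearMap.fst ℝ ℝ ℝ).comp L + (L v).1 • ContinuousLinearMap.snd ℝ ℝ ℝ))) v := by
    intro v
    have a1 : HasFDerivAt (fun v : ℝ × ℝ => v.1) (ContinuousLinearMap.fst ℝ ℝ ℝ) v := hasFDerivAt_fst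
    have a2 : HasFDerivAt (fun v : ℝ × ℝ => v.2) (ContinuousLinearMap.snd ℝ ℝ ℝ) v := hasFDerivAt_snd
    have b1 : HasFDerivAt (fun v : ℝ × ℝ => (L v).1) ((ContinuousLinearMap.fst ℝ ℝ ℝ).comp L) v :=
      ((ContinuousLinearMap.fst ℝ ℝ ℝ).comp L).hasFDerivAt
    have b2 : HasFDerivAt (fun v : ℝ × ℝ => (L v).2) ((ContinuousLinearMap.snd ℝ ℝ ℝ).comp L) v :=
      ((ContinuousLinearMap.snd ℝ ℝ ℝ).comp L).hasFDerivAt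
    exact ((a1.mul b2).sub (a2.mul b1)).const_mul s
  set tr : ℝ := (L (1,0)).1 + (L (0,1)).2 with htr
  have hLe : ∀ v : ℝ × ℝ, L v = v.1 • L (1,0) + v.2 • L (0,1) := by
    intro v
    rw [← map_smul, ← map_smul, ← map_add]
    congr 1; ext <;> simp
  have hqv : ∀ v, fderiv ℝ q v v = 2 * q v := by
    intro v; rw [(hqd v).fderiv]; simp [hq, wedge]; ring
  have hqL : ∀ v, fderiv ℝ q v (L v) = tr * q v := by
    intro v
    rw [(hqd v).fderiv]
    have h1 := congrArg Prod.fst (hLe v)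
    have h2 := congrArg Prod.snd (hLe v)
    have h3 := congrArg Prod.fst (hLe (L v))
    have h4 := congrArg Prod.snd (hLe (L v))
    simp at h1 h2 h3 h4
    simp [hq, wedge, htr, h3, h4]
    rw [h1, h2]; ring
  set G : ℝ × ℝ → ℝ := fun v => F v * (q v)⁻¹ with hG
  have hGd : ∀ v, v ≠ 0 → HasFDerivAt G (F v • (-(q v ^ 2)⁻¹ • fderiv ℝ q v) + (q v)⁻¹ • fderiv ℝ F v) v := by
    intro v hv
    have hqq : HasFDerivAt q (fderiv ℝ q v) v := (hqd v).differentiableAt.hasFDerivAt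
    have := (hasDerivAt_inv (hs v hv).ne').comp_hasFDerivAt v hqq
    exact (hF.hasFDerivAt hv).mul this
  have hGv : ∀ v, v ≠ 0 → fderiv ℝ G v v = 0 := by
    intro v hv
    rw [(hGd v hv).fderiv]
    have := (hs v hv).ne'
    simp [hqv, hF.euler hv]
    field_simp; ring
  have hGL : ∀ v, v ≠ 0 → fderiv ℝ G v (L v) = - tr * G v := by
    intro v hv
    rw [(hGd v hv).fderiv]
    have := (hs v hv).ne'
    simp [hqL, hL v hv, hG]
    field_simp
  have hGpos : ∀ v, v ≠ 0 → 0 < G v := fun v hv => mul_pos (hF.1 v hv) (inv_pos.2 (hs v hv))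
  have hGs : ∀ (t : ℝ), 0 < t → ∀ v, G (t • v) = G v := by
    intro t ht v
    have : q (t • v) = t ^ 2 * q v := by simp [hq, wedge]; ring
    simp only [hG]
    rw [this, hF.2.1 t ht.le, mul_inv]
    field_simp
  have hGdiff : DifferentiableOn ℝ G {0}ᶜ := fun v hv =>
    (hGd v hv).differentiableAt.differentiableWithinAt
  have htr0 : tr = 0 := by
    have hK : IsCompact (Metric.sphere (0 : ℝ × ℝ) 1) := isCompact_sphere 0 1
    have hn : ∀ a ∈ Metric.sphere (0 : ℝ × ℝ) 1, a ≠ 0 := by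
      rintro a ha rfl; simp at ha
    obtain ⟨a, ha, hmax⟩ := hK.exists_isMaxOn ⟨(1,0), by simp [Prod.norm_def]⟩
      (hGdiff.continuousOn.mono fun a ha => hn a ha)
    have hloc : IsLocalMax G a := by
      filter_upwards [isOpen_compl_singleton.mem_nhds (hn a ha)] with v hv
      have hv : v ≠ 0 := hv
      rw [← hGs ‖v‖⁻¹ (by positivity) v]
      exact hmax (by simp [norm_smul, hv])
    have h0 := hGL a (hn a ha)
    rw [hloc.fderiv_eq_zero] at h0
    have := hGpos a (hn a ha)
    have h1 : tr * G a = 0 := by simpa using h0.symm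
    exact (mul_eq_zero.1 h1).resolve_right this.ne'
  have hG0 : EqOn (fderiv ℝ G) 0 {0}ᶜ := by
    intro v hv
    refine ContinuousLinearMap.ext fun w => ?_
    rw [wedge_span (hQ0 v hv) w]
    rw [map_add, map_smul, map_smul, hGv v hv, hGL v hv, htr0]
    simp
  have hconst : ∀ v, v ≠ 0 → G v = G (1,0) := fun v hv =>
    isOpen_compl_singleton.is_const_of_fderiv_eq_zero hconn hGdiff hG0 hv (by simp)
  apply hN
  set cc := G (1,0)
  have hcc : 0 < cc := hGpos _ (by simp)
  let Bf : LinearMap.BilinForm ℝ (ℝ × ℝ) := LinearMap.mk₂ ℝ (fun v w => cc * s * wedge v (L w))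
    (by intros; simp [wedge]; ring) (by intros; simp [wedge]; ring)
    (by intros; simp [wedge]; ring) (by intros; simp [wedge]; ring)
  have hB : ∀ v, Bf.toQuadraticMap v = cc * q v := by
    intro v; simp [Bf, hq]; ring
  refine ⟨Bf.toQuadraticMap, fun v hv => ?_, fun v => ?_⟩
  · rw [hB]; exact mul_pos hcc (hs v hv)
  · rw [hB]
    by_cases hv : v = 0
    · subst hv; simp [hF.zero, hq, wedge]
    · have h1 := hconst v hv
      have h2 := (hs v hv).ne'
      rw [← h1]
      simp only [hG]
      rw [mul_assoc, inv_mul_cancel₀ h2, mul_one]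

lemma lemma_S {F : ℝ × ℝ → ℝ} (hF : Good F) (hN : NE F)
    (S : (ℝ × ℝ) →L[ℝ] (ℝ × ℝ) →L[ℝ] (ℝ × ℝ))
    (hS : ∀ v, v ≠ 0 → fderiv ℝ F v (S v v) = 0) : ∀ v, S v v = 0 := by
  obtain ⟨v0, hv0, hw⟩ : ∃ v0 : ℝ × ℝ, v0 ≠ 0 ∧ wedge v0 (S v0 v0) = 0 := by
    have hc : Continuous fun v : ℝ × ℝ => wedge v (S v v) := by unfold wedge; fun_prop
    have hconn : IsPreconnected ({0}ᶜ : Set (ℝ × ℝ)) :=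
      (isConnected_compl_singleton_of_one_lt_rank (by
        rw [← Module.finrank_eq_rank]; norm_num) 0).isPreconnected
    have e1 : ((1, 0) : ℝ × ℝ) ∈ ({0}ᶜ : Set (ℝ × ℝ)) := by simp
    have e2 : -((1, 0) : ℝ × ℝ) ∈ ({0}ᶜ : Set (ℝ × ℝ)) := by simp
    have hodd : wedge (-((1, 0) : ℝ × ℝ)) (S (-(1,0)) (-(1,0))) = - wedge (1,0) (S (1,0) (1,0)) := by
      have : S (-(1,0)) (-(1,0)) = S (1,0) (1,0) := by rw [map_neg S, map_neg, neg_apply, neg_neg]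
      rw [this]
      simp [wedge]
    rcases le_total (wedge (1,0) (S (1,0) (1,0))) 0 with h | h
    · obtain ⟨z, hz, hz0⟩ := hconn.intermediate_value e1 e2 hc.continuousOn
        (show (0:ℝ) ∈ _ from ⟨h, by simp only [hodd]; linarith⟩)
      exact ⟨z, hz, hz0⟩
    · obtain ⟨z, hz, hz0⟩ := hconn.intermediate_value e2 e1 hc.continuousOn
        (show (0:ℝ) ∈ _ from ⟨by simp only [hodd]; linarith, h⟩)
      exact ⟨z, hz, hz0⟩
  have h00 : S v0 v0 = 0 := par_zero hF hv0 hw (hS v0 hv0)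
  obtain ⟨v1, hv1⟩ : ∃ v1 : ℝ × ℝ, wedge v0 v1 = 1 := by
    by_contra hh
    push Not at hh
    apply hv0
    ext
    · by_contra h1
      have h1 : v0.1 ≠ 0 := h1
      apply hh (0, v0.1⁻¹); simp [wedge, h1]
    · by_contra h1
      have h1 : v0.2 ≠ 0 := h1
      apply hh (-v0.2⁻¹, 0); simp [wedge, h1]
  have hspan : ∀ v : ℝ × ℝ, v = wedge v v1 • v0 + wedge v0 v • v1 := by
    intro v
    have := wedge_span (a := v0) (b := v1) (by rw [hv1]; norm_num) v
    simpa [hv1] using this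
  let L : (ℝ × ℝ) →L[ℝ] (ℝ × ℝ) :=
    (v1.2 • ContinuousLinearMap.fst ℝ ℝ ℝ - v1.1 • ContinuousLinearMap.snd ℝ ℝ ℝ).smulRight
      (S v0 v1 + S v1 v0)
    + (v0.1 • ContinuousLinearMap.snd ℝ ℝ ℝ - v0.2 • ContinuousLinearMap.fst ℝ ℝ ℝ).smulRight
      (S v1 v1)
  have hLv : ∀ v, L v = wedge v v1 • (S v0 v1 + S v1 v0) + wedge v0 v • S v1 v1 := by
    intro v
    simp only [L, wedge, add_apply, ContinuousLinearMap.smulRight_apply,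
      sub_apply, smul_apply,
      ContinuousLinearMap.coe_fst', ContinuousLinearMap.coe_snd', smul_eq_mul]
    congr 2; ring
  have hSL : ∀ v, S v v = wedge v0 v • L v := by
    intro v
    rw [hLv]
    conv_lhs => rw [hspan v]
    simp only [map_add, map_smul, add_apply, smul_apply, h00]
    module
  have hL1 : ∀ v, v ≠ 0 → wedge v0 v ≠ 0 → fderiv ℝ F v (L v) = 0 := by
    intro v hv hw
    have := hS v hv
    rw [hSL, map_smul, smul_eq_mul] at this
    exact (mul_eq_zero.1 this).resolve_left hw
  have hL : L = 0 := by
    apply lemma_L hF hN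
    intro v hv
    by_cases hw : wedge v0 v = 0
    · have key : ∀ᶠ t : ℝ in 𝓝[≠] 0, fderiv ℝ F (v + t • v1) (L (v + t • v1)) = 0 := by
        have hne : ∀ᶠ t : ℝ in 𝓝[≠] 0, v + t • v1 ≠ 0 := by
          have : ContinuousAt (fun t : ℝ => v + t • v1) 0 := by fun_prop
          exact (this.eventually_ne (by simpa using hv)).filter_mono nhdsWithin_le_nhds
        filter_upwards [hne, self_mem_nhdsWithin] with t h1 h2
        apply hL1 _ h1
        have : wedge v0 (v + t • v1) = wedge v0 v + t * wedge v0 v1 := by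
          simp [wedge]; ring
        rw [this, hw, hv1]; simpa using h2
      have ht : Tendsto (fun t : ℝ => fderiv ℝ F (v + t • v1) (L (v + t • v1))) (𝓝[≠] 0)
          (𝓝 (fderiv ℝ F v (L v))) := by
        have h1 : ContinuousAt (fun t : ℝ => v + t • v1) 0 := by fun_prop
        have h2 : ContinuousAt (fderiv ℝ F) (v + (0:ℝ) • v1) := by
          simpa using hF.tendsto_fderiv hv
        have h3 : ContinuousAt (fun t : ℝ => fderiv ℝ F (v + t • v1)) 0 :=
          ContinuousAt.comp (f := fun t : ℝ => v + t • v1) h2 h1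
        have h5 : ContinuousAt (fun t : ℝ => L (v + t • v1)) 0 := by fun_prop
        have h4 := (h3.clm_apply h5).tendsto
        simp only [zero_smul, add_zero] at h4
        exact h4.mono_left nhdsWithin_le_nhds
      exact tendsto_nhds_unique (ht.congr' key) tendsto_const_nhds |>.symm ▸ rfl
    · exact hL1 v hv hw
  intro v
  rw [hSL, hL]; simp

lemma lemma_U {F : ℝ × ℝ → ℝ} (hF : Good F) (hN : NE F) (g : ℝ × ℝ → ℝ)
    (h1 h2 : (ℝ × ℝ) →L[ℝ] ℝ) (a1 a2 : ℝ × ℝ) (h11 : h1 a1 = 1) (h12 : h1 a2 = 0)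
    (h21 : h2 a1 = 0) (h22 : h2 a2 = 1) (hsp : ∀ v, v = h1 v • a1 + h2 v • a2)
    (B1 B2 : (ℝ × ℝ) →L[ℝ] (ℝ × ℝ))
    (hB1 : ∀ v, v ≠ 0 → fderiv ℝ F v (B1 v) = h1 v * g v)
    (hB2 : ∀ v, v ≠ 0 → fderiv ℝ F v (B2 v) = h2 v * g v) :
    ∃ u, ∀ v, v ≠ 0 → fderiv ℝ F v u = g v := by
  have hS := lemma_S hF hN (h2.smulRight B1 - h1.smulRight B2) (by
    intro v hv
    simp only [sub_apply, ContinuousLinearMap.smulRight_apply,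
      smul_apply, map_sub, map_smul, smul_eq_mul, hB1 v hv, hB2 v hv]
    ring)
  simp only [sub_apply, ContinuousLinearMap.smulRight_apply,
      smul_apply] at hS
  have s1 : B2 a1 = 0 := by simpa [h11, h21] using hS a1
  have s2 : B1 a2 = 0 := by simpa [h12, h22] using hS a2
  have s3 : B1 a1 = B2 a2 := by
    have := hS (a1 + a2)
    simp [h11, h12, h21, h22, s1, s2] at this
    exact sub_eq_zero.1 this
  have b1 : ∀ v, B1 v = h1 v • B1 a1 := by
    intro v
    conv_lhs => rw [hsp v]
    simp [s2]
  have b2 : ∀ v, B2 v = h2 v • B1 a1 := by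
    intro v
    conv_lhs => rw [hsp v]
    simp [s1, s3]
  refine ⟨B1 a1, fun v hv => ?_⟩
  by_cases h : h1 v = 0
  · have h' : h2 v ≠ 0 := by
      intro h'; apply hv; rw [hsp v, h, h']; simp
    have := hB2 v hv
    rw [b2, map_smul, smul_eq_mul] at this
    exact mul_left_cancel₀ h' this
  · have := hB1 v hv
    rw [b1, map_smul, smul_eq_mul] at this
    exact mul_left_cancel₀ h this

lemma seq_lemma {E : Type*} [NormedAddCommGroup E] [NormedSpace ℝ E] [FiniteDimensional ℝ E]
    (t : ℕ → ℝ) (ht : ∀ k, 0 < t k) (X : ℕ → E) :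
    ∃ ψ : ℕ → ℕ, StrictMono ψ ∧ ∃ (τ : ℝ) (C : E), (τ ≠ 0 ∨ C ≠ 0) ∧ 
      Tendsto (fun k => ‖(t (ψ k), X (ψ k))‖⁻¹ * t (ψ k)) atTop (𝓝 τ) ∧ 
      Tendsto (fun k => ‖(t (ψ k), X (ψ k))‖⁻¹ • X (ψ k)) atTop (𝓝 C) := by
  have hmem : ∀ k, ‖(t k, X k)‖⁻¹ • (t k, X k) ∈ Metric.sphere (0 : ℝ × E) 1 := by
    intro k
    have : (t k, X k) ≠ 0 := by
      intro h; exact (ht k).ne' (congrArg Prod.fst h)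
    rw [mem_sphere_zero_iff_norm, norm_smul, norm_inv, norm_norm,
      inv_mul_cancel₀ (norm_ne_zero_iff.2 this)]
  obtain ⟨⟨τ, C⟩, hm, ψ, hψ, hlim⟩ := (isCompact_sphere (0 : ℝ × E) 1).tendsto_subseq hmem
  refine ⟨ψ, hψ, τ, C, ?_, ?_, ?_⟩
  · by_contra hh
    push Not at hh
    obtain ⟨rfl, rfl⟩ := hh
    simp at hm
  · exact (continuous_fst.tendsto _).comp hlim
  · exact (continuous_snd.tendsto _).comp hlim

lemma tclm {E F : Type*} [NormedAddCommGroup E] [NormedSpace ℝ E] [NormedAddCommGroup F]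
    [NormedSpace ℝ F] {ι : Type*} {l : Filter ι} {T : ι → E →L[ℝ] F} {T0 : E →L[ℝ] F}
    {x : ι → E} {x0 : E} (hT : Tendsto T l (𝓝 T0)) (hx : Tendsto x l (𝓝 x0)) :
    Tendsto (fun k => T k (x k)) l (𝓝 (T0 x0)) :=
  ((isBoundedBilinearMap_apply (𝕜 := ℝ) (E := E) (F := F)).continuous.tendsto (T0, x0)).comp
    (hT.prodMk_nhds hx)

lemma slope_seq {E : Type*} [NormedAddCommGroup E] [NormedSpace ℝ E] {D : ℝ → E} {D' : E}
    (hD : HasDerivAt D D' 0) {s c : ℕ → ℝ} (hs : ∀ k, 0 < s k) (hs0 : Tendsto s atTop (𝓝 0))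
    {τ : ℝ} (hc : Tendsto (fun k => c k * s k) atTop (𝓝 τ)) :
    Tendsto (fun k => c k • (D (s k) - D 0)) atTop (𝓝 (τ • D')) := by
  have h1 : Tendsto s atTop (𝓝[≠] 0) :=
    tendsto_nhdsWithin_iff.2 ⟨hs0, Eventually.of_forall fun k => (hs k).ne'⟩
  have h2 := hD.tendsto_slope_zero.comp h1
  refine (hc.smul h2).congr fun k => ?_
  simp only [Function.comp, zero_add]
  rw [smul_smul, mul_assoc, mul_inv_cancel₀ (hs k).ne', mul_one]

lemma pos_seq {P : ℝ → Prop} (h : ∀ᶠ t in 𝓝 (0:ℝ), P t) :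
    ∃ s : ℕ → ℝ, (∀ k, 0 < s k) ∧ Tendsto s atTop (𝓝 0) ∧ ∀ k, P (s k) := by
  obtain ⟨δ, hδ, hP⟩ := Metric.eventually_nhds_iff.1 h
  have hp : ∀ k : ℕ, 0 < δ * (1 / ((k : ℝ) + 1)) * (1 / 2) := fun k => by positivity
  refine ⟨fun k => δ * (1 / ((k : ℝ) + 1)) * (1 / 2), hp, ?_, fun k => hP ?_⟩
  · have := (tendsto_one_div_add_atTop_nhds_zero_nat (𝕜 := ℝ)).const_mul δ |>.mul_const (1/2)
    simpa using this
  · rw [Real.dist_eq, sub_zero, abs_of_pos (hp k)]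
    have : 1 / ((k : ℝ) + 1) ≤ 1 := by
      rw [div_le_one (by positivity)]; linarith [Nat.cast_nonneg (α := ℝ) k]
    nlinarith

lemma lemma_K {V : Type*} [NormedAddCommGroup V] [NormedSpace ℝ V] [FiniteDimensional ℝ V]
    {Θ : V → ℝ} (hΘ : Good Θ) (D : ℝ → (ℝ × ℝ) →L[ℝ] V) (D' : (ℝ × ℝ) →L[ℝ] V)
    (hD : HasDerivAt D D' 0) (hinj : ∀ v, D 0 v = 0 → v = 0) (hN : NE fun v => Θ (D 0 v))
    (hA : ∀ᶠ t in 𝓝 (0:ℝ), ∃ A : (ℝ × ℝ) ≃ₗ[ℝ] (ℝ × ℝ), ∀ v, Θ (D t (A v)) = Θ (D 0 v)) :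
    ∃ C : (ℝ × ℝ) →L[ℝ] (ℝ × ℝ), ∀ v, v ≠ 0 → fderiv ℝ Θ (D 0 v) (D 0 (C v) + D' v) = 0 := by
  obtain ⟨c, C, hc, hC, hb⟩ := hΘ.bounds
  obtain ⟨K, hK, hanti⟩ := LinearMap.exists_antilipschitzWith (D 0 : (ℝ × ℝ) →ₗ[ℝ] V)
    (LinearMap.ker_eq_bot'.2 hinj)
  have hK' : (0:ℝ) < K := hK
  have hDn : ∀ v, ‖v‖ ≤ K * ‖D 0 v‖ := fun v => by
    have := hanti.le_mul_dist v 0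
    simpa using this
  set R : ℝ := Real.sqrt (C * ‖D 0‖ ^ 2 * (4 * K ^ 2) / c) with hR
  have hRsq : R ^ 2 = C * ‖D 0‖ ^ 2 * (4 * K ^ 2) / c := Real.sq_sqrt (by positivity)
  have key : ∀ᶠ t in 𝓝 (0:ℝ), ∃ A : (ℝ × ℝ) →L[ℝ] (ℝ × ℝ), ‖A‖ ≤ R ∧
      ∀ v, Θ (D t (A v)) = Θ (D 0 v) := by
    have hclose : ∀ᶠ t in 𝓝 (0:ℝ), ‖D t - D 0‖ < 1 / (2 * K) := by
      have := hD.continuousAt.tendsto.sub_const (D 0)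
      rw [sub_self] at this
      have h2 := this.norm
      rw [norm_zero] at h2
      exact h2.eventually_lt_const (by positivity)
    filter_upwards [hA, hclose] with t ⟨A, hA⟩ ht
    refine ⟨LinearMap.toContinuousLinearMap (A : (ℝ × ℝ) →ₗ[ℝ] (ℝ × ℝ)), ?_, hA⟩
    refine ContinuousLinearMap.opNorm_le_bound _ (Real.sqrt_nonneg _) fun v => ?_
    show ‖A v‖ ≤ R * ‖v‖
    set w := A v with hw
    have h1 : ‖w‖ ≤ 2 * K * ‖D t w‖ := by
      have a1 := hDn w
      have a2 : ‖D 0 w‖ ≤ ‖D t w‖ + ‖(D t - D 0) w‖ := by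
        have : D 0 w = D t w - (D t - D 0) w := by simp
        rw [this]; exact norm_sub_le _ _
      have a3 : ‖(D t - D 0) w‖ ≤ 1 / (2 * K) * ‖w‖ :=
        ((D t - D 0).le_opNorm w).trans (mul_le_mul_of_nonneg_right ht.le (norm_nonneg _))
      have a4 : (K:ℝ) * (1 / (2 * K) * ‖w‖) = ‖w‖ / 2 := by field_simp
      have a5 : (K:ℝ) * ‖D 0 w‖ ≤ K * (‖D t w‖ + 1 / (2 * K) * ‖w‖) :=
        mul_le_mul_of_nonneg_left (a2.trans (by linarith)) hK'.le
      nlinarith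
    have h2 : c * ‖D t w‖ ^ 2 ≤ C * (‖D 0‖ * ‖v‖) ^ 2 := by
      refine (hb _).1.trans ?_
      rw [hw, hA]
      refine (hb _).2.trans ?_
      gcongr
      exact (D 0).le_opNorm v
    apply abs_le_of_sq_le_sq' _ (by positivity) |>.2
    rw [mul_pow, hRsq, div_mul_eq_mul_div, le_div_iff₀ hc]
    calc ‖w‖ ^ 2 * c ≤ (2 * K * ‖D t w‖) ^ 2 * c := by gcongr
      _ = 4 * K ^ 2 * (c * ‖D t w‖ ^ 2) := by ring
      _ ≤ 4 * K ^ 2 * (C * (‖D 0‖ * ‖v‖) ^ 2) := by gcongr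
      _ = _ := by ring
  obtain ⟨s, hs, hs0, hP⟩ := pos_seq key
  choose A hAn hAv using hP
  obtain ⟨A0, -, ψ, hψ, hlim⟩ := (isCompact_closedBall (0 : (ℝ × ℝ) →L[ℝ] (ℝ × ℝ)) R).tendsto_subseq
    (x := A) (fun k => by simpa using hAn k)
  have hsψ : Tendsto (fun k => s (ψ k)) atTop (𝓝 0) := hs0.comp hψ.tendsto_atTop
  have hDψ : Tendsto (fun k => D (s (ψ k))) atTop (𝓝 (D 0)) := hD.continuousAt.tendsto.comp hsψ
  have hA0 : ∀ v, Θ (D 0 (A0 v)) = Θ (D 0 v) := by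
    intro v
    have h1 : Tendsto (fun k => D (s (ψ k)) (A (ψ k) v)) atTop (𝓝 (D 0 (A0 v))) :=
      tclm hDψ (tclm hlim tendsto_const_nhds)
    have h2 := (hΘ.continuous.tendsto _).comp h1
    refine tendsto_nhds_unique h2 (tendsto_const_nhds.congr fun k => ?_)
    exact (hAv (ψ k) v).symm
  have hA0inj : Function.Injective (A0 : (ℝ × ℝ) →ₗ[ℝ] (ℝ × ℝ)) := by
    refine LinearMap.ker_eq_bot.1 (LinearMap.ker_eq_bot'.2 fun v hv => ?_)
    have hv : A0 v = 0 := hv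
    by_contra hv0
    have h1 := hA0 v
    rw [hv, map_zero, hΘ.zero] at h1
    exact (hΘ.1 (D 0 v) fun h => hv0 (hinj v h)).ne h1
  let Ae := LinearEquiv.ofInjectiveEndo (A0 : (ℝ × ℝ) →ₗ[ℝ] (ℝ × ℝ)) hA0inj
  let Ai : (ℝ × ℝ) →L[ℝ] (ℝ × ℝ) := LinearMap.toContinuousLinearMap (Ae.symm : (ℝ × ℝ) →ₗ[ℝ] (ℝ × ℝ))
  have hAi : ∀ v, A0 (Ai v) = v := fun v => Ae.apply_symm_apply v
  set A' : ℕ → (ℝ × ℝ) →L[ℝ] (ℝ × ℝ) := fun k => (A (ψ k)).comp Ai with hA'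
  have hA'v : ∀ k v, Θ (D (s (ψ k)) (A' k v)) = Θ (D 0 v) := by
    intro k v
    show Θ (D (s (ψ k)) (A (ψ k) (Ai v))) = _
    rw [hAv, ← hA0 (Ai v), hAi]
  have hA'lim : ∀ v, Tendsto (fun k => A' k v) atTop (𝓝 v) := by
    intro v
    have : Tendsto (fun k => A (ψ k) (Ai v)) atTop (𝓝 (A0 (Ai v))) :=
      tclm hlim tendsto_const_nhds
    rwa [hAi] at this
  obtain ⟨χ, hχ, τ, X, hne, hτ, hX⟩ := seq_lemma (fun k => s (ψ k)) (fun k => hs _)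
    (fun k => A' k - ContinuousLinearMap.id ℝ (ℝ × ℝ))
  set cc : ℕ → ℝ := fun k => ‖(s (ψ (χ k)), A' (χ k) - ContinuousLinearMap.id ℝ (ℝ × ℝ))‖⁻¹ with hcc
  have hsχ : Tendsto (fun k => s (ψ (χ k))) atTop (𝓝 0) := hsψ.comp hχ.tendsto_atTop
  have hDχ : Tendsto (fun k => D (s (ψ (χ k)))) atTop (𝓝 (D 0)) := hDψ.comp hχ.tendsto_atTop
  have hslope : Tendsto (fun k => cc k • (D (s (ψ (χ k))) - D 0)) atTop (𝓝 (τ • D')) :=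
    slope_seq hD (fun k => hs _) hsχ hτ
  have main : ∀ v, v ≠ 0 → fderiv ℝ Θ (D 0 v) (τ • D' v + D 0 (X v)) = 0 := by
    intro v hv
    have hv' : D 0 v ≠ 0 := fun h => hv (hinj v h)
    have hAχ : Tendsto (fun k => A' (χ k) v) atTop (𝓝 v) := (hA'lim v).comp hχ.tendsto_atTop
    have d0 : Tendsto (fun k => D (s (ψ (χ k))) (A' (χ k) v) - D 0 v) atTop (𝓝 0) := by
      have := (tclm hDχ hAχ).sub_const (D 0 v)
      rwa [sub_self] at this
    have cd : Tendsto (fun k => cc k • (D (s (ψ (χ k))) (A' (χ k) v) - D 0 v)) atTop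
        (𝓝 (τ • D' v + D 0 (X v))) := by
      have h1 := tclm hslope hAχ
      have h2 : Tendsto (fun k => D 0 ((cc k • (A' (χ k) - ContinuousLinearMap.id ℝ (ℝ × ℝ))) v)) atTop
        (𝓝 (D 0 (X v))) := ((D 0).continuous.tendsto _).comp (tclm hX tendsto_const_nhds)
      refine (h1.add h2).congr fun k => ?_
      simp only [smul_apply, sub_apply, map_smul, map_sub, ContinuousLinearMap.id_apply]
      module
    have := (hasFDerivWithinAt_univ.2 (hΘ.hasFDerivAt hv')).lim d0
      (Eventually.of_forall fun _ => mem_univ _) cd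
    refine tendsto_nhds_unique this (tendsto_const_nhds.congr fun k => ?_)
    rw [add_sub_cancel, hA'v]; simp
  have hτ0 : τ ≠ 0 := by
    intro h0
    have hX0 : X ≠ 0 := hne.resolve_left (by simp [h0])
    apply hX0
    apply lemma_L (hΘ.comp (D 0) hinj) hN
    intro v hv
    rw [hΘ.fderiv_comp (D 0) hinj hv]
    have := main v hv
    simpa [h0] using this
  refine ⟨τ⁻¹ • X, fun v hv => ?_⟩
  have h1 := main v hv
  have h2 : D 0 ((τ⁻¹ • X) v) + D' v = τ⁻¹ • (τ • D' v + D 0 (X v)) := by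
    rw [smul_add, smul_smul, inv_mul_cancel₀ hτ0, one_smul, smul_apply, map_smul, add_comm]
  rw [h2, map_smul, h1, smul_zero]

lemma lemma_M {V : Type*} [NormedAddCommGroup V] [NormedSpace ℝ V] [FiniteDimensional ℝ V]
    {Θ : V → ℝ} (hΘ : Good Θ) (D : ℝ → (ℝ × ℝ) →L[ℝ] V) (D' : (ℝ × ℝ) →L[ℝ] V)
    (hD : HasDerivAt D D' 0) (hinj : ∀ v, D 0 v = 0 → v = 0) (N : V) (u0 : ℝ × ℝ)
    (hu0 : ∀ v, v ≠ 0 → fderiv ℝ Θ (D 0 v) (D 0 u0 + N) = 0)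
    (hA : ∀ᶠ t in 𝓝 (0:ℝ), ∃ u, ∀ v, v ≠ 0 → fderiv ℝ Θ (D t v) (D t u + N) = 0) :
    ∃ c : ℝ × ℝ, ∀ v, v ≠ 0 → fderiv ℝ Θ (D 0 v) (D 0 c + D' u0)
      + fderiv ℝ (fderiv ℝ Θ) (D 0 v) (D' v) (D 0 u0 + N) = 0 := by
  obtain ⟨s, hs, hs0, hP⟩ := pos_seq hA
  choose u hu using hP
  obtain ⟨χ, hχ, τ, X, hne, hτ, hX⟩ := seq_lemma s hs (fun k => u k - u0)
  set cc : ℕ → ℝ := fun k => ‖(s (χ k), u (χ k) - u0)‖⁻¹ with hcc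
  have hsχ : Tendsto (fun k => s (χ k)) atTop (𝓝 0) := hs0.comp hχ.tendsto_atTop
  have hDχ : Tendsto (fun k => D (s (χ k))) atTop (𝓝 (D 0)) := hD.continuousAt.tendsto.comp hsχ
  have hslope : Tendsto (fun k => cc k • (D (s (χ k)) - D 0)) atTop (𝓝 (τ • D')) :=
    slope_seq hD (fun k => hs _) hsχ hτ
  have main : ∀ v, v ≠ 0 → fderiv ℝ Θ (D 0 v) (D 0 X + τ • D' u0)
      + τ * fderiv ℝ (fderiv ℝ Θ) (D 0 v) (D' v) (D 0 u0 + N) = 0 := by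
    intro v hv
    have hv' : D 0 v ≠ 0 := fun h => hv (hinj v h)
    have hd1 : HasDerivAt (fun t => D t v) (D' v) 0 := by
      simpa using hD.clm_apply (hasDerivAt_const (0:ℝ) v)
    have hd2 : HasDerivAt (fun t => fderiv ℝ Θ (D t v)) (fderiv ℝ (fderiv ℝ Θ) (D 0 v) (D' v)) 0 :=
      HasFDerivAt.comp_hasDerivAt (f := fun t => D t v) (0:ℝ) (hΘ.hasFDerivAt2 hv') hd1
    have hsl2 := slope_seq hd2 (s := fun k => s (χ k)) (c := cc) (fun k => hs _) hsχ hτ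
    have hT : Tendsto (fun k => fderiv ℝ Θ (D (s (χ k)) v)) atTop (𝓝 (fderiv ℝ Θ (D 0 v))) :=
      hd2.continuousAt.tendsto.comp hsχ
    have h1 := tclm hT ((tclm hDχ hX).add (tclm hslope (tendsto_const_nhds (x := u0))))
    have h2 := tclm hsl2 (tendsto_const_nhds (x := D 0 u0 + N))
    refine tendsto_nhds_unique (h1.add h2) (tendsto_const_nhds.congr fun k => ?_)
    have e1 := hu (χ k) v hv
    have e2 := hu0 v hv
    simp only [smul_apply, sub_apply, map_smul, map_sub, map_add, smul_eq_mul] at e1 e2 ⊢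
    linear_combination (-cc k) * e1 + cc k * e2
  have hτ0 : τ ≠ 0 := by
    intro h0
    have hX0 : X ≠ 0 := hne.resolve_left (by simp [h0])
    have := main X hX0
    rw [h0] at this
    have hX' : D 0 X ≠ 0 := fun h => hX0 (hinj X h)
    simp [hΘ.euler hX'] at this
    exact (hΘ.1 _ hX').ne' this
  refine ⟨τ⁻¹ • X, fun v hv => ?_⟩
  have h1 := main v hv
  simp only [map_add, map_smul, smul_eq_mul] at h1 ⊢
  field_simp
  linear_combination h1

lemma dual_basis (h1 h2 : (ℝ × ℝ) →L[ℝ] ℝ)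
    (hd : h1 (1,0) * h2 (0,1) - h1 (0,1) * h2 (1,0) ≠ 0) :
    ∃ a1 a2 : ℝ × ℝ, h1 a1 = 1 ∧ h1 a2 = 0 ∧ h2 a1 = 0 ∧ h2 a2 = 1 ∧
      ∀ v, v = h1 v • a1 + h2 v • a2 := by
  have e : ∀ (h : (ℝ × ℝ) →L[ℝ] ℝ) (v : ℝ × ℝ), h v = v.1 * h (1,0) + v.2 * h (0,1) := by
    intro h v
    rw [← smul_eq_mul, ← smul_eq_mul, ← map_smul, ← map_smul, ← map_add]
    congr 1; ext <;> simp
  set d := h1 (1,0) * h2 (0,1) - h1 (0,1) * h2 (1,0) with hdd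
  refine ⟨(h2 (0,1) / d, - h2 (1,0) / d), (- h1 (0,1) / d, h1 (1,0) / d), ?_, ?_, ?_, ?_, ?_⟩
  · rw [e]; field_simp; rw [hdd]; ring
  · rw [e]; field_simp; ring
  · rw [e]; field_simp; ring
  · rw [e]; field_simp; rw [hdd]; ring
  · intro v
    rw [e h1 v, e h2 v]
    ext
    · simp only [Prod.fst_add, Prod.smul_fst, smul_eq_mul]; field_simp; rw [hdd]; ring
    · simp only [Prod.snd_add, Prod.smul_snd, smul_eq_mul]; field_simp; rw [hdd]; ring

lemma stage1 {V : Type*} [NormedAddCommGroup V] [NormedSpace ℝ V]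
    {Θ : V → ℝ} (hΘ : Good Θ) (D : (ℝ × ℝ) →L[ℝ] V) (hinj : ∀ v, D v = 0 → v = 0)
    (hN : NE fun v => Θ (D v)) (N : V) (S1 : V →L[ℝ] (ℝ × ℝ)) (ν : V →L[ℝ] ℝ)
    (hdec : ∀ w, w = D (S1 w) + ν w • N) (P1 P2 : (ℝ × ℝ) →L[ℝ] V)
    (hd : ν (P1 (1,0)) * ν (P2 (0,1)) - ν (P1 (0,1)) * ν (P2 (1,0)) ≠ 0)
    (C1 C2 : (ℝ × ℝ) →L[ℝ] (ℝ × ℝ))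
    (hC1 : ∀ v, v ≠ 0 → fderiv ℝ Θ (D v) (D (C1 v) + P1 v) = 0)
    (hC2 : ∀ v, v ≠ 0 → fderiv ℝ Θ (D v) (D (C2 v) + P2 v) = 0) :
    ∃ u, ∀ v, v ≠ 0 → fderiv ℝ Θ (D v) (D u + N) = 0 := by
  obtain ⟨a1, a2, h11, h12, h21, h22, hsp⟩ := dual_basis (ν.comp P1) (ν.comp P2) hd
  have aux : ∀ (P : (ℝ × ℝ) →L[ℝ] V) (C : (ℝ × ℝ) →L[ℝ] (ℝ × ℝ)),
      (∀ v, v ≠ 0 → fderiv ℝ Θ (D v) (D (C v) + P v) = 0) →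
      ∀ v, v ≠ 0 → fderiv ℝ (fun v => Θ (D v)) v ((C + S1.comp P) v)
        = (ν.comp P) v * (- fderiv ℝ Θ (D v) N) := by
    intro P C h v hv
    rw [hΘ.fderiv_comp D hinj hv]
    have h1 := h v hv
    have h2 := congrArg (fderiv ℝ Θ (D v)) (hdec (P v))
    simp only [map_add, map_smul, smul_eq_mul, add_apply, ContinuousLinearMap.comp_apply] at h1 h2 ⊢
    linear_combination h1 - h2
  obtain ⟨u, hu⟩ := lemma_U (hΘ.comp D hinj) hN (fun v => - fderiv ℝ Θ (D v) N) _ _ a1 a2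
    h11 h12 h21 h22 hsp _ _ (aux P1 C1 hC1) (aux P2 C2 hC2)
  refine ⟨u, fun v hv => ?_⟩
  have := hu v hv
  rw [hΘ.fderiv_comp D hinj hv] at this
  rw [map_add, this]; ring

lemma stage2 {V : Type*} [NormedAddCommGroup V] [NormedSpace ℝ V]
    {Θ : V → ℝ} (hΘ : Good Θ) (D : (ℝ × ℝ) →L[ℝ] V) (hinj : ∀ v, D v = 0 → v = 0)
    (hN : NE fun v => Θ (D v)) (N : V) (S1 : V →L[ℝ] (ℝ × ℝ)) (ν : V →L[ℝ] ℝ)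
    (hdec : ∀ w, w = D (S1 w) + ν w • N) (P1 P2 : (ℝ × ℝ) →L[ℝ] V)
    (hd : ν (P1 (1,0)) * ν (P2 (0,1)) - ν (P1 (0,1)) * ν (P2 (1,0)) ≠ 0)
    (u0 : ℝ × ℝ) (hu0 : ∀ v, v ≠ 0 → fderiv ℝ Θ (D v) (D u0 + N) = 0)
    (c1 c2 : ℝ × ℝ)
    (hC1 : ∀ v, v ≠ 0 → fderiv ℝ Θ (D v) (D c1 + P1 u0)
      + fderiv ℝ (fderiv ℝ Θ) (D v) (P1 v) (D u0 + N) = 0)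
    (hC2 : ∀ v, v ≠ 0 → fderiv ℝ Θ (D v) (D c2 + P2 u0)
      + fderiv ℝ (fderiv ℝ Θ) (D v) (P2 v) (D u0 + N) = 0) :
    ∃ v, v ≠ 0 ∧ fderiv ℝ (fderiv ℝ Θ) (D v) (D u0 + N) (D u0 + N) = 0 := by
  obtain ⟨a1, a2, h11, h12, h21, h22, hsp⟩ := dual_basis (ν.comp P1) (ν.comp P2) hd
  simp only [ContinuousLinearMap.comp_apply] at h11 h12 h21 h22
  set n := D u0 + N with hn
  have hDn : ∀ v, v ≠ 0 → ∀ w, fderiv ℝ (fderiv ℝ Θ) (D v) (D w) n = 0 := by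
    intro v hv w
    have hv' : D v ≠ 0 := fun h => hv (hinj v h)
    have h1 : HasFDerivAt (fun v => fderiv ℝ Θ (D v)) ((fderiv ℝ (fderiv ℝ Θ) (D v)).comp D) v :=
      (hΘ.hasFDerivAt2 hv').comp v D.hasFDerivAt
    have h2 := h1.clm_apply (hasFDerivAt_const n v)
    have h3 : (fun v => fderiv ℝ Θ (D v) n) =ᶠ[𝓝 v] fun _ => (0:ℝ) := by
      filter_upwards [isOpen_compl_singleton.mem_nhds hv] with y hy
      exact hu0 y hy
    have h4 := h2.unique ((hasFDerivAt_const (0:ℝ) v).congr_of_eventuallyEq h3)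
    have := congrArg (fun T => T w) h4
    simpa using this
  have aux : ∀ (P : (ℝ × ℝ) →L[ℝ] V) (c : ℝ × ℝ),
      (∀ v, v ≠ 0 → fderiv ℝ Θ (D v) (D c + P u0)
        + fderiv ℝ (fderiv ℝ Θ) (D v) (P v) n = 0) →
      ∀ v, v ≠ 0 → fderiv ℝ Θ (D v) (D (c + S1 (P u0) - ν (P u0) • u0))
        + ν (P v) * fderiv ℝ (fderiv ℝ Θ) (D v) n n = 0 := by
    intro P c h v hv
    have h1 := h v hv
    have h2 := congrArg (fderiv ℝ Θ (D v)) (hdec (P u0))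
    have h3 := congrArg (fun z => fderiv ℝ (fderiv ℝ Θ) (D v) z n) (hdec (P v))
    have h4 := hu0 v hv
    have h5 := hDn v hv (S1 (P v))
    have h6 := hDn v hv u0
    have h7 : fderiv ℝ (fderiv ℝ Θ) (D v) n n = fderiv ℝ (fderiv ℝ Θ) (D v) (D u0) n
      + fderiv ℝ (fderiv ℝ Θ) (D v) N n := by
      have h8 : fderiv ℝ (fderiv ℝ Θ) (D v) n = fderiv ℝ (fderiv ℝ Θ) (D v) (D u0)
          + fderiv ℝ (fderiv ℝ Θ) (D v) N := by rw [hn, map_add]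
      rw [h8, add_apply]
    rw [h7]
    simp only [map_add, map_sub, map_smul, smul_eq_mul, add_apply, smul_apply] at h1 h2 h3 ⊢
    rw [hn, map_add] at h4
    linear_combination h1 - h2 - h3 - ν (P u0) * h4 - h5 + ν (P v) * h6
  have b1 := aux P1 c1 hC1
  have b2 := aux P2 c2 hC2
  set c1' := c1 + S1 (P1 u0) - ν (P1 u0) • u0
  set c2' := c2 + S1 (P2 u0) - ν (P2 u0) • u0
  have hL := lemma_L (hΘ.comp D hinj) hN
    ((ν.comp P2).smulRight c1' - (ν.comp P1).smulRight c2') (by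
      intro v hv
      rw [hΘ.fderiv_comp D hinj hv]
      have e1 := b1 v hv
      have e2 := b2 v hv
      simp only [map_sub, map_smul, smul_eq_mul, sub_apply, ContinuousLinearMap.smulRight_apply,
        ContinuousLinearMap.comp_apply]
      linear_combination ν (P2 v) * e1 - ν (P1 v) * e2)
  have hc1 : c1' = 0 := by
    have := congrArg (fun T => T a2) hL
    simpa [h12, h22] using this
  have ha1 : a1 ≠ 0 := by
    rintro rfl; simp at h11
  refine ⟨a1, ha1, ?_⟩
  have := b1 a1 ha1
  simpa [hc1, h11] using this

end SecProof

open Filter Topology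

theorem statement2 (U : Set (ℝ × ℝ)) (hU : IsOpen U)
    (φ : ℝ × ℝ → ℝ × ℝ → ℝ) (hφ : IsFinslerMetric U φ)
    (hmono : ∀ x ∈ U, ∀ y ∈ U, ∃ A : (ℝ × ℝ) ≃ₗ[ℝ] (ℝ × ℝ),
      ∀ v : ℝ × ℝ, φ y (A v) = φ x v)
    (hnonriem : ∃ x₀ ∈ U, ¬ IsEuclideanNorm (φ x₀))
    (V : Type*) [NormedAddCommGroup V] [NormedSpace ℝ V] [FiniteDimensional ℝ V]
    (hdim : Module.finrank ℝ V = 3)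
    (Φ : V → ℝ) (hΦ : IsBanachMinkowski Φ)
    (f : ℝ × ℝ → V) (hf : IsIsometricEmbedding U φ Φ f) :
    ∀ p ∈ U, ∃ w : ℝ × ℝ, w ≠ 0 ∧
      ∀ u : ℝ × ℝ, iteratedFDeriv ℝ 2 f p ![w, u] ∈ Set.range (fderiv ℝ f p) := by
  intro p hp
  by_contra hcon
  push Not at hcon
  obtain ⟨hfs, -, hiso⟩ := hf
  obtain ⟨hΦ0, hΦpos, hΦhom, -, hΦs, hΦconv⟩ := hΦ
  set Θ : V → ℝ := fun v => Φ v ^ 2 with hΘd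
  have hΘ : Good Θ := by
    refine ⟨fun v hv => pow_pos (hΦpos v hv) 2, fun t ht v => ?_, ?_⟩
    · simp only [hΘd]; rw [hΦhom t ht]; ring
    · exact (hΦs.pow 2).of_le (WithTop.coe_le_coe.2 (le_top : (2 : ℕ∞) ≤ ⊤))
  set D : ℝ × ℝ → (ℝ × ℝ) →L[ℝ] V := fderiv ℝ f with hDd
  set D2 : ℝ × ℝ → (ℝ × ℝ) →L[ℝ] (ℝ × ℝ) →L[ℝ] V := fderiv ℝ D with hD2d
  have hsm : ∀ x ∈ U, ContDiffAt ℝ (⊤ : ℕ∞) f x := fun x hx => hfs.contDiffAt (hU.mem_nhds hx)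
  have hD1 : ∀ x ∈ U, ContDiffAt ℝ (⊤ : ℕ∞) D x := fun x hx =>
    (hsm x hx).fderiv_right (m := (⊤ : ℕ∞)) (by exact_mod_cast le_top)
  have hDfd : ∀ x ∈ U, HasFDerivAt D (D2 x) x := fun x hx =>
    ((hD1 x hx).differentiableAt (by simp)).hasFDerivAt
  have hD2c : ContinuousAt D2 p :=
    ((hD1 p hp).fderiv_right (m := (⊤ : ℕ∞)) (by exact_mod_cast le_top)).continuousAt
  have hφΘ : ∀ x ∈ U, ∀ v, φ x v ^ 2 = Θ (D x v) := fun x hx v => by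
    simp only [hΘd, hDd]; rw [hiso x hx]
  have hinj : ∀ x ∈ U, ∀ v, D x v = 0 → v = 0 := by
    intro x hx v hv
    by_contra h0
    have h1 := (hφ.2 x hx).2.1 v h0
    have h2 := hiso x hx v
    rw [show fderiv ℝ f x v = 0 from hv, hΦ0] at h2
    linarith
  have hNE : ∀ x ∈ U, NE fun v => Θ (D x v) := by
    rintro x hx ⟨Q, hQ, hQv⟩
    obtain ⟨x0, hx0, hx0n⟩ := hnonriem
    obtain ⟨A, hA⟩ := hmono x0 hx0 x hx
    apply hx0n
    refine ⟨Q.comp (A : (ℝ × ℝ) →ₗ[ℝ] (ℝ × ℝ)), fun v hv => ?_, fun v => ?_⟩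
    · exact hQ (A v) (by simpa using hv)
    · rw [← hA v, hφΘ x hx]; exact hQv (A v)
  have hline : ∀ x ∈ U, ∀ β, HasDerivAt (fun t : ℝ => D (x + t • β)) (D2 x β) 0 := by
    intro x hx β
    have h1 : HasDerivAt (fun t : ℝ => x + t • β) β 0 := by
      simpa using ((hasDerivAt_id (0:ℝ)).smul_const β).const_add x
    have h2 : HasFDerivAt D (D2 x) (x + (0:ℝ) • β) := by simpa using hDfd x hx
    exact HasFDerivAt.comp_hasDerivAt (f := fun t : ℝ => x + t • β) (0:ℝ) h2 h1
  have hlineU : ∀ x (P : ℝ × ℝ → Prop), (∀ᶠ y in 𝓝 x, P y) → ∀ β : ℝ × ℝ,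
      ∀ᶠ t : ℝ in 𝓝 0, P (x + t • β) := by
    intro x P hP β
    have h1 : Tendsto (fun t : ℝ => x + t • β) (𝓝 0) (𝓝 x) := by
      have : Continuous (fun t : ℝ => x + t • β) := by fun_prop
      simpa using this.tendsto 0
    exact h1.eventually hP
  -- first stage compactness
  have hK : ∀ x ∈ U, ∀ β, ∃ C : (ℝ × ℝ) →L[ℝ] (ℝ × ℝ), ∀ v, v ≠ 0 →
      fderiv ℝ Θ (D x v) (D x (C v) + D2 x β v) = 0 := by
    intro x hx β
    have := lemma_K hΘ (fun t : ℝ => D (x + t • β)) (D2 x β) (hline x hx β)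
    simp only [zero_smul, add_zero] at this
    refine this (hinj x hx) (hNE x hx) ?_
    filter_upwards [hlineU x _ (hU.mem_nhds hx) β] with t ht
    obtain ⟨A, hA⟩ := hmono x hx _ ht
    exact ⟨A, fun v => by rw [← hφΘ _ ht, ← hφΘ _ hx, hA]⟩
  -- frame
  obtain ⟨N, hN⟩ : ∃ N : V, N ∉ LinearMap.range (D p : (ℝ × ℝ) →ₗ[ℝ] V) := by
    by_contra hall
    push Not at hall
    have htop : LinearMap.range (D p : (ℝ × ℝ) →ₗ[ℝ] V) = ⊤ := by
      rw [eq_top_iff]; exact fun v _ => hall v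
    have h1 := LinearMap.finrank_range_le (D p : (ℝ × ℝ) →ₗ[ℝ] V)
    rw [htop, finrank_top, hdim] at h1
    norm_num at h1
  let T : ℝ × ℝ → ((ℝ × ℝ) × ℝ) →L[ℝ] V := fun x =>
    (D x).comp (ContinuousLinearMap.fst ℝ (ℝ × ℝ) ℝ)
      + (ContinuousLinearMap.snd ℝ (ℝ × ℝ) ℝ).smulRight N
  have hTv : ∀ x y, T x y = D x y.1 + y.2 • N := fun x y => rfl
  have hTc : ContinuousAt T p := by
    have hc : ContinuousAt D p := (hDfd p hp).continuousAt
    exact (hc.clm_comp continuousAt_const).add continuousAt_const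
  have hTinj : Function.Injective (T p : ((ℝ × ℝ) × ℝ) →ₗ[ℝ] V) := by
    refine LinearMap.ker_eq_bot.1 (LinearMap.ker_eq_bot'.2 fun y hy => ?_)
    have hy : D p y.1 + y.2 • N = 0 := hy
    have h2 : y.2 = 0 := by
      by_contra h2
      apply hN
      refine ⟨-(y.2⁻¹ • y.1), ?_⟩
      have : N = y.2⁻¹ • (y.2 • N) := by rw [smul_smul, inv_mul_cancel₀ h2, one_smul]
      rw [this, eq_neg_of_add_eq_zero_right hy]
      simp
    rw [h2, zero_smul, add_zero] at hy
    exact Prod.ext (hinj p hp _ hy) h2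
  let e0 : ((ℝ × ℝ) × ℝ) ≃L[ℝ] V :=
    (LinearEquiv.ofInjectiveOfFinrankEq (T p : ((ℝ × ℝ) × ℝ) →ₗ[ℝ] V) hTinj
      (by rw [hdim]; simp)).toContinuousLinearEquiv
  have he0 : (e0 : ((ℝ × ℝ) × ℝ) →L[ℝ] V) = T p := by
    refine ContinuousLinearMap.ext fun y => rfl
  let S : ℝ × ℝ → V →L[ℝ] ((ℝ × ℝ) × ℝ) := fun x => (T x).inverse
  have hSc : ContinuousAt S p := by
    have h1 : ContinuousAt (ContinuousLinearMap.inverse : (((ℝ × ℝ) × ℝ) →L[ℝ] V) → _) (T p) := by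
      rw [← he0]; exact (contDiffAt_map_inverse (𝕜 := ℝ) (n := 1) e0).continuousAt
    exact ContinuousAt.comp (f := T) h1 hTc
  have hTS : ∀ᶠ x in 𝓝 p, ∀ w, T x (S x w) = w := by
    have h1 : ∀ᶠ x in 𝓝 p, T x ∈ Set.range ((↑) : (((ℝ × ℝ) × ℝ) ≃L[ℝ] V) → _) := by
      apply hTc
      rw [← he0]; exact ContinuousLinearEquiv.nhds e0
    filter_upwards [h1] with x ⟨e, he⟩ w
    simp only [S]
    rw [← he, ContinuousLinearMap.inverse_equiv]
    simp
  let S1 : ℝ × ℝ → V →L[ℝ] (ℝ × ℝ) := fun x => (ContinuousLinearMap.fst ℝ (ℝ × ℝ) ℝ).comp (S x)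
  let ν : ℝ × ℝ → V →L[ℝ] ℝ := fun x => (ContinuousLinearMap.snd ℝ (ℝ × ℝ) ℝ).comp (S x)
  have hdec : ∀ᶠ x in 𝓝 p, ∀ w, w = D x (S1 x w) + ν x w • N := by
    filter_upwards [hTS] with x hx w
    exact (hx w).symm
  have hdecp := hdec.self_of_nhds
  let det : ℝ × ℝ → ℝ := fun x => ν x (D2 x (1,0) (1,0)) * ν x (D2 x (0,1) (0,1))
    - ν x (D2 x (1,0) (0,1)) * ν x (D2 x (0,1) (1,0))
  have hνc : ContinuousAt ν p := continuousAt_const.clm_comp hSc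
  have hdetc : ContinuousAt det p := by
    have : ∀ a b, ContinuousAt (fun x => ν x (D2 x a b)) p := fun a b =>
      hνc.clm_apply ((hD2c.clm_apply continuousAt_const).clm_apply continuousAt_const)
    exact ((this _ _).mul (this _ _)).sub ((this _ _).mul (this _ _))
  have hdetp : det p ≠ 0 := by
    intro h0
    have hno : ∀ w : ℝ × ℝ, w ≠ 0 → ¬ (ν p (D2 p w (1,0)) = 0 ∧ ν p (D2 p w (0,1)) = 0) := by
      rintro w hw ⟨h1, h2⟩
      obtain ⟨u, hu⟩ := hcon w hw
      apply hu
      rw [iteratedFDeriv_two_apply]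
      refine ⟨S1 p (D2 p w u), ?_⟩
      have h3 : ν p (D2 p w u) = 0 := by
        have hu' : u = u.1 • (1,0) + u.2 • (0,1) := by ext <;> simp
        rw [hu']; simp only [map_add, map_smul, h1, h2]; simp
      have := hdecp (D2 p w u)
      rw [h3, zero_smul, add_zero] at this
      exact this.symm
    set r1 : ℝ × ℝ := (ν p (D2 p (1,0) (1,0)), ν p (D2 p (1,0) (0,1))) with hr1
    set r2 : ℝ × ℝ := (ν p (D2 p (0,1) (1,0)), ν p (D2 p (0,1) (0,1))) with hr2
    have hr : wedge r1 r2 = 0 := by simpa [wedge] using h0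
    have hr1n : r1 ≠ 0 := fun h => hno (1,0) (by simp)
      ⟨congrArg Prod.fst h, congrArg Prod.snd h⟩
    obtain ⟨l, hl⟩ := wedge_par hr1n hr
    have hl1 := congrArg Prod.fst hl
    have hl2 := congrArg Prod.snd hl
    simp only [hr1, hr2, Prod.smul_fst, Prod.smul_snd, smul_eq_mul] at hl1 hl2
    have hw : ((-l, 1) : ℝ × ℝ) = (-l) • (1,0) + (0,1) := by ext <;> simp
    refine hno (-l, 1) (by simp) ?_
    rw [hw]
    simp only [map_add, map_smul, add_apply, smul_apply, smul_eq_mul, hl1, hl2]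
    constructor <;> ring
  have hst1 : ∀ᶠ x in 𝓝 p, ∃ u, ∀ v, v ≠ 0 → fderiv ℝ Θ (D x v) (D x u + N) = 0 := by
    filter_upwards [hU.mem_nhds hp, hdec, hdetc.eventually_ne hdetp] with x hx hxd hxdet
    obtain ⟨C1, hC1⟩ := hK x hx (1,0)
    obtain ⟨C2, hC2⟩ := hK x hx (0,1)
    exact stage1 hΘ (D x) (hinj x hx) (hNE x hx) N (S1 x) (ν x) hxd _ _ hxdet C1 C2 hC1 hC2
  obtain ⟨u0, hu0⟩ := hst1.self_of_nhds
  have hM : ∀ β, ∃ c : ℝ × ℝ, ∀ v, v ≠ 0 → fderiv ℝ Θ (D p v) (D p c + D2 p β u0)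
      + fderiv ℝ (fderiv ℝ Θ) (D p v) (D2 p β v) (D p u0 + N) = 0 := by
    intro β
    have := lemma_M hΘ (fun t : ℝ => D (p + t • β)) (D2 p β) (hline p hp β)
    simp only [zero_smul, add_zero] at this
    exact this (hinj p hp) N u0 hu0 (hlineU p _ hst1 β)
  obtain ⟨c1, hc1⟩ := hM (1,0)
  obtain ⟨c2, hc2⟩ := hM (0,1)
  obtain ⟨v, hv, hzero⟩ := stage2 hΘ (D p) (hinj p hp) (hNE p hp) N (S1 p) (ν p) hdecp _ _ hdetp
    u0 hu0 c1 c2 hc1 hc2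
  have hn : D p u0 + N ≠ 0 := by
    intro h
    apply hN
    refine ⟨-u0, ?_⟩
    rw [eq_neg_of_add_eq_zero_right h]; simp
  have hpos := hΦconv (D p v) (fun h => hv (hinj p hp v h)) _ hn
  rw [iteratedFDeriv_two_apply] at hpos
  exact hpos.ne' hzero
end
end

section
/- Let φ be a Finsler metric on an open set U ⊆ ℝ² and p ∈ U, and suppose φ is second-order flat at p: for every v ∈ ℝ²∖{0}, the first and second derivatives of the map x ↦ φ(x, v) vanish at x = p. Let (V, Φ) be a 3-dimensional Banach–Minkowski space and f : U → V an isometric embedding of (U, φ). Then the second fundamental form of f at p is degenerate: there exists w ∈ ℝ²∖{0} such that D²f_p(w, u) ∈ range(Df_p) for all u ∈ ℝ². -/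
noncomputable section

lemma auxA_dense (μ : ℝ × ℝ → (ℝ × ℝ) →L[ℝ] ℝ) (hc : ∀ v, v ≠ 0 → ContinuousAt μ v)
    (hpos : ∀ v, v ≠ 0 → 0 < μ v v) (m w : ℝ × ℝ)
    (h : ∀ᶠ t : ℝ in nhdsWithin 0 {0}ᶜ, μ (m + t • w) m = 0) : m = 0 := by
  by_contra hm
  have h1 : ContinuousAt (fun t : ℝ => μ (m + t • w) m) 0 := by
    have h2 : ContinuousAt (fun t : ℝ => μ (m + t • w)) 0 := by
      apply ContinuousAt.comp (f := fun t : ℝ => m + t • w) (g := μ)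
      · simpa using hc m hm
      · fun_prop
    exact h2.clm_apply continuousAt_const
  have h3 : Filter.Tendsto (fun t : ℝ => μ (m + t • w) m) (nhdsWithin 0 {0}ᶜ) (nhds (μ m m)) := by
    have := h1.tendsto.mono_left (nhdsWithin_le_nhds (s := {(0:ℝ)}ᶜ))
    simpa using this
  have h4 : Filter.Tendsto (fun t : ℝ => μ (m + t • w) m) (nhdsWithin 0 {0}ᶜ) (nhds 0) := by
    apply Filter.Tendsto.congr' _ tendsto_const_nhds
    filter_upwards [h] with t ht using ht.symm
  have := tendsto_nhds_unique h3 h4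
  linarith [hpos m hm]

lemma auxA_ev (x : ℝ) : ∀ᶠ t : ℝ in nhdsWithin 0 {0}ᶜ, x + t ≠ 0 := by
  by_cases hx : x = 0
  · subst hx
    filter_upwards [self_mem_nhdsWithin] with t ht
    simpa using ht
  · apply Filter.Eventually.filter_mono nhdsWithin_le_nhds
    apply ContinuousAt.eventually_ne (by fun_prop)
    simpa using hx

lemma auxA_zero (D : (ℝ × ℝ) →L[ℝ] (ℝ × ℝ) →L[ℝ] (ℝ × ℝ)) (J : (ℝ × ℝ) →L[ℝ] (ℝ × ℝ)) :
    ∃ v : ℝ × ℝ, v ≠ 0 ∧ ∃ c : ℝ, D v (J v) = c • v := by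
  let v : ℝ → ℝ × ℝ := fun t => (Real.cos t, Real.sin t)
  have hv : Continuous v := by fun_prop
  let g : ℝ → ℝ := fun t => (v t).1 * (D (v t) (J (v t))).2 - (v t).2 * (D (v t) (J (v t))).1
  have hg : Continuous g := by fun_prop
  have hpi : g Real.pi = - g 0 := by
    have : v Real.pi = - v 0 := by ext <;> simp [v]
    simp only [g, this]; simp; ring
  have : ∃ t, g t = 0 := by
    have hh := mem_range_of_exists_le_of_exists_ge (c := 0) hg
    rcases le_total (g 0) 0 with h | h
    · exact hh ⟨0, h⟩ ⟨Real.pi, by rw [hpi]; linarith⟩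
    · exact hh ⟨Real.pi, by rw [hpi]; linarith⟩ ⟨0, h⟩
  obtain ⟨t, ht⟩ := this
  have hcs := Real.sin_sq_add_cos_sq t
  refine ⟨v t, ?_, ?_⟩
  · intro h
    have h1 : Real.cos t = 0 := congrArg Prod.fst h
    have h2 : Real.sin t = 0 := congrArg Prod.snd h
    rw [h1, h2] at hcs; norm_num at hcs
  · simp only [g] at ht
    generalize D (v t) (J (v t)) = y at ht ⊢
    simp only [v] at ht ⊢
    refine ⟨Real.cos t * y.1 + Real.sin t * y.2, ?_⟩
    ext
    · simp only [Prod.smul_mk, smul_eq_mul]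
      linear_combination (-y.1) * hcs - Real.sin t * ht
    · simp only [Prod.smul_mk, smul_eq_mul]
      linear_combination (-y.2) * hcs + Real.cos t * ht

lemma aux_span (v w : ℝ × ℝ) (h : v.1 * w.2 - v.2 * w.1 ≠ 0) (z : ℝ × ℝ) :
    ∃ x y : ℝ, z = x • v + y • w := by
  refine ⟨(z.1 * w.2 - z.2 * w.1) / (v.1 * w.2 - v.2 * w.1),
    (v.1 * z.2 - v.2 * z.1) / (v.1 * w.2 - v.2 * w.1), ?_⟩
  ext
  · simp only [Prod.fst_add, Prod.smul_fst, smul_eq_mul]; rw [div_mul_eq_mul_div, div_mul_eq_mul_div, ← add_div, eq_div_iff h]; ring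
  · simp only [Prod.snd_add, Prod.smul_snd, smul_eq_mul]; rw [div_mul_eq_mul_div, div_mul_eq_mul_div, ← add_div, eq_div_iff h]; ring

lemma auxA (μ : ℝ × ℝ → (ℝ × ℝ) →L[ℝ] ℝ) (hc : ∀ v, v ≠ 0 → ContinuousAt μ v)
    (hpos : ∀ v, v ≠ 0 → 0 < μ v v) (p q r : ℝ) (hd : p ^ 2 + q * r ≠ 0)
    (J : (ℝ × ℝ) →L[ℝ] (ℝ × ℝ)) (hJ : ∀ v, J v = (p * v.1 + r * v.2, q * v.1 - p * v.2))
    (D : (ℝ × ℝ) →L[ℝ] (ℝ × ℝ) →L[ℝ] (ℝ × ℝ)) (hs : ∀ v w, D v w = D w v)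
    (hD : ∀ v, v ≠ 0 → μ v (D v (J v)) = 0) : ∀ v, D v (J v) = 0 := by
  obtain ⟨v0, hv0, c, hcv⟩ := auxA_zero D J
  have hc0 : c = 0 := by
    have h1 := hD v0 hv0
    rw [hcv, map_smul, smul_eq_mul] at h1
    rcases mul_eq_zero.1 h1 with h | h
    · exact h
    · exact absurd h (hpos v0 hv0).ne'
  rw [hc0, zero_smul] at hcv
  have hJJ : ∀ v, J (J v) = (p ^ 2 + q * r) • v := by
    intro v; rw [hJ, hJ]; ext <;> simp <;> ring
  have key : ∀ (v1 : ℝ × ℝ), v0.1 * v1.2 - v0.2 * v1.1 ≠ 0 → ∀ (g : ℝ → ℝ → ℝ) (m : ℝ × ℝ),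
      (∀ x y, D (x • v0 + y • v1) (J (x • v0 + y • v1)) = g x y • m) →
      (∀ x y, x ≠ 0 → y ≠ 0 → g x y ≠ 0) → ∀ v, D v (J v) = 0 := by
    intro v1 hi g m hg hg0
    have hm : m = 0 := by
      obtain ⟨x, y, hxy⟩ := aux_span v0 v1 hi m
      apply auxA_dense μ hc hpos m (v0 + v1)
      filter_upwards [auxA_ev x, auxA_ev y] with t hx hy
      have e : m + t • (v0 + v1) = (x + t) • v0 + (y + t) • v1 := by rw [hxy]; module
      rw [e]
      have hne : (x + t) • v0 + (y + t) • v1 ≠ 0 := by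
        intro h0
        have a1 := congrArg Prod.fst h0
        have a2 := congrArg Prod.snd h0
        simp at a1 a2
        apply mul_ne_zero hx hi
        linear_combination v1.2 * a1 - v1.1 * a2
      have := hD _ hne
      rw [hg, map_smul, smul_eq_mul] at this
      exact (mul_eq_zero.1 this).resolve_left (hg0 _ _ hx hy)
    intro v
    obtain ⟨x, y, hxy⟩ := aux_span v0 v1 hi v
    rw [hxy, hg, hm, smul_zero]
  by_cases hi : v0.1 * (J v0).2 - v0.2 * (J v0).1 = 0
  · -- v0 is an eigenvector
    have hn : v0.1 ^ 2 + v0.2 ^ 2 ≠ 0 := by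
      intro h
      apply hv0
      ext
      · simp; nlinarith [sq_nonneg v0.1, sq_nonneg v0.2]
      · simp; nlinarith [sq_nonneg v0.1, sq_nonneg v0.2]
    have : ∃ k : ℝ, J v0 = k • v0 := by
      refine ⟨(v0.1 * (J v0).1 + v0.2 * (J v0).2) / (v0.1 ^ 2 + v0.2 ^ 2), ?_⟩
      generalize J v0 = z at hi
      ext
      · simp only [Prod.smul_fst, smul_eq_mul]; field_simp; linear_combination -v0.2 * hi
      · simp only [Prod.smul_snd, smul_eq_mul]; field_simp; linear_combination v0.1 * hi
    obtain ⟨k, hk⟩ := this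
    have hk0 : k ≠ 0 := by
      rintro rfl
      have := hJJ v0
      rw [hk] at this
      rw [zero_smul, map_zero] at this
      rcases smul_eq_zero.1 this.symm with h | h
      · exact hd h
      · exact hv0 h
    have h00 : D v0 v0 = 0 := by
      rw [hk, map_smul] at hcv
      exact (smul_eq_zero.1 hcv).resolve_left hk0
    let v1 : ℝ × ℝ := (-v0.2, v0.1)
    have hi1 : v0.1 * v1.2 - v0.2 * v1.1 ≠ 0 := by
      simp only [v1]; intro h; apply hn; linear_combination h
    have hJ1 : ∃ a : ℝ, J v1 = a • v0 - k • v1 := by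
      obtain ⟨a, b, hab⟩ := aux_span v0 v1 hi1 (J v1)
      refine ⟨a, ?_⟩
      have hb : b = -k := by
        have e1 := congrArg Prod.fst hk
        have e2 := congrArg Prod.snd hk
        have e3 := congrArg Prod.fst hab
        have e4 := congrArg Prod.snd hab
        rw [hJ] at e1 e2 e3 e4
        simp [v1] at e1 e2 e3 e4
        have : (b + k) * (v0.1 ^ 2 + v0.2 ^ 2) = 0 := by
          linear_combination -v0.1 * e1 - v0.2 * e2 + v0.2 * e3 - v0.1 * e4
        have := (mul_eq_zero.1 this).resolve_right hn
        linarith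
      rw [hab, hb]; module
    obtain ⟨a, ha⟩ := hJ1
    apply key v1 hi1 (fun x y => y ^ 2) (a • D v0 v1 - k • D v1 v1)
    · intro x y
      simp only [map_add, map_smul, hk, ha, add_apply,
        smul_apply, map_sub, h00, hs v1 v0]
      module
    · intro x y _ hy; positivity
  · apply key (J v0) hi (fun x y => x * y) ((p ^ 2 + q * r) • D v0 v0 + D (J v0) (J v0))
    · intro x y
      simp only [map_add, map_smul, hJJ, add_apply,
        smul_apply, hs (J v0) v0, hcv]
      module
    · intro x y hx hy; positivity

lemma aux_core {V : Type*} [NormedAddCommGroup V] [NormedSpace ℝ V] [FiniteDimensional ℝ V]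
    (hdim : Module.finrank ℝ V = 3) (L : (ℝ × ℝ) →L[ℝ] V) (hL : Function.Injective L)
    (B : (ℝ × ℝ) →L[ℝ] (ℝ × ℝ) →L[ℝ] V) (hB : ∀ v w, B v w = B w v)
    (C : (ℝ × ℝ) →L[ℝ] (ℝ × ℝ) →L[ℝ] (ℝ × ℝ) →L[ℝ] V)
    (hC1 : ∀ u v w, C u v w = C v u w) (hC2 : ∀ u v w, C u v w = C u w v)
    (lam : ℝ × ℝ → V →L[ℝ] ℝ) (hlc : ∀ v, v ≠ 0 → ContinuousAt lam v)
    (hlp : ∀ v, v ≠ 0 → 0 < lam v (L v))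
    (Q : ℝ × ℝ → V →L[ℝ] V →L[ℝ] ℝ)
    (h1 : ∀ v, v ≠ 0 → ∀ a, lam v (B a v) = 0)
    (h2 : ∀ v, v ≠ 0 → ∀ a b, Q v (B b v) (B a v) + lam v (C b a v) = 0)
    (hQ : ∀ v, v ≠ 0 → ∀ w, w ≠ 0 → lam v w = 0 → 0 < Q v w w) :
    ∃ w : ℝ × ℝ, w ≠ 0 ∧ ∀ u : ℝ × ℝ, B w u ∈ Set.range L := by
  by_contra hcon
  push Not at hcon
  -- left inverse and normal functional
  obtain ⟨P0, hP0⟩ := LinearMap.exists_leftInverse_of_injective (L : (ℝ × ℝ) →ₗ[ℝ] V)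
    (LinearMap.ker_eq_bot.2 hL)
  have hrk : Module.finrank ℝ (LinearMap.range (L : (ℝ × ℝ) →ₗ[ℝ] V)) = 2 := by
    rw [LinearMap.finrank_range_of_inj hL]; simp
  have hlt : LinearMap.range (L : (ℝ × ℝ) →ₗ[ℝ] V) < ⊤ := by
    rw [lt_top_iff_ne_top]
    intro h
    rw [h, finrank_top, hdim] at hrk
    norm_num at hrk
  obtain ⟨l0, hl0, hle⟩ := Submodule.exists_le_ker_of_lt_top _ hlt
  have hker : LinearMap.range (L : (ℝ × ℝ) →ₗ[ℝ] V) = LinearMap.ker l0 := by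
    apply Submodule.eq_of_le_of_finrank_le hle
    have h3 := Module.Dual.finrank_ker_add_one_of_ne_zero (f := l0) hl0
    omega
  let P : V →L[ℝ] ℝ × ℝ := LinearMap.toContinuousLinearMap P0
  let l : V →L[ℝ] ℝ := LinearMap.toContinuousLinearMap l0
  have hP : ∀ z, P (L z) = z := fun z => LinearMap.congr_fun hP0 z
  have hl : ∀ y, l y = 0 → ∃ z, L z = y := by
    intro y hy
    have : y ∈ LinearMap.range (L : (ℝ × ℝ) →ₗ[ℝ] V) := by
      rw [hker]; exact hy
    exact this
  have hLP : ∀ y, l y = 0 → L (P y) = y := by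
    intro y hy
    obtain ⟨z, rfl⟩ := hl y hy
    rw [hP]
  -- coordinates of B
  set B11 := B (1, 0) (1, 0) with hB11
  set B12 := B (1, 0) (0, 1) with hB12
  set B22 := B (0, 1) (0, 1) with hB22
  have hBx : ∀ v w : ℝ × ℝ, B v w =
      (v.1 * w.1) • B11 + (v.1 * w.2 + v.2 * w.1) • B12 + (v.2 * w.2) • B22 := by
    have hd : ∀ v : ℝ × ℝ, v = v.1 • ((1, 0) : ℝ × ℝ) + v.2 • ((0, 1) : ℝ × ℝ) := by
      intro v; ext <;> simp
    intro v w
    conv_lhs => rw [hd v, hd w]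
    simp only [map_add, map_smul, add_apply, smul_apply, hB (0, 1) (1, 0),
      ← hB11, ← hB12, ← hB22]
    module
  set b11 := l B11 with hb11
  set b12 := l B12 with hb12
  set b22 := l B22 with hb22
  have hbx : ∀ v w : ℝ × ℝ, l (B v w) =
      (v.1 * w.1) * b11 + (v.1 * w.2 + v.2 * w.1) * b12 + (v.2 * w.2) * b22 := by
    intro v w; rw [hBx]; simp [← hb11, ← hb12, ← hb22]
  have hnd : ∀ w : ℝ × ℝ, w ≠ 0 → ∃ u, l (B w u) ≠ 0 := by
    intro w hw
    obtain ⟨u, hu⟩ := hcon w hw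
    refine ⟨u, fun h => hu ?_⟩
    obtain ⟨z, hz⟩ := hl _ h
    exact ⟨z, hz⟩
  have hdet : b12 ^ 2 - b11 * b22 ≠ 0 := by
    intro h0
    by_cases hz : b11 = 0 ∧ b12 = 0
    · obtain ⟨u, hu⟩ := hnd (1, 0) (by simp)
      apply hu; rw [hbx]; simp [hz.1, hz.2]
    · obtain ⟨u, hu⟩ := hnd (-b12, b11) (by
        intro h
        apply hz
        have e1 := congrArg Prod.fst h
        have e2 := congrArg Prod.snd h
        simp at e1 e2
        exact ⟨e2, e1⟩)
      apply hu; rw [hbx]; simp only; linear_combination -u.2 * h0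
  -- the operator J
  let J : (ℝ × ℝ) →L[ℝ] (ℝ × ℝ) :=
    ((-b12) • ContinuousLinearMap.fst ℝ ℝ ℝ + (-b22) • ContinuousLinearMap.snd ℝ ℝ ℝ).prod
      (b11 • ContinuousLinearMap.fst ℝ ℝ ℝ + b12 • ContinuousLinearMap.snd ℝ ℝ ℝ)
  have hJ : ∀ v, J v = (-b12 * v.1 + -b22 * v.2, b11 * v.1 - -b12 * v.2) := by
    intro v; simp [J]
  have hJJ : ∀ v, J (J v) = (b12 ^ 2 - b11 * b22) • v := by
    intro v; rw [hJ, hJ]; ext <;> simp <;> ring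
  have hbJ : ∀ v, l (B v (J v)) = 0 := by
    intro v; rw [hbx, hJ]; simp only; ring
  let μ : ℝ × ℝ → (ℝ × ℝ) →L[ℝ] ℝ := fun v => (lam v).comp L
  have hμc : ∀ v, v ≠ 0 → ContinuousAt μ v := fun v hv =>
    (hlc v hv).clm_comp continuousAt_const
  have hμp : ∀ v, v ≠ 0 → 0 < μ v v := fun v hv => hlp v hv
  have hdet' : (-b12) ^ 2 + b11 * (-b22) ≠ 0 := by
    intro h; apply hdet; linear_combination h
  have A := auxA μ hμc hμp (-b12) b11 (-b22) hdet' J hJ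
  -- first order
  have hBJ : ∀ v, B v (J v) = 0 := by
    have := A ((ContinuousLinearMap.compL ℝ (ℝ × ℝ) V (ℝ × ℝ) P).comp B)
      (fun v w => by simp [hB v w]) (fun v hv => by
        simp only [μ, ContinuousLinearMap.comp_apply, ContinuousLinearMap.compL_apply]
        rw [hLP _ (hbJ v), hB]
        exact h1 v hv _)
    intro v
    have h3 := this v
    simp only [ContinuousLinearMap.comp_apply, ContinuousLinearMap.compL_apply] at h3
    rw [← hLP _ (hbJ v), h3, map_zero]
  have r1 : -b12 • B11 + b11 • B12 = 0 := by
    have := hBJ (1, 0)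
    rw [hBx, hJ] at this
    simpa using this
  have r2 : -b22 • B12 + b12 • B22 = 0 := by
    have := hBJ (0, 1)
    rw [hBx, hJ] at this
    simpa using this
  have r3 : -b22 • B11 + b11 • B22 = 0 := by
    have := hBJ (1, 1)
    rw [hBx, hJ] at this
    simp only at this
    rw [← this]
    have e : -b22 • B11 + b11 • B22 = -b22 • B11 + b11 • B22 + (-b12 • B11 + b11 • B12)
      + (-b22 • B12 + b12 • B22) := by rw [r1, r2]; simp
    rw [e]; module
  have hdd : ∀ {x y : ℝ} {X Y : V}, y ≠ 0 → -x • Y + y • X = 0 → X = x • (y⁻¹ • Y) := by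
    intro x y X Y hy h
    have h3 : y • X = x • Y := by
      have : y • X = (-x • Y + y • X) + x • Y := by module
      rw [this, h, zero_add]
    rw [smul_comm, ← h3, inv_smul_smul₀ hy]
  have hdd' : ∀ {x y : ℝ} {X Y : V}, y ≠ 0 → -y • X + x • Y = 0 → X = x • (y⁻¹ • Y) := by
    intro x y X Y hy h
    apply hdd hy
    have : -x • Y + y • X = -(-y • X + x • Y) := by module
    rw [this, h, neg_zero]
  have hdi : ∀ {y : ℝ} {Y : V}, y ≠ 0 → Y = y • (y⁻¹ • Y) := by
    intro y Y hy; rw [smul_inv_smul₀ hy]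
  have hle : ∀ {y : ℝ} {Y : V}, l Y = y → y ≠ 0 → l (y⁻¹ • Y) = 1 := by
    intro y Y h hy; rw [map_smul, h, smul_eq_mul, inv_mul_cancel₀ hy]
  have hex : ∃ e, l e = 1 ∧ B11 = b11 • e ∧ B12 = b12 • e ∧ B22 = b22 • e := by
    by_cases z1 : b11 = 0
    · have z2 : b12 ≠ 0 := by
        intro z2; apply hdet; rw [z1, z2]; ring
      exact ⟨b12⁻¹ • B12, hle rfl z2, hdd' z2 r1, hdi z2, hdd z2 r2⟩
    · exact ⟨b11⁻¹ • B11, hle rfl z1, hdi z1, hdd z1 r1, hdd z1 r3⟩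
  obtain ⟨e, hle1, he11, he12, he22⟩ := hex
  have hBe : ∀ v w, B v w = l (B v w) • e := by
    intro v w; rw [hbx, hBx, he11, he12, he22]; module
  have hlame : ∀ v, v ≠ 0 → lam v e = 0 := by
    intro v hv
    obtain ⟨u, hu⟩ := hnd v hv
    have h3 := h1 v hv u
    rw [hB, hBe, map_smul, smul_eq_mul] at h3
    exact (mul_eq_zero.1 h3).resolve_left hu
  -- projection along e
  let R : V →L[ℝ] ℝ × ℝ := P.comp (ContinuousLinearMap.id ℝ V - l.smulRight e)
  have hR : ∀ v, v ≠ 0 → ∀ y, μ v (R y) = lam v y := by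
    intro v hv y
    have h3 : l (y - l y • e) = 0 := by rw [map_sub, map_smul, hle1]; simp
    have h4 : R y = P (y - l y • e) := by simp [R]
    simp only [μ, ContinuousLinearMap.comp_apply]
    rw [h4, hLP _ h3, map_sub, map_smul, hlame v hv]; simp
  have hRC : ∀ u v, R (C u v (J v)) = 0 := by
    intro u
    have := A ((ContinuousLinearMap.compL ℝ (ℝ × ℝ) V (ℝ × ℝ) R).comp (C u))
      (fun v w => by simp [hC2 u v w]) (fun v hv => by
        simp only [ContinuousLinearMap.comp_apply, ContinuousLinearMap.compL_apply]
        rw [hR v hv]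
        have h3 := h2 v hv (J v) u
        rw [hB (J v) v, hBJ v, map_zero, zero_add] at h3
        rw [hC2]; exact h3)
    intro v
    simpa using this v
  -- a non-null vector
  have hnn : ∃ v : ℝ × ℝ, l (B v v) ≠ 0 := by
    by_contra hall
    push Not at hall
    have q1 := hall (1, 0)
    have q2 := hall (0, 1)
    have q3 := hall (1, 1)
    rw [hbx] at q1 q2 q3
    simp at q1 q2 q3
    apply hdet
    have : b12 = 0 := by linarith
    rw [this, q1]; ring
  obtain ⟨v, hv⟩ := hnn
  have hv0 : v ≠ 0 := by
    rintro rfl; simp at hv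
  have hBv : B v v ≠ 0 := by
    intro h; rw [h, map_zero] at hv; exact hv rfl
  have hCv : R (C v v v) = 0 := by
    have k1 := hRC v (v + J v)
    have k2 := hRC v v
    have k3 := hRC v (J v)
    have k4 := hRC (J v) v
    rw [hC1] at k4
    have k5 : R (C v (J v) v) = 0 := by rw [hC2]; exact k2
    simp only [map_add, add_apply, k2, k4, k5, hJJ, map_smul, zero_add, add_zero] at k1
    exact (smul_eq_zero.1 k1).resolve_left hdet
  have h3 := h2 v hv0 v v
  rw [← hR v hv0, hCv, map_zero, add_zero] at h3
  have := hQ v hv0 _ hBv (h1 v hv0 v)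
  linarith

lemma aux_diff {G : Type*} [NormedAddCommGroup G] [NormedSpace ℝ G] {H : Type*}
    [NormedAddCommGroup H] [NormedSpace ℝ H] {g : G → H} {x : G}
    (h : ContDiffAt ℝ (⊤ : ℕ∞) g x) : HasFDerivAt g (fderiv ℝ g x) x :=
  (h.differentiableAt (by simp)).hasFDerivAt

lemma aux_two : minSmoothness ℝ 2 ≤ ((⊤ : ℕ∞) : WithTop ℕ∞) := by
  rw [minSmoothness_of_isRCLikeNormedField]; exact WithTop.coe_le_coe.2 (le_top : (2 : ℕ∞) ≤ ⊤)

/-- Theorem: second-order flat metrics: if a Finsler metric `φ` on an open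
set `U ⊆ ℝ²` is second-order flat at `p` (the first and second derivatives of `x ↦ φ x v`
vanish at `p` for every `v ≠ 0`), then every smooth isometric embedding `f` of `(U, φ)`
into a 3-dimensional Banach–Minkowski space has a degenerate second fundamental form at `p`. -/
theorem statement3 (U : Set (ℝ × ℝ)) (hU : IsOpen U)
    (φ : ℝ × ℝ → ℝ × ℝ → ℝ) (hφ : IsFinslerMetric U φ)
    (p : ℝ × ℝ) (hp : p ∈ U)
    (hflat1 : ∀ v : ℝ × ℝ, v ≠ 0 → fderiv ℝ (fun x => φ x v) p = 0)
    (hflat2 : ∀ v : ℝ × ℝ, v ≠ 0 → iteratedFDeriv ℝ 2 (fun x => φ x v) p = 0)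
    (V : Type*) [NormedAddCommGroup V] [NormedSpace ℝ V] [FiniteDimensional ℝ V]
    (hdim : Module.finrank ℝ V = 3)
    (Φ : V → ℝ) (hΦ : IsBanachMinkowski Φ)
    (f : ℝ × ℝ → V) (hf : IsIsometricEmbedding U φ Φ f) :
    ∃ w : ℝ × ℝ, w ≠ 0 ∧
      ∀ u : ℝ × ℝ, iteratedFDeriv ℝ 2 f p ![w, u] ∈ Set.range (fderiv ℝ f p) := by
  obtain ⟨hΦ0, hΦpos, hΦhom, -, hΦs, hΦconv⟩ := hΦ
  obtain ⟨hfs, -, hiso⟩ := hf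
  have hUp : U ∈ nhds p := hU.mem_nhds hp
  have hfat : ContDiffAt ℝ (⊤ : ℕ∞) f p := hfs.contDiffAt hUp
  have hfx : ∀ x ∈ U, ContDiffAt ℝ (⊤ : ℕ∞) f x := fun x hx => hfs.contDiffAt (hU.mem_nhds hx)
  have hΦat : ∀ z : V, z ≠ 0 → ContDiffAt ℝ (⊤ : ℕ∞) Φ z := fun z hz =>
    hΦs.contDiffAt (isOpen_compl_singleton.mem_nhds hz)
  have hFx : ∀ x ∈ U, ContDiffAt ℝ (⊤ : ℕ∞) (fderiv ℝ f) x := fun x hx =>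
    (hfx x hx).fderiv_right (by norm_num)
  have hFFx : ∀ x ∈ U, ContDiffAt ℝ (⊤ : ℕ∞) (fderiv ℝ (fderiv ℝ f)) x := fun x hx =>
    (hFx x hx).fderiv_right (by norm_num)
  have hDΦ : ∀ z : V, z ≠ 0 → ContDiffAt ℝ (⊤ : ℕ∞) (fderiv ℝ Φ) z := fun z hz =>
    (hΦat z hz).fderiv_right (by norm_num)
  have hne : ∀ x ∈ U, ∀ v : ℝ × ℝ, v ≠ 0 → fderiv ℝ f x v ≠ 0 := by
    intro x hx v hv h
    have h1 := hiso x hx v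
    rw [h, hΦ0] at h1
    have := (hφ.2 x hx).2.1 v hv
    linarith
  have hsymm : ∀ x ∈ U, ∀ v w, fderiv ℝ (fderiv ℝ f) x v w = fderiv ℝ (fderiv ℝ f) x w v := by
    intro x hx v w
    exact (hfx x hx).isSymmSndFDerivAt aux_two v w
  have hfirst : ∀ v, v ≠ 0 → ∀ x ∈ U, HasFDerivAt (fun x => Φ (fderiv ℝ f x v))
      ((fderiv ℝ Φ (fderiv ℝ f x v)).comp ((fderiv ℝ (fderiv ℝ f) x).flip v)) x := by
    intro v hv x hx
    have h1 : HasFDerivAt (fun x => fderiv ℝ f x v) ((fderiv ℝ (fderiv ℝ f) x).flip v) x := by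
      have := (aux_diff (hFx x hx)).clm_apply (hasFDerivAt_const v x)
      simpa using this
    exact (aux_diff (hΦat _ (hne x hx v hv))).comp x h1
  have hgeq : ∀ v, (fun x => φ x v) =ᶠ[nhds p] (fun x => Φ (fderiv ℝ f x v)) := by
    intro v
    filter_upwards [hUp] with x hx using (hiso x hx v).symm
  have hres := aux_core hdim (fderiv ℝ f p)
    (by
      intro x y hxy
      by_contra hne'
      apply hne p hp (x - y) (sub_ne_zero.2 hne')
      rw [map_sub, hxy, sub_self])
    (fderiv ℝ (fderiv ℝ f) p) (hsymm p hp)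
    (fderiv ℝ (fderiv ℝ (fderiv ℝ f)) p)
    (by
      intro u v w
      have := (hFx p hp).isSymmSndFDerivAt aux_two u v
      rw [this])
    (by
      intro u v w
      have key : ∀ v w, fderiv ℝ (fun x => fderiv ℝ (fderiv ℝ f) x v w) p u
          = fderiv ℝ (fderiv ℝ (fderiv ℝ f)) p u v w := by
        intro v w
        have h1 := ((aux_diff (hFFx p hp)).clm_apply (hasFDerivAt_const v p)).clm_apply
          (hasFDerivAt_const w p)
        rw [h1.fderiv]; simp
      rw [← key, ← key]
      have : (fun x => fderiv ℝ (fderiv ℝ f) x v w) =ᶠ[nhds p]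
          (fun x => fderiv ℝ (fderiv ℝ f) x w v) := by
        filter_upwards [hUp] with x hx using hsymm x hx v w
      rw [this.fderiv_eq])
    (fun v => fderiv ℝ Φ (fderiv ℝ f p v))
    (by
      intro v hv
      exact ContinuousAt.comp (f := fun v => fderiv ℝ f p v) (g := fderiv ℝ Φ)
        (hDΦ _ (hne p hp v hv)).continuousAt (by fun_prop))
    (by
      intro v hv
      have hz := hne p hp v hv
      generalize fderiv ℝ f p v = z at hz ⊢
      have h1 : HasDerivAt (fun t : ℝ => Φ (t • z)) (fderiv ℝ Φ z z) 1 := by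
        have h2 : HasDerivAt (fun t : ℝ => t • z) z 1 := by
          simpa using (hasDerivAt_id (1 : ℝ)).smul_const z
        have h3 : HasFDerivAt Φ (fderiv ℝ Φ z) ((1 : ℝ) • z) := by
          rw [one_smul]; exact aux_diff (hΦat z hz)
        exact h3.comp_hasDerivAt (1 : ℝ) h2
      have h4 : HasDerivAt (fun t : ℝ => Φ (t • z)) (Φ z) 1 := by
        have h5 : HasDerivAt (fun t : ℝ => t * Φ z) (Φ z) 1 := by
          simpa using (hasDerivAt_id (1 : ℝ)).mul_const (Φ z)
        apply h5.congr_of_eventuallyEq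
        filter_upwards [lt_mem_nhds (zero_lt_one (α := ℝ))] with t ht
        exact hΦhom t ht.le z
      rw [h1.unique h4]
      exact hΦpos z hz)
    (fun v => fderiv ℝ (fderiv ℝ Φ) (fderiv ℝ f p v))
    (by
      intro v hv a
      have h1 := hflat1 v hv
      rw [(hgeq v).fderiv_eq, (hfirst v hv p hp).fderiv] at h1
      have := congrArg (fun T => T a) h1
      simpa using this)
    (by
      intro v hv a b
      have h1 := hflat2 v hv
      have h2 : iteratedFDeriv ℝ 2 (fun x => φ x v) p ![b, a] = 0 := by rw [h1]; rfl
      rw [iteratedFDeriv_two_apply] at h2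
      simp only [Matrix.cons_val_zero, Matrix.cons_val_one] at h2
      have h3 : fderiv ℝ (fun x => φ x v) =ᶠ[nhds p] (fun x =>
          (fderiv ℝ Φ (fderiv ℝ f x v)).comp ((fderiv ℝ (fderiv ℝ f) x).flip v)) := by
        filter_upwards [(hgeq v).fderiv (𝕜 := ℝ), hUp] with x hx hxU
        rw [hx, (hfirst v hv x hxU).fderiv]
      rw [h3.fderiv_eq] at h2
      have e1 : HasFDerivAt (fun x => fderiv ℝ f x v) ((fderiv ℝ (fderiv ℝ f) p).flip v) p := by
        have := (aux_diff (hFx p hp)).clm_apply (hasFDerivAt_const v p)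
        simpa using this
      have e2 : HasFDerivAt (fun x => fderiv ℝ Φ (fderiv ℝ f x v))
          ((fderiv ℝ (fderiv ℝ Φ) (fderiv ℝ f p v)).comp ((fderiv ℝ (fderiv ℝ f) p).flip v)) p :=
        (aux_diff (hDΦ _ (hne p hp v hv))).comp p e1
      have e3 : HasFDerivAt (fun x => (fderiv ℝ (fderiv ℝ f) x).flip v)
          (((ContinuousLinearMap.flipₗᵢ ℝ (ℝ × ℝ) (ℝ × ℝ) V).toContinuousLinearEquiv.toContinuousLinearMap.flip v).comp
            (fderiv ℝ (fderiv ℝ (fderiv ℝ f)) p)) p := by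
        exact (ContinuousLinearMap.hasFDerivAt ((ContinuousLinearMap.flipₗᵢ ℝ (ℝ × ℝ) (ℝ × ℝ) V).toContinuousLinearEquiv.toContinuousLinearMap.flip v)).comp p
          (aux_diff (hFFx p hp))
      have e4 := e2.clm_comp e3
      have e5 := e4.fderiv
      rw [e5] at h2
      simp at h2
      rw [add_comm]
      simpa using h2)
    (by
      intro v hv w hw hlam
      have hz := hne p hp v hv
      generalize fderiv ℝ f p v = z at hz hlam ⊢
      have h1 := hΦconv z hz w hw
      rw [iteratedFDeriv_two_apply] at h1
      simp only [Matrix.cons_val_zero, Matrix.cons_val_one] at h1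
      have h2 : fderiv ℝ (fun u => Φ u ^ 2) =ᶠ[nhds z] (fun u => (2 * Φ u) • fderiv ℝ Φ u) := by
        filter_upwards [isOpen_compl_singleton.mem_nhds hz] with u hu
        have := (aux_diff (hΦat u hu)).pow 2
        rw [this.fderiv]; simp
      rw [h2.fderiv_eq] at h1
      have h3 := ((aux_diff (hΦat z hz)).const_mul 2).smul (aux_diff (hDΦ z hz))
      have h4 : fderiv ℝ (fun u => (2 * Φ u) • fderiv ℝ Φ u) z = _ := h3.fderiv
      rw [h4] at h1
      simp [hlam] at h1
      have := hΦpos z hz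
      exact (mul_pos_iff_of_pos_left (by positivity)).1 h1)
  obtain ⟨w, hw, h⟩ := hres
  refine ⟨w, hw, fun u => ?_⟩
  rw [iteratedFDeriv_two_apply]
  exact h u
end
end

section
/- Let (V, Φ) be a 3-dimensional Banach–Minkowski space and S ⊆ V*∖{0} a nonempty open set of linear functionals such that for all g, g' ∈ S there is a linear bijection A : ker g → ker g' with Φ(A(v)) = Φ(v) for all v ∈ ker g. Then for every g ∈ S the restriction of Φ to the plane ker g is a Euclidean norm: there is a positive definite quadratic form q on ker g with Φ(v)² = q(v) for all v ∈ ker g. -/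
noncomputable section

open Filter Topology

structure Nrm {W : Type*} [NormedAddCommGroup W] [NormedSpace ℝ W] (F : W → ℝ) : Prop where
  zero : F 0 = 0
  pos : ∀ v, v ≠ 0 → 0 < F v
  hom : ∀ t : ℝ, 0 ≤ t → ∀ v, F (t • v) = t * F v
  diff : ∀ v, v ≠ 0 → DifferentiableAt ℝ F v

def Euc {W : Type*} [NormedAddCommGroup W] [NormedSpace ℝ W] (F : W → ℝ) : Prop :=
  ∃ q : QuadraticForm ℝ W, q.PosDef ∧ ∀ v, F v ^ 2 = q v

section plane
variable {W : Type*} [NormedAddCommGroup W] [NormedSpace ℝ W]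

theorem Nrm.euler {F : W → ℝ} (hF : Nrm F) (v : W) (hv : v ≠ 0) : fderiv ℝ F v v = F v := by
  have h1 : HasDerivAt (fun t : ℝ => F (t • v)) (fderiv ℝ F v v) 1 := by
    have h := (hF.diff v hv).hasFDerivAt
    have h2 : HasDerivAt (fun t : ℝ => t • v) ((1:ℝ) • v) 1 := (hasDerivAt_id (1:ℝ)).smul_const v
    rw [one_smul] at h2
    refine HasFDerivAt.comp_hasDerivAt (1:ℝ) ?_ h2
    simpa using h
  have h2 : HasDerivAt (fun t : ℝ => F (t • v)) (1 * F v) 1 := by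
    refine ((hasDerivAt_id (1:ℝ)).mul_const (F v)).congr_of_eventuallyEq ?_
    filter_upwards [lt_mem_nhds (zero_lt_one (α := ℝ))] with t ht
    simp [hF.hom t ht.le]
  simpa using h1.unique h2

/-- coordinates on a plane -/
theorem exists_coords (hW : Module.finrank ℝ W = 2) :
    ∃ (x y : W →L[ℝ] ℝ) (a b : W), x a = 1 ∧ y a = 0 ∧ x b = 0 ∧ y b = 1 ∧
      ∀ v, v = x v • a + y v • b := by
  have : FiniteDimensional ℝ W := Module.finite_of_finrank_pos (by omega)
  let B := Module.finBasisOfFinrankEq ℝ W hW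
  refine ⟨LinearMap.toContinuousLinearMap (B.coord 0), LinearMap.toContinuousLinearMap (B.coord 1),
    B 0, B 1, by simp, by simp, by simp, by simp, ?_⟩
  intro v
  have := B.sum_repr v
  rw [Fin.sum_univ_two] at this
  simpa using this.symm

theorem coord_ext {x y : W →L[ℝ] ℝ} {a b : W} (hd : ∀ v, v = x v • a + y v • b) {v w : W}
    (h1 : x v = x w) (h2 : y v = y w) : v = w :=
  (hd v).trans (by rw [h1, h2]; exact (hd w).symm)

theorem par_of_det {x y : W →L[ℝ] ℝ} {a b : W} (hd : ∀ v, v = x v • a + y v • b) {v w : W}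
    (hv : v ≠ 0) (h : x v * y w - y v * x w = 0) : ∃ β : ℝ, w = β • v := by
  by_cases hx : x v = 0
  · have hy : y v ≠ 0 := by
      intro hy; apply hv; rw [hd v, hx, hy]; simp
    refine ⟨y w / y v, ?_⟩
    have hxw : x w = 0 := by
      rw [hx] at h
      have : y v * x w = 0 := by linarith
      exact (mul_eq_zero.mp this).resolve_left hy
    refine coord_ext hd ?_ ?_
    · simp [hx, hxw]
    · simp [hy]
  · refine ⟨x w / x v, ?_⟩
    have : y w = x w / x v * y v := by field_simp; linarith
    refine coord_ext hd ?_ ?_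
    · simp [hx]
    · simpa using this

theorem span_of_det {x y : W →L[ℝ] ℝ} {a b : W} (hd : ∀ v, v = x v • a + y v • b) {v w : W}
    (h : x v * y w - y v * x w ≠ 0) (u : W) : ∃ β γ : ℝ, u = β • v + γ • w := by
  refine ⟨(x u * y w - y u * x w) / (x v * y w - y v * x w),
    (x v * y u - y v * x u) / (x v * y w - y v * x w), ?_⟩
  set D := x v * y w - y v * x w with hD
  have h1 : x u = (x u * y w - y u * x w) / D * x v + (x v * y u - y v * x u) / D * x w := by
    field_simp; rw [hD]; ring
  have h2 : y u = (x u * y w - y u * x w) / D * y v + (x v * y u - y v * x u) / D * y w := by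
    field_simp; rw [hD]; ring
  generalize (x u * y w - y u * x w) / D = p at *
  generalize (x v * y u - y v * x u) / D = q at *
  rw [hd u, h1, h2]
  conv_rhs => rw [hd v, hd w]
  module

theorem preconn (hW : Module.finrank ℝ W = 2) : IsPreconnected ({(0:W)}ᶜ) := by
  have : FiniteDimensional ℝ W := Module.finite_of_finrank_pos (by omega)
  refine (isConnected_compl_singleton_of_one_lt_rank ?_ 0).isPreconnected
  rw [← Module.finrank_eq_rank, hW]; norm_num

theorem lemmaA (hW : Module.finrank ℝ W = 2) {F : W → ℝ} (hF : Nrm F) (B : W →L[ℝ] W)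
    (hB : B ≠ 0) (h : ∀ v, v ≠ 0 → fderiv ℝ F v (B v) = 0) : Euc F := by
  have : FiniteDimensional ℝ W := Module.finite_of_finrank_pos (by omega)
  obtain ⟨x, y, a, b, hxa, hya, hxb, hyb, hd⟩ := exists_coords hW
  have heig : ∀ v, v ≠ 0 → ∀ β : ℝ, B v = β • v → β = 0 := by
    intro v hv β hβ
    have h1 := h v hv
    rw [hβ, map_smul, hF.euler v hv, smul_eq_mul] at h1
    exact (mul_eq_zero.mp h1).resolve_right (hF.pos v hv).ne'
  set q : W → ℝ := fun v => x v * y (B v) - y v * x (B v) with hq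
  by_cases hdeg : ∃ v, v ≠ 0 ∧ q v = 0
  · exfalso
    obtain ⟨v0, hv0, hq0⟩ := hdeg
    obtain ⟨β, hβ⟩ := par_of_det hd hv0 hq0
    have hb0 : B v0 = 0 := by rw [hβ, heig v0 hv0 β hβ, zero_smul]
    obtain ⟨v1, hv1⟩ : ∃ v1, B v1 ≠ 0 := by
      by_contra! hc
      exact hB (by ext v; simpa using hc v)
    have hind : x v0 * y v1 - y v0 * x v1 ≠ 0 := by
      intro h0
      obtain ⟨γ, hγ⟩ := par_of_det hd hv0 h0
      apply hv1; rw [hγ, map_smul, hb0, smul_zero]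
    obtain ⟨m, n, hmn⟩ := span_of_det hd hind (B v1)
    have hBB : B (B v1) = n • B v1 := by
      conv_lhs => rw [hmn]
      rw [map_add, map_smul, map_smul, hb0, smul_zero, zero_add]
    have hn := heig _ hv1 _ hBB
    rw [hn, zero_smul] at hBB
    set u := B v1 with hu
    have hne : ∀ s : ℝ, v1 + s • u ≠ 0 := by
      intro s hs
      have : B (v1 + s • u) = u := by rw [map_add, map_smul, hBB, smul_zero, add_zero]
      rw [hs, map_zero] at this
      exact hv1 this.symm
    have hder : ∀ s : ℝ, HasDerivAt (fun s : ℝ => F (v1 + s • u)) 0 s := by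
      intro s
      have h2 : HasDerivAt (fun t : ℝ => v1 + t • u) ((1:ℝ) • u) s :=
        ((hasDerivAt_id s).smul_const u).const_add v1
      have h3 := (hF.diff _ (hne s)).hasFDerivAt.comp_hasDerivAt s h2
      have h4 := h _ (hne s)
      rw [map_add, map_smul, hBB, smul_zero, add_zero] at h4
      rw [one_smul] at h3
      have h5 : fderiv ℝ F (v1 + s • u) u = 0 := h4
      rw [h5] at h3
      exact h3
    have hconst : ∀ s : ℝ, F (v1 + s • u) = F v1 := by
      intro s
      have := is_const_of_deriv_eq_zero (f := fun s : ℝ => F (v1 + s • u))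
        (fun s => (hder s).differentiableAt) (fun s => (hder s).deriv) s 0
      simpa using this
    have hlim1 : Tendsto (fun s : ℝ => F (s • v1 + u)) (𝓝[>] 0) (𝓝 (F u)) := by
      have hc : ContinuousAt F u := (hF.diff u hv1).continuousAt
      have : Tendsto (fun s : ℝ => s • v1 + u) (𝓝[>] 0) (𝓝 u) := by
        have : Continuous (fun s : ℝ => s • v1 + u) := by fun_prop
        have := this.tendsto 0
        simp only [zero_smul, zero_add] at this
        exact this.mono_left nhdsWithin_le_nhds
      exact hc.tendsto.comp this
    have hlim2 : Tendsto (fun s : ℝ => F (s • v1 + u)) (𝓝[>] 0) (𝓝 0) := by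
      have : Tendsto (fun s : ℝ => s * F v1) (𝓝[>] 0) (𝓝 0) := by
        have : Continuous (fun s : ℝ => s * F v1) := by fun_prop
        have := this.tendsto 0
        simp only [zero_mul] at this
        exact this.mono_left nhdsWithin_le_nhds
      refine this.congr' ?_
      filter_upwards [self_mem_nhdsWithin] with s hs
      have hs' : (0:ℝ) < s := hs
      have : s • v1 + u = s • (v1 + s⁻¹ • u) := by
        rw [smul_add, smul_smul, mul_inv_cancel₀ hs'.ne', one_smul]
      rw [this, hF.hom s hs'.le, hconst]
    have := tendsto_nhds_unique hlim1 hlim2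
    exact absurd this (hF.pos u hv1).ne'
  · push Not at hdeg
    -- derivative of q
    set τ : ℝ := x (B a) + y (B b) with hτ
    have hBx : ∀ v, x (B v) = x v * x (B a) + y v * x (B b) := by
      intro v
      conv_lhs => rw [hd v]
      simp
    have hBy : ∀ v, y (B v) = x v * y (B a) + y v * y (B b) := by
      intro v
      conv_lhs => rw [hd v]
      simp
    have hqd : ∀ v, HasFDerivAt q ((x v • (y.comp B) + y (B v) • x) - (y v • (x.comp B) + x (B v) • y)) v := by
      intro v
      have e1 := x.hasFDerivAt (x := v)
      have e2 := y.hasFDerivAt (x := v)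
      have e3 := (x.comp B).hasFDerivAt (x := v)
      have e4 := (y.comp B).hasFDerivAt (x := v)
      exact (e1.mul e4).sub (e2.mul e3)
    set G : W → ℝ := fun v => F v ^ 2 * (q v)⁻¹ with hG
    have hGd : ∀ v, v ≠ 0 → DifferentiableAt ℝ G v := by
      intro v hv
      exact ((hF.diff v hv).pow 2).mul ((hqd v).differentiableAt.inv (hdeg v hv))
    have hGf : ∀ v, v ≠ 0 → ∀ w, fderiv ℝ G v w =
        2 * F v * fderiv ℝ F v w * (q v)⁻¹ - F v ^ 2 * ((q v ^ 2)⁻¹ * (fderiv ℝ q v w)) := by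
      intro v hv w
      have e1 := (hF.diff v hv).hasFDerivAt.pow 2
      have e2 := (hasDerivAt_inv (hdeg v hv)).comp_hasFDerivAt v (hqd v).differentiableAt.hasFDerivAt
      have e3 := (e1.mul e2).fderiv
      have e4 : fderiv ℝ G v = _ := e3
      rw [e4]
      simp
      ring
    have hqB : ∀ v, fderiv ℝ q v (B v) = τ * q v := by
      intro v
      rw [(hqd v).fderiv]
      simp only [hq, sub_apply, add_apply, smul_apply, ContinuousLinearMap.comp_apply, smul_eq_mul]
      rw [hBx (B v), hBy (B v), hBx v, hBy v, hτ]
      ring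
    have hqv : ∀ v, fderiv ℝ q v v = 2 * q v := by
      intro v
      rw [(hqd v).fderiv]
      simp [hq]
      ring
    have hGB : ∀ v, v ≠ 0 → fderiv ℝ G v (B v) = - τ * (F v ^ 2 * (q v)⁻¹) := by
      intro v hv
      rw [hGf v hv, h v hv, hqB]
      have := hdeg v hv
      field_simp
      ring
    have hGv : ∀ v, v ≠ 0 → fderiv ℝ G v v = 0 := by
      intro v hv
      rw [hGf v hv, hF.euler v hv, hqv]
      have := hdeg v hv
      field_simp
      ring
    have hGh : ∀ t : ℝ, 0 < t → ∀ v, G (t • v) = G v := by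
      intro t ht v
      simp only [hG, hq, hF.hom t ht.le, map_smul, smul_eq_mul]
      have : t * x v * (t * y (B v)) - t * y v * (t * x (B v)) = t^2 * (x v * y (B v) - y v * x (B v)) := by ring
      rw [this, mul_inv, mul_pow]
      field_simp
    have ha : a ≠ 0 := by rintro rfl; simp at hxa
    have hτ0 : τ = 0 := by
      have hcomp : IsCompact (Metric.sphere (0:W) 1) := isCompact_sphere 0 1
      have hne : (Metric.sphere (0:W) 1).Nonempty := by
        refine ⟨‖a‖⁻¹ • a, ?_⟩
        simp [norm_smul, ha]
      have h0 : ∀ v ∈ Metric.sphere (0:W) 1, v ≠ 0 := by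
        rintro v hv rfl; simp at hv
      obtain ⟨v, hv, hmax⟩ := hcomp.exists_isMaxOn hne
        (f := G) (fun v hv => (hGd v (h0 v hv)).continuousAt.continuousWithinAt)
      have hv0 := h0 v hv
      have hloc : IsLocalMax G v := by
        filter_upwards [isOpen_compl_singleton.mem_nhds (show v ∈ ({0}:Set W)ᶜ from hv0)] with w hw
        have hw : w ≠ 0 := hw
        have hw' : 0 < ‖w‖ := norm_pos_iff.mpr hw
        rw [← hGh ‖w‖⁻¹ (inv_pos.mpr hw') w]
        apply hmax
        simp [norm_smul, hw]
      have := hGB v hv0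
      rw [hloc.fderiv_eq_zero] at this
      simp only [zero_apply] at this
      have hp := hF.pos v hv0
      have hqq := hdeg v hv0
      by_contra hc
      have : - τ * (F v ^ 2 * (q v)⁻¹) ≠ 0 :=
        mul_ne_zero (neg_ne_zero.mpr hc) (mul_ne_zero (pow_ne_zero _ hp.ne') (inv_ne_zero hqq))
      exact this (by linarith)
    have hG0 : ∀ v, v ≠ 0 → fderiv ℝ G v = 0 := by
      intro v hv
      ext u
      obtain ⟨β, γ, rfl⟩ := span_of_det hd (v := v) (w := B v) (hdeg v hv) u
      rw [map_add, map_smul, map_smul, hGB v hv, hGv v hv, hτ0]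
      simp
    have hconst : ∀ v, v ≠ 0 → G v = G a := by
      intro v hv
      exact isOpen_compl_singleton.is_const_of_fderiv_eq_zero (preconn hW)
        (fun v hv => (hGd v hv).differentiableWithinAt) (fun v hv => hG0 v hv) hv ha
    let Q : QuadraticForm ℝ W := G a • (QuadraticMap.linMulLin (x : W →ₗ[ℝ] ℝ) ((y.comp B : W →L[ℝ] ℝ) : W →ₗ[ℝ] ℝ)
       - QuadraticMap.linMulLin (y : W →ₗ[ℝ] ℝ) ((x.comp B : W →L[ℝ] ℝ) : W →ₗ[ℝ] ℝ))
    have hQ : ∀ v, F v ^ 2 = Q v := by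
      intro v
      have hQv : Q v = G a * q v := by simp [Q, hq]
      by_cases hv : v = 0
      · simp [hv, hF.zero]
      · rw [hQv, ← hconst v hv]
        have := hdeg v hv
        simp only [hG]
        field_simp
    refine ⟨Q, ?_, hQ⟩
    intro v hv
    rw [← hQ]
    have := hF.pos v hv
    positivity
end plane

theorem tapp {ι E G : Type*} [NormedAddCommGroup E] [NormedSpace ℝ E] [NormedAddCommGroup G]
    [NormedSpace ℝ G] {l : Filter ι} {f : ι → E →L[ℝ] G} {x : ι → E} {f0 : E →L[ℝ] G} {x0 : E}
    (hf : Tendsto f l (𝓝 f0)) (hx : Tendsto x l (𝓝 x0)) :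
    Tendsto (fun i => f i (x i)) l (𝓝 (f0 x0)) :=
  (isBoundedBilinearMap_apply.continuous.tendsto (f0, x0)).comp (hf.prodMk_nhds hx)

theorem tcomp {ι E G H : Type*} [NormedAddCommGroup E] [NormedSpace ℝ E] [NormedAddCommGroup G]
    [NormedSpace ℝ G] [NormedAddCommGroup H] [NormedSpace ℝ H]
    {l : Filter ι} {f : ι → E →L[ℝ] G} {f0 : E →L[ℝ] G}
    (hf : Tendsto f l (𝓝 f0)) (P : H →L[ℝ] E) :
    Tendsto (fun i => (f i).comp P) l (𝓝 (f0.comp P)) := by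
  have : Continuous (fun f : E →L[ℝ] G => f.comp P) := by fun_prop
  exact (this.tendsto f0).comp hf

theorem lemmaQ {W : Type*} [NormedAddCommGroup W] [NormedSpace ℝ W]
    (hW : Module.finrank ℝ W = 2) {F : W → ℝ} (hF : Nrm F)
    (hFc : ∀ v, v ≠ 0 → ContinuousAt (fderiv ℝ F) v) (X : W → W)
    (hXc : Continuous X)
    (hX : ∀ v w, ∀ s t : ℝ, X (s • v + t • w) =
      s ^ 2 • X v + (s * t) • (X (v + w) - X v - X w) + t ^ 2 • X w)
    (h : ∀ v, v ≠ 0 → fderiv ℝ F v (X v) = 0) : Euc F ∨ ∀ v, X v = 0 := by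
  have : FiniteDimensional ℝ W := Module.finite_of_finrank_pos (by omega)
  obtain ⟨x, y, a, b, hxa, hya, hxb, hyb, hd⟩ := exists_coords hW
  have hneg : ∀ v, X (-v) = X v := by
    intro v
    have := hX v 0 (-1) 0
    simpa using this
  have ha : a ≠ 0 := by rintro rfl; simp at hxa
  obtain ⟨v0, hv0, hz⟩ : ∃ v, v ≠ 0 ∧ x v * y (X v) - y v * x (X v) = 0 := by
    set c : W → ℝ := fun v => x v * y (X v) - y v * x (X v) with hc
    have hcc : Continuous c := by fun_prop
    have hcn : c (-a) = - c a := by simp only [hc, hneg, map_neg]; ring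
    have hpre := (preconn hW).image c hcc.continuousOn
    have m1 : c a ∈ c '' {(0:W)}ᶜ := ⟨a, ha, rfl⟩
    have m2 : - c a ∈ c '' {(0:W)}ᶜ := ⟨-a, by simpa using ha, hcn⟩
    have : (0:ℝ) ∈ c '' {(0:W)}ᶜ := by
      rcases le_total 0 (c a) with h0 | h0
      · exact hpre.Icc_subset m2 m1 ⟨by linarith, h0⟩
      · exact hpre.Icc_subset m1 m2 ⟨h0, by linarith⟩
    obtain ⟨v, hv, hv'⟩ := this
    exact ⟨v, hv, hv'⟩
  obtain ⟨β, hβ⟩ := par_of_det hd hv0 hz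
  have hX0 : X v0 = 0 := by
    have h1 := h v0 hv0
    rw [hβ, map_smul, hF.euler v0 hv0, smul_eq_mul] at h1
    rw [hβ, (mul_eq_zero.mp h1).resolve_right (hF.pos v0 hv0).ne', zero_smul]
  -- l vanishes on v0
  obtain ⟨v1, hv1⟩ : ∃ v1, x v0 * y v1 - y v0 * x v1 ≠ 0 := by
    by_contra! hc
    have h1 := hc a
    have h2 := hc b
    rw [hxa, hya] at h1
    rw [hxb, hyb] at h2
    exact hv0 (coord_ext hd (by simp; linarith) (by simp; linarith))
  set D := x v0 * y v1 - y v0 * x v1 with hD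
  let k : W →L[ℝ] ℝ := D⁻¹ • (y v1 • x - x v1 • y)
  let l : W →L[ℝ] ℝ := D⁻¹ • (x v0 • y - y v0 • x)
  have hkl : ∀ v, v = k v • v0 + l v • v1 := by
    intro v
    refine coord_ext hd ?_ ?_ <;>
    · simp [k, l]; field_simp; rw [hD]; ring
  set p := X (v0 + v1) - X v0 - X v1 with hp
  let B : W →L[ℝ] W := k.smulRight p + l.smulRight (X v1)
  have hB : ∀ v, X v = l v • B v := by
    intro v
    conv_lhs => rw [hkl v, hX, hX0, ← hX0, ← hp, hX0]
    simp [B]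
    module
  by_cases hB0 : B = 0
  · right
    intro v
    rw [hB, hB0]; simp
  left
  have hlv1 : l v1 = 1 := by
    simp only [l, smul_apply, sub_apply, smul_eq_mul]
    rw [← hD]; exact inv_mul_cancel₀ hv1
  have hlv0 : l v0 = 0 := by
    simp [l]; right; ring
  have hgood : ∀ v, l v ≠ 0 → fderiv ℝ F v (B v) = 0 := by
    intro v hv
    have hv' : v ≠ 0 := by rintro rfl; simp at hv
    have h1 := h v hv'
    rw [hB, map_smul, smul_eq_mul] at h1
    exact (mul_eq_zero.mp h1).resolve_left hv
  refine lemmaA hW hF B hB0 ?_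
  intro v hv
  by_cases hlv : l v = 0
  swap
  · exact hgood v hlv
  have hpath : Tendsto (fun s : ℝ => v + s • v1) (𝓝[≠] 0) (𝓝 v) := by
    have : Continuous (fun s : ℝ => v + s • v1) := by fun_prop
    have := this.tendsto 0
    simp only [zero_smul, add_zero] at this
    exact this.mono_left nhdsWithin_le_nhds
  have t1 := (hFc v hv).tendsto.comp hpath
  have t2 := (B.continuous.tendsto v).comp hpath
  have t3 := tapp t1 t2
  have t4 : Tendsto (fun s : ℝ => (0:ℝ)) (𝓝[≠] 0) (𝓝 (fderiv ℝ F v (B v))) := by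
    refine t3.congr' ?_
    filter_upwards [self_mem_nhdsWithin] with s hs
    apply hgood
    rw [map_add, hlv, map_smul, hlv1]
    simpa using hs
  exact (tendsto_nhds_unique t4 tendsto_const_nhds)

theorem ulim {E : Type*} [NormedAddCommGroup E] [ProperSpace E] (U : Ultrafilter ℝ) (x : ℝ → E)
    (R : ℝ) (h : ∀ᶠ t in (U : Filter ℝ), ‖x t‖ ≤ R) : ∃ L, Tendsto x U (𝓝 L) := by
  obtain ⟨L, -, hL⟩ := (isCompact_closedBall (0:E) R).ultrafilter_le_nhds (U.map x) (by
    rw [le_principal_iff]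
    change x ⁻¹' _ ∈ (U : Filter ℝ)
    filter_upwards [h] with t ht
    simpa using ht)
  exact ⟨L, hL⟩

theorem blowup {E : Type*} [NormedAddCommGroup E] [NormedSpace ℝ E] [FiniteDimensional ℝ E]
    (U : Ultrafilter ℝ) (hU : (U : Filter ℝ) ≤ 𝓝[>] 0) (w : ℝ → E) :
    ∃ (c : ℝ → ℝ) (α : ℝ) (C : E), (α ≠ 0 ∨ C ≠ 0) ∧ 
      Tendsto (fun t => c t * t) U (𝓝 α) ∧ Tendsto (fun t => c t • w t) U (𝓝 C) := by
  set z : ℝ → ℝ × E := fun t => (t, w t)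
  have hz : ∀ᶠ t in (U : Filter ℝ), ‖‖z t‖⁻¹ • z t‖ = 1 := by
    filter_upwards [hU self_mem_nhdsWithin] with t ht
    have ht : (0:ℝ) < t := ht
    have : z t ≠ 0 := by
      intro h0
      have := congrArg Prod.fst h0
      exact ht.ne' this
    rw [norm_smul, norm_inv, norm_norm]
    exact inv_mul_cancel₀ (norm_ne_zero_iff.mpr this)
  have : ProperSpace (ℝ × E) := FiniteDimensional.proper ℝ _
  obtain ⟨L, hL⟩ := ulim U (fun t => ‖z t‖⁻¹ • z t) 1 (hz.mono fun t ht => ht.le)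
  have hL1 : ‖L‖ = 1 := tendsto_nhds_unique hL.norm
    (tendsto_const_nhds.congr' (hz.mono fun t ht => ht.symm))
  refine ⟨fun t => ‖z t‖⁻¹, L.1, L.2, ?_, ?_, ?_⟩
  · by_contra! hc
    have : L = 0 := Prod.ext hc.1 hc.2
    rw [this] at hL1; simp at hL1
  · exact (continuous_fst.tendsto L).comp hL
  · exact (continuous_snd.tendsto L).comp hL

theorem Nrm.bounds {V : Type*} [NormedAddCommGroup V] [NormedSpace ℝ V] [FiniteDimensional ℝ V]
    {Φ : V → ℝ} (hΦ : Nrm Φ) : ∃ c C : ℝ, 0 < c ∧ 0 < C ∧ ∀ v, c * ‖v‖ ≤ Φ v ∧ Φ v ≤ C * ‖v‖ := by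
  have hcomp : IsCompact (Metric.sphere (0:V) 1) := isCompact_sphere 0 1
  have h0 : ∀ v ∈ Metric.sphere (0:V) 1, v ≠ 0 := by
    rintro v hv rfl; simp at hv
  by_cases hne : (Metric.sphere (0:V) 1).Nonempty
  · have hc : ContinuousOn Φ (Metric.sphere (0:V) 1) :=
      fun v hv => (hΦ.diff v (h0 v hv)).continuousAt.continuousWithinAt
    obtain ⟨p, hp, hmin⟩ := hcomp.exists_isMinOn hne hc
    obtain ⟨P, hP, hmax⟩ := hcomp.exists_isMaxOn hne hc
    refine ⟨Φ p, Φ P, hΦ.pos p (h0 p hp), hΦ.pos P (h0 P hP), ?_⟩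
    intro v
    by_cases hv : v = 0
    · simp [hv, hΦ.zero]
    have hn : 0 < ‖v‖ := norm_pos_iff.mpr hv
    have hs : ‖v‖⁻¹ • v ∈ Metric.sphere (0:V) 1 := by simp [norm_smul, hv]
    have e : Φ v = Φ (‖v‖⁻¹ • v) * ‖v‖ := by
      rw [hΦ.hom _ (inv_nonneg.mpr hn.le)]; field_simp
    rw [e]
    exact ⟨mul_le_mul_of_nonneg_right (hmin hs) hn.le, mul_le_mul_of_nonneg_right (hmax hs) hn.le⟩
  · refine ⟨1, 1, one_pos, one_pos, ?_⟩
    intro v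
    have hv : v = 0 := by
      by_contra hv
      exact hne ⟨‖v‖⁻¹ • v, by simp [norm_smul, hv]⟩
    simp [hv, hΦ.zero]

theorem Nrm.cont {V : Type*} [NormedAddCommGroup V] [NormedSpace ℝ V] [FiniteDimensional ℝ V]
    {Φ : V → ℝ} (hΦ : Nrm Φ) : Continuous Φ := by
  rw [continuous_iff_continuousAt]
  intro v
  by_cases hv : v = 0
  · subst hv
    obtain ⟨c, C, hc, hC, hb⟩ := hΦ.bounds
    rw [ContinuousAt, hΦ.zero]
    have h1 : Tendsto (fun v : V => C * ‖v‖) (𝓝 0) (𝓝 0) := by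
      have : Continuous (fun v : V => C * ‖v‖) := by fun_prop
      simpa using this.tendsto 0
    refine tendsto_of_tendsto_of_tendsto_of_le_of_le tendsto_const_nhds h1 ?_ (fun v => (hb v).2)
    intro v
    exact le_trans (by positivity) (hb v).1
  · exact (hΦ.diff v hv).continuousAt

section main
variable {V : Type*} [NormedAddCommGroup V] [NormedSpace ℝ V] [FiniteDimensional ℝ V]

/-- restriction to a subspace -/
def Res (Φ : V → ℝ) (W : Submodule ℝ V) : W → ℝ := fun w => Φ w

theorem Res.hasFDerivAt {Φ : V → ℝ} (hΦ : Nrm Φ) (W : Submodule ℝ V) (v : W) (hv : v ≠ 0) :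
    HasFDerivAt (Res Φ W) ((fderiv ℝ Φ (v : V)).comp W.subtypeL) v := by
  have hv' : (v : V) ≠ 0 := by simpa using hv
  exact HasFDerivAt.comp v (hΦ.diff _ hv').hasFDerivAt W.subtypeL.hasFDerivAt

theorem Res.fderiv {Φ : V → ℝ} (hΦ : Nrm Φ) (W : Submodule ℝ V) (v : W) (hv : v ≠ 0) (w : W) :
    fderiv ℝ (Res Φ W) v w = fderiv ℝ Φ (v : V) (w : V) := by
  rw [(Res.hasFDerivAt hΦ W v hv).fderiv]; rfl

theorem Res.nrm {Φ : V → ℝ} (hΦ : Nrm Φ) (W : Submodule ℝ V) : Nrm (Res Φ W) where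
  zero := hΦ.zero
  pos v hv := hΦ.pos _ (by simpa using hv)
  hom t ht v := hΦ.hom t ht v
  diff v hv := (Res.hasFDerivAt hΦ W v hv).differentiableAt

theorem Res.contfd {Φ : V → ℝ} (hΦ : Nrm Φ) (hc : ∀ v, v ≠ 0 → ContinuousAt (_root_.fderiv ℝ Φ) v)
    (W : Submodule ℝ V) (v : W) (hv : v ≠ 0) : ContinuousAt (_root_.fderiv ℝ (Res Φ W)) v := by
  have hv' : (v : V) ≠ 0 := by simpa using hv
  have h1 : ContinuousAt (fun u : W => (_root_.fderiv ℝ Φ (u : V)).comp W.subtypeL) v := by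
    have : ContinuousAt (fun u : W => _root_.fderiv ℝ Φ (u : V)) v :=
      ContinuousAt.comp (f := fun u : W => (u : V)) (hc _ hv') continuous_subtype_val.continuousAt
    exact this.clm_comp continuousAt_const
  refine h1.congr ?_
  filter_upwards [isOpen_compl_singleton.mem_nhds (show v ∈ ({0}:Set W)ᶜ from hv)] with u hu
  exact (Res.hasFDerivAt hΦ W u hu).fderiv.symm

abbrev Ker (g : V →L[ℝ] ℝ) : Submodule ℝ V := LinearMap.ker (g : V →ₗ[ℝ] ℝ)

theorem finrank_ker (hdim : Module.finrank ℝ V = 3) (g : V →L[ℝ] ℝ) (hg : g ≠ 0) :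
    Module.finrank ℝ (Ker g) = 2 := by
  have h1 := LinearMap.finrank_range_add_finrank_ker (g : V →ₗ[ℝ] ℝ)
  have hs : LinearMap.range (g : V →ₗ[ℝ] ℝ) = ⊤ := by
    apply LinearMap.range_eq_top.mpr
    apply LinearMap.surjective
    intro h
    apply hg
    ext v
    exact congrArg (fun f : V →ₗ[ℝ] ℝ => f v) h
  rw [hs, finrank_top, Module.finrank_self, hdim] at h1
  show Module.finrank ℝ (LinearMap.ker (g : V →ₗ[ℝ] ℝ)) = 2
  omega

theorem prop1 (hdim : Module.finrank ℝ V = 3) {Φ : V → ℝ} (hΦ : Nrm Φ)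
    (S : Set (V →L[ℝ] ℝ)) (hSopen : IsOpen S)
    (hiso : ∀ g ∈ S, ∀ g' ∈ S, ∃ A : Ker g ≃ₗ[ℝ] Ker g', ∀ v : Ker g, Φ (A v : V) = Φ (v : V))
    (g : V →L[ℝ] ℝ) (hg : g ∈ S) (hg0 : g ≠ 0) (μ : V →L[ℝ] ℝ) :
    Euc (Res Φ (Ker g)) ∨ ∃ C : Ker g →L[ℝ] V, ∀ v : Ker g, g (C v) = - μ (v : V) ∧
      (v ≠ 0 → fderiv ℝ Φ (v : V) (C v) = 0) := by
  set W := Ker g with hWdef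
  have hW : Module.finrank ℝ W = 2 := finrank_ker hdim g hg0
  have hgW : ∀ v : W, g (v : V) = 0 := fun v => v.2
  obtain ⟨c, K, hc, hK, hb⟩ := hΦ.bounds
  let U : Ultrafilter ℝ := Ultrafilter.of (𝓝[>] 0)
  have hU : (U : Filter ℝ) ≤ 𝓝[>] 0 := Ultrafilter.of_le _
  have hU0 : (U : Filter ℝ) ≤ 𝓝 0 := hU.trans nhdsWithin_le_nhds
  have hid : Tendsto (fun t : ℝ => t) U (𝓝 0) := hU0
  have hgt : Tendsto (fun t : ℝ => g + t • μ) U (𝓝 g) := by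
    have := tendsto_const_nhds (x := g).add (hid.smul_const μ)
    simpa using this
  have hS : ∀ᶠ t in (U : Filter ℝ), g + t • μ ∈ S := hgt.eventually (hSopen.mem_nhds hg)
  have hA : ∀ t : ℝ, ∃ A : W →L[ℝ] V, g + t • μ ∈ S →
      (∀ v, (g + t • μ) (A v) = 0) ∧ ∀ v : W, Φ (A v) = Φ v := by
    intro t
    by_cases ht : g + t • μ ∈ S
    · obtain ⟨A, hA⟩ := hiso g hg _ ht
      refine ⟨LinearMap.toContinuousLinearMap ((Ker (g + t • μ)).subtype ∘ₗ A.toLinearMap), fun _ => ⟨?_, ?_⟩⟩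
      · intro v
        exact (A v).2
      · intro v
        exact hA v
    · exact ⟨0, fun h => absurd h ht⟩
  choose A hA using hA
  have : ProperSpace (W →L[ℝ] V) := FiniteDimensional.proper ℝ (W →L[ℝ] V)
  obtain ⟨A0, hA0⟩ := ulim U A (K / c) (by
    filter_upwards [hS] with t ht
    refine ContinuousLinearMap.opNorm_le_bound _ (by positivity) ?_
    intro v
    have h1 := (hb (A t v)).1
    rw [(hA t ht).2 v] at h1
    have h2 := (hb (v : V)).2
    have h3 : c * ‖A t v‖ ≤ K * ‖v‖ := h1.trans h2
    rw [div_mul_eq_mul_div, le_div_iff₀ hc]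
    linarith)
  have hA0v : ∀ v, Tendsto (fun t => A t v) U (𝓝 (A0 v)) :=
    fun v => tapp hA0 tendsto_const_nhds
  have hA0Φ : ∀ v : W, Φ (A0 v) = Φ v := by
    intro v
    refine tendsto_nhds_unique ((hΦ.cont.tendsto _).comp (hA0v v)) ?_
    refine tendsto_const_nhds.congr' ?_
    filter_upwards [hS] with t ht
    exact ((hA t ht).2 v).symm
  have hA0g : ∀ v, g (A0 v) = 0 := by
    intro v
    refine tendsto_nhds_unique (tapp hgt (hA0v v)) ?_
    refine tendsto_const_nhds.congr' ?_
    filter_upwards [hS] with t ht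
    exact ((hA t ht).1 v).symm
  let A1 : W →ₗ[ℝ] W := LinearMap.codRestrict W (A0 : W →ₗ[ℝ] V) hA0g
  have hinj : Function.Injective A1 := by
    rw [injective_iff_map_eq_zero]
    intro v hv
    by_contra hv0
    have h1 : A0 v = 0 := congrArg (Subtype.val) hv
    have h2 := hA0Φ v
    rw [h1, hΦ.zero] at h2
    exact (hΦ.pos (v : V) (by simpa using hv0)).ne h2
  let A2 := LinearEquiv.ofInjectiveEndo A1 hinj
  let P : W →L[ℝ] W := LinearMap.toContinuousLinearMap A2.symm.toLinearMap
  have hP : ∀ v, A0 (P v) = v := by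
    intro v
    have : A1 (A2.symm v) = v := by
      have := A2.apply_symm_apply v
      exact this
    exact congrArg Subtype.val this
  have hPΦ : ∀ v : W, Φ (P v) = Φ v := by
    intro v
    rw [← hA0Φ, hP]
  let C : ℝ → (W →L[ℝ] V) := fun t => (A t).comp P - W.subtypeL
  have hC0 : Tendsto C U (𝓝 0) := by
    have h1 : Tendsto C U (𝓝 (A0.comp P - W.subtypeL)) :=
      (tcomp hA0 P).sub tendsto_const_nhds
    have h2 : A0.comp P - W.subtypeL = 0 := by
      ext v; simp [hP]
    rwa [h2] at h1
  have hC0v : ∀ v, Tendsto (fun t => C t v) U (𝓝 0) := by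
    intro v
    simpa using tapp hC0 (tendsto_const_nhds (x := v))
  have hCv : ∀ (t : ℝ) (v : W), (v : V) + C t v = A t (P v) := by
    intro t v; simp [C]
  obtain ⟨r, α, D, hne, hα, hD⟩ := blowup U hU C
  have hDv : ∀ v, Tendsto (fun t => r t • C t v) U (𝓝 (D v)) := by
    intro v
    exact tapp hD (tendsto_const_nhds (x := v))
  have hgD : ∀ v : W, g (D v) = - (α * μ v) := by
    intro v
    have t1 : Tendsto (fun t => g (r t • C t v) + r t * t * μ (v + C t v)) U
        (𝓝 (g (D v) + α * μ (v + 0))) :=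
      ((g.continuous.tendsto _).comp (hDv v)).add
        (hα.mul ((μ.continuous.tendsto _).comp (tendsto_const_nhds.add (hC0v v))))
    have t2 : Tendsto (fun t => g (r t • C t v) + r t * t * μ (v + C t v)) U (𝓝 0) := by
      refine tendsto_const_nhds.congr' ?_
      filter_upwards [hS] with t ht
      have h1 := (hA t ht).1 (P v)
      rw [← hCv] at h1
      simp only [add_apply, smul_apply, smul_eq_mul, map_add, hgW] at h1
      simp only [map_smul, smul_eq_mul, map_add]
      linear_combination (-r t) * h1
    have := tendsto_nhds_unique t1 t2
    rw [add_zero] at this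
    linarith
  have hdD : ∀ v : W, v ≠ 0 → fderiv ℝ Φ (v : V) (D v) = 0 := by
    intro v hv
    have hv' : (v : V) ≠ 0 := by simpa using hv
    have t1 := (hasFDerivWithinAt_univ.2 (hΦ.diff _ hv').hasFDerivAt).lim (hC0v v)
      (.of_forall fun _ => Set.mem_univ _) (hDv v)
    refine tendsto_nhds_unique t1 ?_
    refine tendsto_const_nhds.congr' ?_
    filter_upwards [hS] with t ht
    rw [hCv, (hA t ht).2, hPΦ]; simp
  by_cases hα0 : α = 0
  · left
    have hD0 : D ≠ 0 := hne.resolve_left (by simpa using hα0)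
    have hDW : ∀ v, D v ∈ W := by
      intro v
      show g (D v) = 0
      rw [hgD, hα0]; simp
    refine lemmaA hW (Res.nrm hΦ W) (D.codRestrict W hDW) ?_ ?_
    · intro h
      apply hD0
      ext v
      have := congrArg (fun f : W →L[ℝ] W => ((f v : W) : V)) h
      simpa using this
    · intro v hv
      rw [Res.fderiv hΦ W v hv]
      exact hdD v hv
  · right
    refine ⟨α⁻¹ • D, fun v => ⟨?_, fun hv => ?_⟩⟩
    · simp [hgD]; field_simp
    · simp [hdD v hv]

theorem ext_coord (W : Submodule ℝ V) (x : W →L[ℝ] ℝ) : ∃ μ : V →L[ℝ] ℝ, ∀ v : W, μ v = x v := by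
  obtain ⟨f, hf⟩ := LinearMap.exists_extend (x : W →ₗ[ℝ] ℝ)
  refine ⟨LinearMap.toContinuousLinearMap f, fun v => ?_⟩
  exact congrArg (fun f : W →ₗ[ℝ] ℝ => f v) hf

theorem prop1b (hdim : Module.finrank ℝ V = 3) {Φ : V → ℝ} (hΦ : Nrm Φ)
    (hc : ∀ v, v ≠ 0 → ContinuousAt (fderiv ℝ Φ) v)
    (g : V →L[ℝ] ℝ) (hg0 : g ≠ 0)
    (h1 : ∀ μ : V →L[ℝ] ℝ, Euc (Res Φ (Ker g)) ∨ ∃ C : Ker g →L[ℝ] V, ∀ v : Ker g,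
      g (C v) = - μ (v : V) ∧ (v ≠ 0 → fderiv ℝ Φ (v : V) (C v) = 0))
    (hE : ¬ Euc (Res Φ (Ker g))) :
    ∃ e : V, g e = 1 ∧ ∀ v : Ker g, v ≠ 0 → fderiv ℝ Φ (v : V) e = 0 := by
  set W := Ker g with hWdef
  have hW : Module.finrank ℝ W = 2 := finrank_ker hdim g hg0
  obtain ⟨x, y, a, b, hxa, hya, hxb, hyb, hd⟩ := exists_coords hW
  obtain ⟨μ1, hμ1⟩ := ext_coord W x
  obtain ⟨μ2, hμ2⟩ := ext_coord W y
  obtain ⟨C1, hC1⟩ := (h1 μ1).resolve_left hE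
  obtain ⟨C2, hC2⟩ := (h1 μ2).resolve_left hE
  have hmem : ∀ v : W, y v • C1 v - x v • C2 v ∈ W := by
    intro v
    show g _ = 0
    rw [map_sub, map_smul, map_smul, (hC1 v).1, (hC2 v).1, hμ1, hμ2, smul_eq_mul, smul_eq_mul]
    ring
  let X : W → W := fun v => ⟨y v • C1 v - x v • C2 v, hmem v⟩
  have hX := (lemmaQ hW (Res.nrm hΦ W) (Res.contfd hΦ hc W) X ?_ ?_ ?_).resolve_left hE
  rotate_left
  · exact Continuous.subtype_mk (by fun_prop) _
  · intro v w s t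
    apply Subtype.ext
    simp only [X, Submodule.coe_add, Submodule.coe_sub, Submodule.coe_smul, map_add, map_smul, smul_eq_mul]
    module
  · intro v hv
    rw [Res.fderiv hΦ W v hv]
    simp only [X, map_sub, map_smul, (hC1 v).2 hv, (hC2 v).2 hv, smul_zero, sub_zero]
  have hX' : ∀ v, y v • C1 v - x v • C2 v = 0 := fun v => congrArg Subtype.val (hX v)
  have e1 : C2 a = 0 := by simpa [hxa, hya] using hX' a
  have e2 : C1 b = 0 := by simpa [hxb, hyb] using hX' b
  have e3 : C1 a = C2 b := by
    have := hX' (a + b)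
    simp only [map_add, hxa, hxb, hya, hyb, e1, e2] at this
    simpa [sub_eq_zero] using this
  have f1 : ∀ v, C1 v = x v • C1 a := by
    intro v
    conv_lhs => rw [hd v]
    simp [e2]
  have f2 : ∀ v, C2 v = y v • C1 a := by
    intro v
    conv_lhs => rw [hd v]
    simp [e1, e3]
  refine ⟨- C1 a, ?_, ?_⟩
  · rw [map_neg, (hC1 a).1, hμ1, hxa]; norm_num
  · intro v hv
    have g1 := (hC1 v).2 hv
    have g2 := (hC2 v).2 hv
    rw [f1, map_smul, smul_eq_mul] at g1
    rw [f2, map_smul, smul_eq_mul] at g2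
    rw [map_neg, neg_eq_zero]
    by_contra hne
    apply hv
    apply coord_ext hd
    · simpa using (mul_eq_zero.mp g1).resolve_right hne
    · simpa using (mul_eq_zero.mp g2).resolve_right hne

/-- `E` stands for the square of the norm. -/
theorem prop2 {E : V → ℝ} (hEu : ∀ v, v ≠ 0 → fderiv ℝ E v v ≠ 0)
    (hE1 : ∀ v, v ≠ 0 → ContinuousAt (fderiv ℝ E) v)
    (hE2 : ∀ v, v ≠ 0 → DifferentiableAt ℝ (fderiv ℝ E) v)
    (S : Set (V →L[ℝ] ℝ)) (hSopen : IsOpen S)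
    (e : (V →L[ℝ] ℝ) → V) (he : ∀ g ∈ S, g (e g) = 1)
    (hee : ∀ g ∈ S, ∀ v, g v = 0 → v ≠ 0 → fderiv ℝ E v (e g) = 0)
    (g : V →L[ℝ] ℝ) (hg : g ∈ S) (μ : V →L[ℝ] ℝ) (hμ : μ (e g) = 0) :
    ∃ c : Ker g, ∀ v : Ker g, v ≠ 0 →
      fderiv ℝ E v c = μ v * fderiv ℝ (fderiv ℝ E) v (e g) (e g) := by
  let U : Ultrafilter ℝ := Ultrafilter.of (𝓝[>] 0)
  have hU : (U : Filter ℝ) ≤ 𝓝[>] 0 := Ultrafilter.of_le _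
  have hU0 : (U : Filter ℝ) ≤ 𝓝 0 := hU.trans nhdsWithin_le_nhds
  have hid : Tendsto (fun t : ℝ => t) U (𝓝 0) := hU0
  have hgt : Tendsto (fun t : ℝ => g + t • μ) U (𝓝 g) := by
    have := tendsto_const_nhds (x := g).add (hid.smul_const μ)
    simpa using this
  have hS : ∀ᶠ t in (U : Filter ℝ), g + t • μ ∈ S := hgt.eventually (hSopen.mem_nhds hg)
  set e0 := e g with he0
  have hge0 : g e0 = 1 := he g hg
  -- moving points
  have hut : ∀ v, Tendsto (fun t : ℝ => - (t * μ v) • e0) U (𝓝 0) := by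
    intro v
    have : Continuous (fun t : ℝ => - (t * μ v) • e0) := by fun_prop
    have := this.tendsto 0
    simp only [zero_mul, neg_zero, zero_smul] at this
    exact this.mono_left hU0
  have hut' : ∀ v, Tendsto (fun t : ℝ => v + - (t * μ v) • e0) U (𝓝 v) := by
    intro v
    simpa using tendsto_const_nhds (x := v).add (hut v)
  have hne : ∀ v, v ≠ 0 → ∀ᶠ t in (U : Filter ℝ), v + - (t * μ v) • e0 ≠ 0 := by
    intro v hv
    exact (hut' v).eventually (isOpen_compl_singleton.mem_nhds (show v ∈ ({0}:Set V)ᶜ from hv))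
  have hker : ∀ v, g v = 0 → ∀ t : ℝ, (g + t • μ) (v + - (t * μ v) • e0) = 0 := by
    intro v hv t
    simp [hv, hge0, hμ]
  have hfd : ∀ v, v ≠ 0 → Tendsto (fun t : ℝ => fderiv ℝ E (v + - (t * μ v) • e0)) U
      (𝓝 (fderiv ℝ E v)) := fun v hv => (hE1 v hv).tendsto.comp (hut' v)
  have hzero : ∀ v, g v = 0 → v ≠ 0 → ∀ᶠ t in (U : Filter ℝ),
      fderiv ℝ E (v + - (t * μ v) • e0) (e (g + t • μ)) = 0 := by
    intro v hv hv0
    filter_upwards [hS, hne v hv0] with t ht ht'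
    exact hee _ ht _ (hker v hv t) ht'
  -- normalise
  set z : ℝ → V := fun t => e (g + t • μ) with hz
  have hz0 : ∀ᶠ t in (U : Filter ℝ), ‖‖z t‖⁻¹ • z t‖ = 1 := by
    filter_upwards [hS] with t ht
    have : z t ≠ 0 := by
      intro h0
      have := he _ ht
      change (g + t • μ) (z t) = 1 at this
      rw [h0, map_zero] at this
      exact zero_ne_one this
    rw [norm_smul, norm_inv, norm_norm]
    exact inv_mul_cancel₀ (norm_ne_zero_iff.mpr this)
  have : ProperSpace V := FiniteDimensional.proper ℝ V
  obtain ⟨L, hL⟩ := ulim U (fun t => ‖z t‖⁻¹ • z t) 1 (hz0.mono fun t ht => ht.le)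
  have hL1 : ‖L‖ = 1 := tendsto_nhds_unique hL.norm
    (tendsto_const_nhds.congr' (hz0.mono fun t ht => ht.symm))
  have hLd : ∀ v, g v = 0 → v ≠ 0 → fderiv ℝ E v L = 0 := by
    intro v hv hv0
    refine tendsto_nhds_unique (tapp (hfd v hv0) hL) ?_
    refine tendsto_const_nhds.congr' ?_
    filter_upwards [hzero v hv hv0] with t ht
    simp only [hz, map_smul, ht, smul_zero]
  have hLe : L = g L • e0 := by
    by_contra hc
    have hc' : L - g L • e0 ≠ 0 := sub_ne_zero.mpr hc
    have hk : g (L - g L • e0) = 0 := by simp [hge0]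
    apply hEu _ hc'
    conv_lhs => rw [map_sub]
    rw [map_smul, hLd _ hk hc', hee g hg _ hk hc']
    simp
  have hgL : g L ≠ 0 := by
    intro h0
    rw [h0, zero_smul] at hLe
    rw [hLe] at hL1; simp at hL1
  have hgLt : Tendsto (fun t => g (‖z t‖⁻¹ • z t)) U (𝓝 (g L)) := (g.continuous.tendsto L).comp hL
  have hgne : ∀ᶠ t in (U : Filter ℝ), g (‖z t‖⁻¹ • z t) ≠ 0 :=
    hgLt.eventually (isOpen_compl_singleton.mem_nhds (show g L ∈ ({0}:Set ℝ)ᶜ from hgL))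
  set w : ℝ → V := fun t => (g (‖z t‖⁻¹ • z t))⁻¹ • (‖z t‖⁻¹ • z t) - e0 with hw
  have hw0 : Tendsto w U (𝓝 0) := by
    have h1 := ((hgLt.inv₀ hgL).smul hL).sub (tendsto_const_nhds (x := e0))
    have h2 : (g L)⁻¹ • L - e0 = 0 := by
      rw [sub_eq_zero]
      conv_lhs => rw [hLe]
      simp only [map_smul, smul_eq_mul, hge0, mul_one]
      rw [smul_smul, inv_mul_cancel₀ hgL, one_smul]
    rwa [h2] at h1
  have hwg : ∀ᶠ t in (U : Filter ℝ), g (w t) = 0 := by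
    filter_upwards [hgne] with t ht
    simp only [hw, map_sub, map_smul _ (g (‖z t‖⁻¹ • z t))⁻¹, smul_eq_mul, hge0]
    rw [inv_mul_cancel₀ ht, sub_self]
  obtain ⟨r, α, D, hne', hα, hD⟩ := blowup U hU w
  have hgD : g D = 0 := by
    refine tendsto_nhds_unique ((g.continuous.tendsto D).comp hD) ?_
    refine tendsto_const_nhds.congr' ?_
    filter_upwards [hwg] with t ht
    simp [ht]
  have key : ∀ v, g v = 0 → v ≠ 0 →
      fderiv ℝ E v D = α * (μ v * fderiv ℝ (fderiv ℝ E) v e0 e0) := by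
    intro v hv hv0
    have t1 : Tendsto (fun t => r t • (fderiv ℝ E (v + - (t * μ v) • e0) - fderiv ℝ E v)) U
        (𝓝 (fderiv ℝ (fderiv ℝ E) v (-(α * μ v) • e0))) := by
      refine (hasFDerivWithinAt_univ.2 (hE2 v hv0).hasFDerivAt).lim (hut v)
        (.of_forall fun _ => Set.mem_univ _) ?_
      have := ((hα.mul_const (μ v)).neg).smul_const e0
      refine this.congr ?_
      intro t
      rw [smul_smul]; congr 1; ring
    have t2 := (tapp t1 (tendsto_const_nhds (x := e0))).add (tapp (hfd v hv0) hD)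
    have t3 := tendsto_nhds_unique t2 (tendsto_const_nhds.congr' (f₁ := fun _ => (0:ℝ)) ?_)
    · simp only [map_smul, smul_apply, smul_eq_mul] at t3
      linear_combination t3
    · filter_upwards [hzero v hv hv0] with t ht
      have h0 : fderiv ℝ E v e0 = 0 := hee g hg v hv hv0
      have ht' : fderiv ℝ E (v + - (t * μ v) • e0) (z t) = 0 := ht
      simp only [hw, smul_apply, sub_apply, map_smul, map_sub, ht', h0, smul_eq_mul]
      ring
  have hα0 : α ≠ 0 := by
    intro h0
    have hD0 : D ≠ 0 := hne'.resolve_left (by simpa using h0)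
    apply hEu D hD0
    rw [key D hgD hD0, h0, zero_mul]
  refine ⟨⟨α⁻¹ • D, ?_⟩, ?_⟩
  · show g _ = 0
    simp [hgD]
  · intro v hv
    have hv' : (v : V) ≠ 0 := by simpa using hv
    have := key v v.2 hv'
    simp only [map_smul, this, smul_eq_mul]
    field_simp

end main

/-- Proposition: linearly equivalent sections: if `S` is a nonempty open
set of nonzero linear functionals on a 3-dimensional Banach–Minkowski space `(V, Φ)` such
that the restrictions of `Φ` to the planes `ker g`, `g ∈ S`, are pairwise isometric, then
the restriction of `Φ` to each such plane is a Euclidean norm. -/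
theorem statement4 (V : Type*) [NormedAddCommGroup V] [NormedSpace ℝ V]
    [FiniteDimensional ℝ V] (hdim : Module.finrank ℝ V = 3)
    (Φ : V → ℝ) (hΦ : IsBanachMinkowski Φ)
    (S : Set (V →L[ℝ] ℝ)) (hSne : S.Nonempty) (hSopen : IsOpen S)
    (hS0 : ∀ g ∈ S, g ≠ 0)
    (hiso : ∀ g ∈ S, ∀ g' ∈ S,
      ∃ A : LinearMap.ker (g : V →ₗ[ℝ] ℝ) ≃ₗ[ℝ] LinearMap.ker (g' : V →ₗ[ℝ] ℝ),
        ∀ v : LinearMap.ker (g : V →ₗ[ℝ] ℝ), Φ ((A v : LinearMap.ker (g' : V →ₗ[ℝ] ℝ)) : V) = Φ (v : V)) :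
    ∀ g ∈ S, ∃ q : QuadraticForm ℝ (LinearMap.ker (g : V →ₗ[ℝ] ℝ)), q.PosDef ∧
      ∀ v : LinearMap.ker (g : V →ₗ[ℝ] ℝ), Φ (v : V) ^ 2 = q v := by
  obtain ⟨hz, hpos, hhom, -, hsm, hconv⟩ := hΦ
  have hat : ∀ v : V, v ≠ 0 → ContDiffAt ℝ (⊤ : ℕ∞) Φ v := fun v hv =>
    hsm.contDiffAt (isOpen_compl_singleton.mem_nhds hv)
  have hN : Nrm Φ := ⟨hz, hpos, hhom, fun v hv => (hat v hv).differentiableAt (by simp)⟩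
  have hc : ∀ v, v ≠ 0 → ContinuousAt (fderiv ℝ Φ) v := by
    intro v hv
    exact ((hat v hv).fderiv_right (m := 0) (by exact_mod_cast le_top)).continuousAt
  set E : V → ℝ := fun u => Φ u ^ 2 with hEdef
  have hEat : ∀ v : V, v ≠ 0 → ContDiffAt ℝ (⊤ : ℕ∞) E v := fun v hv => (hat v hv).pow 2
  have hE1 : ∀ v, v ≠ 0 → DifferentiableAt ℝ (fderiv ℝ E) v := by
    intro v hv
    exact ((hEat v hv).fderiv_right (m := 1) (by norm_cast)).differentiableAt (by simp)
  have hEf : ∀ v, v ≠ 0 → ∀ w, fderiv ℝ E v w = 2 * Φ v * fderiv ℝ Φ v w := by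
    intro v hv w
    have h := ((hN.diff v hv).hasFDerivAt.pow 2).fderiv
    have h' : fderiv ℝ E v = _ := h
    rw [h']
    simp
    try ring
  intro g hg
  by_contra hnot
  have hnot' : ∀ g' ∈ S, ¬ Euc (Res Φ (Ker g')) := by
    rintro g' hg' ⟨q, hq, hqv⟩
    apply hnot
    obtain ⟨A, hA⟩ := hiso g hg g' hg'
    refine ⟨q.comp A.toLinearMap, ?_, ?_⟩
    · intro v hv
      exact hq (A v) (by simpa using hv)
    · intro v
      rw [← hA v]
      exact hqv (A v)
  have hex : ∀ h : V →L[ℝ] ℝ, ∃ e : V, h ∈ S → h e = 1 ∧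
      ∀ v, h v = 0 → v ≠ 0 → fderiv ℝ E v e = 0 := by
    intro h
    by_cases hh : h ∈ S
    · obtain ⟨e, he, hev⟩ := prop1b hdim hN hc h (hS0 h hh)
        (prop1 hdim hN S hSopen hiso h hh (hS0 h hh)) (hnot' h hh)
      refine ⟨e, fun _ => ⟨he, ?_⟩⟩
      intro v hv hv0
      rw [hEf v hv0, hev ⟨v, hv⟩ (fun h0 => hv0 (congrArg Subtype.val h0)), mul_zero]
    · exact ⟨0, fun h' => absurd h' hh⟩
  choose e he using hex
  have hW : Module.finrank ℝ (Ker g) = 2 := finrank_ker hdim g (hS0 g hg)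
  have hEu : ∀ v, v ≠ 0 → fderiv ℝ E v v ≠ 0 := by
    intro v hv
    rw [hEf v hv, hN.euler v hv]
    have := hpos v hv
    positivity
  have hge := (he g hg).1
  have P2 := prop2 (E := E) hEu (fun v hv => (hE1 v hv).continuousAt) hE1 S hSopen e
    (fun h hh => (he h hh).1) (fun h hh => (he h hh).2) g hg
  obtain ⟨x, y, a, b, hxa, hya, hxb, hyb, hd⟩ := exists_coords hW
  have hP : ∀ x : Ker g →L[ℝ] ℝ, ∃ c : Ker g, ∀ v : Ker g, v ≠ 0 →
      fderiv ℝ E v c = x v * fderiv ℝ (fderiv ℝ E) v (e g) (e g) := by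
    intro x
    obtain ⟨μ, hμ⟩ := ext_coord (Ker g) x
    obtain ⟨c, hcv⟩ := P2 (μ - μ (e g) • g) (by simp [hge])
    refine ⟨c, fun v hv => ?_⟩
    rw [hcv v hv, ← hμ]
    have : g (v : V) = 0 := v.2
    simp [this]
  obtain ⟨c1, hc1⟩ := hP x
  obtain ⟨c2, hc2⟩ := hP y
  let X : Ker g →L[ℝ] Ker g := y.smulRight c1 - x.smulRight c2
  have hX0 : X = 0 := by
    by_contra hX
    apply hnot' g hg
    refine lemmaA hW (Res.nrm hN _) X hX ?_
    intro v hv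
    have hv' : (v : V) ≠ 0 := by simpa using hv
    rw [Res.fderiv hN _ v hv]
    have h1 : fderiv ℝ E (v : V) (X v : V) = 0 := by
      simp [X, hc1 v hv, hc2 v hv]
      ring
    rw [hEf _ hv'] at h1
    exact (mul_eq_zero.mp h1).resolve_left (by have := hpos _ hv'; positivity)
  have hc20 : c2 = 0 := by
    have := congrArg (fun f : Ker g →L[ℝ] Ker g => f a) hX0
    simpa [X, hxa, hya] using this
  have hb : b ≠ 0 := by rintro rfl; simp at hyb
  have hb' : (b : V) ≠ 0 := by simpa using hb
  have h1 := hc2 b hb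
  rw [hc20, hyb] at h1
  have hegne : e g ≠ 0 := by
    intro h0; rw [h0, map_zero] at hge; exact zero_ne_one hge
  have h2 := hconv b hb' (e g) hegne
  rw [iteratedFDeriv_two_apply] at h2
  simp at h1 h2
  rw [← h1] at h2
  exact lt_irrefl _ h2
end
end

section
/- Let (V, Φ) be a 3-dimensional Banach–Minkowski space, H ⊆ V a 2-dimensional subspace such that Φ|_H is not a Euclidean norm, and ν ∈ V∖H. For α ∈ H* let π_α ∈ V* be the unique linear functional with π_α|_H = α and π_α(ν) = 1, and set H_α := ker π_α. Suppose there is a neighborhood U₀ of 0 in H* such that for every α ∈ U₀ there exists a linear bijection from H to H_α preserving Φ. Then there exist a neighborhood U ⊆ U₀ of 0 in H* and a C^∞ map L : U → Hom(H, V) such that L(0) is the inclusion of H into V and, for every α ∈ U, L(α) is injective with range H_α and Φ(L(α)(v)) = Φ(v) for all v ∈ H. -/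
noncomputable section

lemma charpoly_two {E : Type*} [AddCommGroup E] [Module ℝ E] [FiniteDimensional ℝ E]
    (h2 : Module.finrank ℝ E = 2) (M : E →ₗ[ℝ] E) :
    ∃ τ d : ℝ, ∀ v, M (M v) = (2 * τ) • M v - d • v := by
  have h := LinearMap.aeval_self_charpoly M
  have hd : M.charpoly.natDegree = 2 := by rw [LinearMap.charpoly_natDegree, h2]
  have hm : M.charpoly.coeff 2 = 1 := by
    have := LinearMap.charpoly_monic M
    rw [Polynomial.Monic, Polynomial.leadingCoeff, hd] at this
    exact this
  refine ⟨-M.charpoly.coeff 1 / 2, M.charpoly.coeff 0, fun v => ?_⟩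
  rw [Polynomial.aeval_eq_sum_range, hd] at h
  have h' := LinearMap.congr_fun h v
  simp [Finset.sum_range_succ, hm, pow_two] at h'
  have : M (M v) = -(M.charpoly.coeff 0 • v + M.charpoly.coeff 1 • M v) := by
    rw [eq_neg_iff_add_eq_zero, ← h']; abel
  rw [this]; module

lemma const_of_deriv_zero {f : ℝ → ℝ} (h : ∀ t, HasDerivAt f 0 t) (a b : ℝ) : f a = f b :=
  is_const_of_deriv_eq_zero (fun t => (h t).differentiableAt) (fun t => (h t).deriv) a b

lemma euler_id {E : Type*} [NormedAddCommGroup E] [NormedSpace ℝ E] {Ψ : E → ℝ}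
    (hhom : ∀ t : ℝ, 0 ≤ t → ∀ v, Ψ (t • v) = t * Ψ v) {v : E}
    (hd : DifferentiableAt ℝ Ψ v) : fderiv ℝ Ψ v v = Ψ v := by
  have h1 : HasDerivAt (fun t : ℝ => Ψ (t • v)) (fderiv ℝ Ψ v v) 1 := by
    have hl : HasDerivAt (fun t : ℝ => t • v) ((1:ℝ) • v) 1 := (hasDerivAt_id (1:ℝ)).smul_const v
    rw [one_smul] at hl
    have hd' : HasFDerivAt Ψ (fderiv ℝ Ψ v) ((1:ℝ) • v) := by
      rw [one_smul]; exact hd.hasFDerivAt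
    exact hd'.comp_hasDerivAt (1:ℝ) hl
  have h2 : HasDerivAt (fun t : ℝ => Ψ (t • v)) (Ψ v) 1 := by
    have : HasDerivAt (fun t : ℝ => t * Ψ v) (1 * Ψ v) 1 := (hasDerivAt_id (1:ℝ)).mul_const _
    rw [one_mul] at this
    refine this.congr_of_eventuallyEq ?_
    filter_upwards [lt_mem_nhds (zero_lt_one)] with t ht
    exact hhom t ht.le v
  exact h1.unique h2

lemma euclid_of_J {E : Type*} [NormedAddCommGroup E] [NormedSpace ℝ E] [FiniteDimensional ℝ E]
    (h2 : Module.finrank ℝ E = 2) {Ψ : E → ℝ}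
    (hpos : ∀ v, v ≠ 0 → 0 < Ψ v)
    (hhom : ∀ t : ℝ, 0 ≤ t → ∀ v, Ψ (t • v) = t * Ψ v)
    (hd : ∀ v, v ≠ 0 → DifferentiableAt ℝ Ψ v)
    (J : E →ₗ[ℝ] E) (hJ : ∀ v, J (J v) = -v) (c : ℝ)
    (hc : ∀ v, v ≠ 0 → fderiv ℝ Ψ v (J v) = - c * Ψ v) : IsEuclideanNorm Ψ := by
  have hnt : Nontrivial E := Module.nontrivial_of_finrank_pos (R := ℝ) (by omega)
  obtain ⟨v, hv⟩ := exists_ne (0 : E)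
  have hli : ∀ a b : ℝ, a • v + b • J v = 0 → a = 0 ∧ b = 0 := by
    intro a b hab
    have h1 : J (a • v + b • J v) = 0 := by rw [hab, map_zero]
    simp only [map_add, map_smul, hJ] at h1
    have h3 : (a ^ 2 + b ^ 2) • v = 0 := by
      have : (a ^ 2 + b ^ 2) • v = a • (a • v + b • J v) - b • (a • J v + b • -v) := by module
      rw [this, hab, h1]; simp
    have h4 : a ^ 2 + b ^ 2 = 0 := (smul_eq_zero.1 h3).resolve_right hv
    constructor <;> nlinarith [sq_nonneg a, sq_nonneg b]
  have hne : ∀ t : ℝ, Real.cos t • v + Real.sin t • J v ≠ 0 := by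
    intro t h
    obtain ⟨h1, h2⟩ := hli _ _ h
    have := Real.sin_sq_add_cos_sq t
    rw [h1, h2] at this; norm_num at this
  have hder : ∀ t : ℝ, HasDerivAt (fun t : ℝ => Real.exp (c * t) *
      Ψ (Real.cos t • v + Real.sin t • J v)) 0 t := by
    intro t
    have hx : HasDerivAt (fun t : ℝ => Real.cos t • v + Real.sin t • J v)
        (J (Real.cos t • v + Real.sin t • J v)) t := by
      have := ((Real.hasDerivAt_cos t).smul_const v).add ((Real.hasDerivAt_sin t).smul_const (J v))
      have e : J (Real.cos t • v + Real.sin t • J v)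
          = -Real.sin t • v + Real.cos t • J v := by
        simp only [map_add, map_smul, hJ]; module
      rw [e]; exact this
    have h1 := (hd _ (hne t)).hasFDerivAt.comp_hasDerivAt t hx
    rw [hc _ (hne t)] at h1
    have h2 : HasDerivAt (fun t : ℝ => Real.exp (c * t)) (Real.exp (c * t) * c) t := by
      have := ((hasDerivAt_id t).const_mul c).exp
      simpa using this
    have := h2.mul h1
    have e : Real.exp (c * t) * c * Ψ (Real.cos t • v + Real.sin t • J v) +
        Real.exp (c * t) * (-c * Ψ (Real.cos t • v + Real.sin t • J v)) = 0 := by ring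
    rw [← e]; exact this
  have hconst := const_of_deriv_zero hder
  have hc0 : c = 0 := by
    have := hconst (2 * Real.pi) 0
    simp only [Real.cos_two_pi, Real.sin_two_pi, Real.cos_zero, Real.sin_zero, one_smul,
      zero_smul, add_zero, mul_zero, Real.exp_zero] at this
    have h3 := mul_right_cancel₀ (hpos v hv).ne' this
    rw [Real.exp_eq_one_iff] at h3
    have := Real.pi_pos
    rcases mul_eq_zero.1 h3 with h | h
    · exact h
    · linarith
  have hrot : ∀ t, Ψ (Real.cos t • v + Real.sin t • J v) = Ψ v := by
    intro t
    have := hconst t 0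
    simpa [hc0] using this
  have hform : ∀ a b : ℝ, Ψ (a • v + b • J v) ^ 2 = Ψ v ^ 2 * (a * a + b * b) := by
    intro a b
    set z : ℂ := ⟨a, b⟩
    have e1 : a = ‖z‖ * Real.cos z.arg := (Complex.norm_mul_cos_arg z).symm
    have e2 : b = ‖z‖ * Real.sin z.arg := (Complex.norm_mul_sin_arg z).symm
    have e3 : a • v + b • J v = ‖z‖ • (Real.cos z.arg • v + Real.sin z.arg • J v) := by
      rw [smul_add, smul_smul, smul_smul, ← e1, ← e2]
    have e4 : ‖z‖ ^ 2 = a * a + b * b := by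
      rw [Complex.sq_norm, Complex.normSq_mk]
    rw [e3, hhom _ (norm_nonneg z), hrot, mul_pow, e4]; ring
  have hlin : LinearIndependent ℝ ![v, J v] := LinearIndependent.pair_iff.2 hli
  let B := basisOfLinearIndependentOfCardEqFinrank hlin (by simp [h2])
  have hB : ∀ x, x = B.coord 0 x • v + B.coord 1 x • J v := by
    intro x
    have := B.sum_repr x
    simp [Fin.sum_univ_two, B] at this
    simp [B, this]
  have hQ : ∀ x, Ψ x ^ 2 = (Ψ v ^ 2 • (QuadraticMap.linMulLin (B.coord 0) (B.coord 0)
     + QuadraticMap.linMulLin (B.coord 1) (B.coord 1))) x := by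
    intro x
    conv_lhs => rw [hB x]
    rw [hform]
    simp
    ring
  refine ⟨_, ?_, hQ⟩
  intro x hx
  rw [← hQ]
  exact pow_pos (hpos x hx) 2

lemma euclid_of_field {E : Type*} [NormedAddCommGroup E] [NormedSpace ℝ E] [FiniteDimensional ℝ E]
    (h2 : Module.finrank ℝ E = 2) {Ψ : E → ℝ}
    (hpos : ∀ v, v ≠ 0 → 0 < Ψ v)
    (hhom : ∀ t : ℝ, 0 ≤ t → ∀ v, Ψ (t • v) = t * Ψ v)
    (hsub : ∀ v w, Ψ (v + w) ≤ Ψ v + Ψ w)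
    (hd : ∀ v, v ≠ 0 → DifferentiableAt ℝ Ψ v)
    (M : E →ₗ[ℝ] E) (hM : M ≠ 0)
    (hc : ∀ v, v ≠ 0 → fderiv ℝ Ψ v (M v) = 0) : IsEuclideanNorm Ψ := by
  have hnt : Nontrivial E := Module.nontrivial_of_finrank_pos (R := ℝ) (by omega)
  obtain ⟨τ, d, hCH⟩ := charpoly_two h2 M
  have heig : ∀ (l : ℝ) v, v ≠ 0 → M v = l • v → l = 0 := by
    intro l v hv h
    have := hc v hv
    rw [h, map_smul, euler_id hhom (hd v hv), smul_eq_mul] at this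
    exact (mul_eq_zero.1 this).resolve_right (hpos v hv).ne'
  rcases lt_or_ge (τ ^ 2) d with hlt | hge
  · set ω := Real.sqrt (d - τ ^ 2) with hω
    have hωp : 0 < ω := Real.sqrt_pos.2 (by linarith)
    have hω2 : ω * ω = d - τ ^ 2 := Real.mul_self_sqrt (by linarith)
    refine euclid_of_J h2 hpos hhom hd (ω⁻¹ • (M - τ • LinearMap.id)) ?_ (τ / ω) ?_
    · intro v
      have e : (M - τ • (LinearMap.id : E →ₗ[ℝ] E)) ((M - τ • (LinearMap.id : E →ₗ[ℝ] E)) v) = (-(ω * ω)) • v := by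
        simp [hCH, hω2]; module
      simp only [LinearMap.smul_apply, map_smul]
      rw [e, smul_smul, smul_smul]
      have : ω⁻¹ * ω⁻¹ * -(ω * ω) = -1 := by field_simp
      rw [this]; simp
    · intro v hv
      simp [hc v hv, euler_id hhom (hd v hv)]
      field_simp
  · exfalso
    set s := Real.sqrt (τ ^ 2 - d) with hs
    have hs2 : s * s = τ ^ 2 - d := Real.mul_self_sqrt (by linarith)
    have key : ∀ l m : ℝ, l + m = 2 * τ → l * m = d → l = 0 := by
      intro l m h1 h3
      by_cases h : ∃ v, M v - m • v ≠ 0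
      · obtain ⟨v, hv⟩ := h
        refine heig l _ hv ?_
        rw [map_sub, map_smul, hCH, ← h1, ← h3]; module
      · push Not at h
        obtain ⟨v, hv⟩ := exists_ne (0 : E)
        have hm : m = 0 := heig m v hv (sub_eq_zero.1 (h v))
        exact absurd (LinearMap.ext fun v => by simpa [hm] using h v) hM
    have l1 := key (τ + s) (τ - s) (by ring) (by linear_combination -hs2)
    have l2 := key (τ - s) (τ + s) (by ring) (by linear_combination -hs2)
    have ht : τ = 0 := by linarith
    have hs0 : s = 0 := by linarith
    have hd0 : d = 0 := by rw [ht, hs0] at hs2; linarith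
    have hMM : ∀ v, M (M v) = 0 := by intro v; rw [hCH, ht, hd0]; simp
    obtain ⟨v, hv⟩ : ∃ v, M v ≠ 0 := by
      by_contra! h
      exact hM (LinearMap.ext h)
    have hv0 : v ≠ 0 := by rintro rfl; simp at hv
    have hne : ∀ t : ℝ, v + t • M v ≠ 0 := by
      intro t h
      apply hv
      have := congrArg M h
      simpa [hMM] using this
    have hder : ∀ t : ℝ, HasDerivAt (fun t : ℝ => Ψ (v + t • M v)) 0 t := by
      intro t
      have hx : HasDerivAt (fun t : ℝ => v + t • M v) (M (v + t • M v)) t := by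
        have := ((hasDerivAt_id t).smul_const (M v)).const_add v
        simpa [hMM] using this
      have h1 := (hd _ (hne t)).hasFDerivAt.comp_hasDerivAt t hx
      rwa [hc _ (hne t)] at h1
    have hconst := const_of_deriv_zero hder
    have hb : ∀ t : ℝ, 0 ≤ t → t * Ψ (M v) ≤ Ψ v + Ψ (-v) := by
      intro t ht
      have e1 := hsub (v + t • M v) (-v)
      have e2 := hconst t 0
      simp at e2
      rw [e2] at e1
      have e3 : v + t • M v + -v = t • M v := by abel
      rwa [e3, hhom t ht] at e1
    have hp := hpos _ hv
    have p1 := hpos v hv0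
    have p2 := hpos (-v) (neg_ne_zero.2 hv0)
    have := hb ((Ψ v + Ψ (-v) + 1) / Ψ (M v)) (by positivity)
    rw [div_mul_cancel₀ _ hp.ne'] at this
    linarith

open scoped Topology in
lemma smooth_implicit {X Y : Type*} [NormedAddCommGroup X] [NormedSpace ℝ X]
    [NormedAddCommGroup Y] [NormedSpace ℝ Y] [CompleteSpace X] [CompleteSpace Y]
    (G : X × Y → Y) (O : Set (X × Y)) (hO : IsOpen O) (x₀ : X) (y₀ : Y) (hmem : (x₀, y₀) ∈ O)
    (hG : ContDiffOn ℝ (⊤ : ℕ∞) G O)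
    (hder : HasFDerivAt (fun y => G (x₀, y)) (ContinuousLinearMap.id ℝ Y) y₀) :
    ∃ ψ : X → Y, ψ x₀ = y₀ ∧ (∀ᶠ x in 𝓝 x₀, ContDiffAt ℝ (⊤ : ℕ∞) ψ x) ∧
      ∀ᶠ p in 𝓝 (x₀, y₀), G p = G (x₀, y₀) → ψ p.1 = p.2 := by
  have hn : ((⊤ : ℕ∞) : WithTop ℕ∞) ≠ 0 := by simp
  have hat : ∀ p ∈ O, ContDiffAt ℝ (⊤ : ℕ∞) G p := fun p hp => hG.contDiffAt (hO.mem_nhds hp)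
  have hc := hat _ hmem
  have hid : fderiv ℝ G (x₀, y₀) ∘L .inr ℝ X Y = ContinuousLinearMap.id ℝ Y := by
    have h1 := (hc.differentiableAt hn).hasFDerivAt
    have h2 : HasFDerivAt (fun y : Y => (x₀, y)) (ContinuousLinearMap.inr ℝ X Y) y₀ :=
      hasFDerivAt_prodMk_right x₀ y₀
    exact (HasFDerivAt.comp y₀ h1 h2).unique hder
  have hinv : (fderiv ℝ G (x₀, y₀) ∘L .inr ℝ X Y).IsInvertible := by
    rw [hid]; exact ⟨ContinuousLinearEquiv.refl ℝ Y, rfl⟩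
  set ψ := hc.implicitFunction hn hinv with hψ
  have hψ0 : ψ x₀ = y₀ := hc.implicitFunction_apply_self hn hinv
  have hinvev : ∀ᶠ p in 𝓝 (x₀, y₀), (fderiv ℝ G p ∘L .inr ℝ X Y).IsInvertible := by
    have hcont : ContinuousAt (fun p => fderiv ℝ G p ∘L .inr ℝ X Y) (x₀, y₀) := by
      have : ContinuousAt (fderiv ℝ G) (x₀, y₀) :=
        (hc.fderiv_right (m := 0) (by simp)).continuousAt
      exact this.clm_comp continuousAt_const
    have hopen : IsOpen (Set.range ((↑) : (Y ≃L[ℝ] Y) → (Y →L[ℝ] Y))) :=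
      ContinuousLinearEquiv.isOpen
    exact hcont.eventually (hopen.mem_nhds hinv)
  have hψc : ContDiffAt ℝ (⊤ : ℕ∞) ψ x₀ := hc.contDiffAt_implicitFunction hn hinv
  have hψcont : ∀ᶠ x in 𝓝 x₀, ContinuousAt ψ x := by
    have : ContDiffAt ℝ 1 ψ x₀ := hψc.of_le (by exact_mod_cast le_top)
    filter_upwards [this.eventually (by simp)] with x hx using hx.continuousAt
  have hgraph : Filter.Tendsto (fun x => (x, ψ x)) (𝓝 x₀) (𝓝 (x₀, y₀)) := by
    have : ContinuousAt (fun x => (x, ψ x)) x₀ := continuousAt_id.prodMk hψc.continuousAt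
    simpa [ContinuousAt, hψ0] using this
  refine ⟨ψ, hψ0, ?_, ?_⟩
  · have hsol : ∀ᶠ x in 𝓝 x₀, G (x, ψ x) = G (x₀, y₀) :=
      hc.eventually_apply_implicitFunction hn hinv
    filter_upwards [hψcont, hgraph.eventually hinvev, hgraph.eventually (hO.mem_nhds hmem),
      hsol, hsol.eventually_nhds] with x h1 h2 h3 h4 h5
    have hc' := hat _ h3
    have h6 := hc'.eventually_apply_eq_iff_implicitFunction hn h2
    have hg' : Filter.Tendsto (fun z => (z, ψ z)) (𝓝 x) (𝓝 (x, ψ x)) :=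
      continuousAt_id.prodMk h1
    refine (hc'.contDiffAt_implicitFunction hn h2).congr_of_eventuallyEq ?_
    filter_upwards [hg'.eventually h6, h5] with z h7 h8
    exact (h7.1 (h8.trans h4.symm)).symm
  · filter_upwards [hc.eventually_apply_eq_iff_implicitFunction hn hinv] with p hp h
    exact hp.1 h

lemma exists_vectors {E : Type*} [NormedAddCommGroup E] [NormedSpace ℝ E] [FiniteDimensional ℝ E]
    (h2 : Module.finrank ℝ E = 2) {Ψ : E → ℝ}
    (hpos : ∀ v, v ≠ 0 → 0 < Ψ v)
    (hhom : ∀ t : ℝ, 0 ≤ t → ∀ v, Ψ (t • v) = t * Ψ v)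
    (hsub : ∀ v w, Ψ (v + w) ≤ Ψ v + Ψ w)
    (hd : ∀ v, v ≠ 0 → DifferentiableAt ℝ Ψ v)
    (hne : ¬ IsEuclideanNorm Ψ) :
    ∃ (n : ℕ) (v : Fin n → E) (g : (Fin n → ℝ) →L[ℝ] (E →L[ℝ] E)), (∀ i, v i ≠ 0) ∧
      ∀ M : E →L[ℝ] E, g (fun i => fderiv ℝ Ψ (v i) (M (v i))) = M := by
  let ℓ : E → Module.Dual ℝ (E →L[ℝ] E) := fun v =>
    ((fderiv ℝ Ψ v) ∘L (ContinuousLinearMap.apply ℝ E v) : (E →L[ℝ] E) →L[ℝ] ℝ)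
  have hℓ : ∀ v M, ℓ v M = fderiv ℝ Ψ v (M v) := fun v M => rfl
  obtain ⟨b, hbS, hspan, hli⟩ := exists_linearIndependent ℝ (ℓ '' {v | v ≠ 0})
  have hfin : Finite b := hli.finite
  obtain ⟨n, ⟨e⟩⟩ := Finite.exists_equiv_fin b
  have hch : ∀ i : Fin n, ∃ v, v ≠ 0 ∧ ℓ v = (e.symm i : Module.Dual ℝ (E →L[ℝ] E)) :=
    fun i => hbS (e.symm i).2
  choose v hv0 hv using hch
  let T : (E →L[ℝ] E) →ₗ[ℝ] (Fin n → ℝ) := LinearMap.pi fun i => ℓ (v i)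
  have hT : LinearMap.ker T = ⊥ := by
    rw [LinearMap.ker_eq_bot']
    intro M hM
    by_contra hM0
    apply hne
    refine euclid_of_field h2 hpos hhom hsub hd (M : E →ₗ[ℝ] E) ?_ ?_
    · intro h; apply hM0; ext x; exact LinearMap.congr_fun h x
    · intro w hw
      have hw' : ℓ w ∈ Submodule.span ℝ b := by
        rw [hspan]; exact Submodule.subset_span ⟨w, hw, rfl⟩
      have hle : Submodule.span ℝ b ≤ LinearMap.ker (Module.Dual.eval ℝ (E →L[ℝ] E) M) := by
        rw [Submodule.span_le]
        intro f hf
        have h1 := congrFun hM (e ⟨f, hf⟩)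
        have h3 : ℓ (v (e ⟨f, hf⟩)) M = 0 := h1
        rw [hv] at h3
        simpa using h3
      exact hle hw'
  obtain ⟨g, hg⟩ := LinearMap.exists_leftInverse_of_injective T hT
  refine ⟨n, v, LinearMap.toContinuousLinearMap g, hv0, fun M => ?_⟩
  exact LinearMap.congr_fun hg M

lemma phi_continuous {V : Type*} [NormedAddCommGroup V] [NormedSpace ℝ V] [FiniteDimensional ℝ V]
    {Φ : V → ℝ} (hhom : ∀ t : ℝ, 0 ≤ t → ∀ v, Φ (t • v) = t * Φ v)
    (hsub : ∀ v w, Φ (v + w) ≤ Φ v + Φ w) : Continuous Φ := by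
  have : ConvexOn ℝ Set.univ Φ := by
    refine ⟨convex_univ, fun x _ y _ a b ha hb _ => ?_⟩
    refine (hsub _ _).trans ?_
    rw [hhom a ha, hhom b hb]; rfl
  exact continuousOn_univ.1 (this.continuousOn isOpen_univ)

lemma phi_lower {V : Type*} [NormedAddCommGroup V] [NormedSpace ℝ V] [FiniteDimensional ℝ V]
    {Φ : V → ℝ} (hhom : ∀ t : ℝ, 0 ≤ t → ∀ v, Φ (t • v) = t * Φ v) (h0 : Φ 0 = 0)
    (hpos : ∀ v, v ≠ 0 → 0 < Φ v) (hc : Continuous Φ) :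
    ∃ C : ℝ, 0 ≤ C ∧ (∀ v, ‖v‖ ≤ C * Φ v) ∧ (∀ v, Φ v ≤ C * ‖v‖) := by
  rcases subsingleton_or_nontrivial V with hs | hs
  · refine ⟨0, le_rfl, fun v => ?_, fun v => ?_⟩ <;> simp [Subsingleton.elim v 0, h0]
  have hcomp : IsCompact (Metric.sphere (0 : V) 1) := isCompact_sphere 0 1
  have hne : (Metric.sphere (0 : V) 1).Nonempty := NormedSpace.sphere_nonempty.2 zero_le_one
  obtain ⟨m, hm, hmin⟩ := hcomp.exists_isMinOn hne hc.continuousOn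
  obtain ⟨M, hM, hmax⟩ := hcomp.exists_isMaxOn hne hc.continuousOn
  have hm0 : m ≠ 0 := by rintro rfl; simp at hm
  have hM0 : M ≠ 0 := by rintro rfl; simp at hM
  have pm := hpos m hm0
  have pM := hpos M hM0
  have hscale : ∀ v, v ≠ 0 → ∃ u ∈ Metric.sphere (0 : V) 1, Φ v = ‖v‖ * Φ u := by
    intro v hv
    have hn : ‖v‖ ≠ 0 := norm_ne_zero_iff.2 hv
    refine ⟨‖v‖⁻¹ • v, by simp [norm_smul, hn], ?_⟩
    rw [hhom _ (by positivity)]; field_simp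
  refine ⟨(Φ m)⁻¹ + Φ M, by positivity, fun v => ?_, fun v => ?_⟩
  · rcases eq_or_ne v 0 with rfl | hv
    · simp [h0]
    obtain ⟨u, hu, e⟩ := hscale v hv
    have h1 : Φ m ≤ Φ u := hmin hu
    have pv := hpos v hv
    have : ‖v‖ ≤ (Φ m)⁻¹ * Φ v := by
      rw [inv_mul_eq_div, le_div_iff₀ pm, e]
      exact mul_le_mul_of_nonneg_left h1 (norm_nonneg v)
    nlinarith
  · rcases eq_or_ne v 0 with rfl | hv
    · simp [h0]
    obtain ⟨u, hu, e⟩ := hscale v hv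
    have h1 : Φ u ≤ Φ M := hmax hu
    have : Φ v ≤ Φ M * ‖v‖ := by
      rw [e, mul_comm]
      exact mul_le_mul_of_nonneg_right h1 (norm_nonneg v)
    have : 0 ≤ (Φ m)⁻¹ * ‖v‖ := by positivity
    linarith

open scoped Topology in
lemma compactness_step {X E V : Type*} [NormedAddCommGroup X] [NormedSpace ℝ X]
    [NormedAddCommGroup E] [NormedSpace ℝ E] [FiniteDimensional ℝ E]
    [NormedAddCommGroup V] [NormedSpace ℝ V]
    (Φ : V → ℝ) (hΦc : Continuous Φ) (hpos : ∀ v, v ≠ 0 → 0 < Φ v) (h0 : Φ 0 = 0)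
    (P : X → (E →L[ℝ] V)) (hP : Continuous P) (hinj : Function.Injective (P 0))
    (R : ℝ) (Ψ : E → ℝ) (hΨ : ∀ v, Ψ v = Φ (P 0 v))
    (hex : ∀ᶠ α in 𝓝 (0 : X), ∃ A : E →L[ℝ] E, ‖A‖ ≤ R ∧ ∀ v, Φ (P α (A v)) = Ψ v)
    (W : Set (E →L[ℝ] E)) (hW : W ∈ 𝓝 (ContinuousLinearMap.id ℝ E)) :
    ∀ᶠ α in 𝓝 (0 : X), ∃ A ∈ W, ∀ v, Φ (P α (A v)) = Ψ v := by
  by_contra hcon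
  rw [Filter.not_eventually] at hcon
  obtain ⟨x, hx, hx'⟩ := Filter.exists_seq_forall_of_frequently (hcon.and_eventually hex)
  choose hno A hAR hA using hx'
  obtain ⟨A₀, -, φ, hφ, hlim⟩ := (isCompact_closedBall (0 : E →L[ℝ] E) R).tendsto_subseq
    (x := A) (fun n => by simpa using hAR n)
  have hxφ : Filter.Tendsto (fun n => x (φ n)) Filter.atTop (𝓝 0) :=
    hx.comp hφ.tendsto_atTop
  have hA₀ : ∀ v, Ψ (A₀ v) = Ψ v := by
    intro v
    have h1 : Filter.Tendsto (fun n => Φ (P (x (φ n)) (A (φ n) v))) Filter.atTop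
        (𝓝 (Φ (P 0 (A₀ v)))) := by
      refine (hΦc.tendsto _).comp ?_
      have hPl : Filter.Tendsto (fun n => P (x (φ n))) Filter.atTop (𝓝 (P 0)) :=
        (hP.tendsto 0).comp hxφ
      have hAl : Filter.Tendsto (fun n => A (φ n) v) Filter.atTop (𝓝 (A₀ v)) :=
        (((ContinuousLinearMap.apply ℝ E v).continuous.tendsto A₀).comp hlim)
      exact ((isBoundedBilinearMap_apply (𝕜 := ℝ) (E := E) (F := V)).continuous.tendsto
        (P 0, A₀ v)).comp (hPl.prodMk_nhds hAl)
    simp only [hA] at h1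
    rw [hΨ]
    exact (tendsto_nhds_unique h1 tendsto_const_nhds)
  have hinj₀ : Function.Injective (A₀ : E →ₗ[ℝ] E) := by
    rw [injective_iff_map_eq_zero]
    intro v hv
    by_contra hv0
    have h1 := hA₀ v
    have hv' : A₀ v = 0 := hv
    rw [hv', hΨ, hΨ, map_zero, h0] at h1
    have : P 0 v ≠ 0 := fun h => hv0 (hinj (by rw [h, map_zero]))
    exact (hpos _ this).ne h1
  let e : E ≃ₗ[ℝ] E := LinearEquiv.ofInjectiveEndo _ hinj₀
  let B : E →L[ℝ] E := LinearMap.toContinuousLinearMap (e.symm : E →ₗ[ℝ] E)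
  have hB : ∀ v, A₀ (B v) = v := fun v => e.apply_symm_apply v
  have hlimB : Filter.Tendsto (fun n => A (φ n) ∘L B) Filter.atTop
      (𝓝 (ContinuousLinearMap.id ℝ E)) := by
    have h1 : Filter.Tendsto (fun n => A (φ n) ∘L B) Filter.atTop (𝓝 (A₀ ∘L B)) :=
      ((continuous_id.clm_comp continuous_const : Continuous fun T : E →L[ℝ] E => T ∘L B).tendsto
        A₀).comp hlim
    have h2 : A₀ ∘L B = ContinuousLinearMap.id ℝ E := by ext v; exact hB v
    rwa [h2] at h1
  obtain ⟨n, hn⟩ := (hlimB.eventually hW).exists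
  apply hno (φ n)
  refine ⟨_, hn, fun v => ?_⟩
  rw [ContinuousLinearMap.comp_apply, hA, ← hA₀, hB]

lemma hasFDerivAt_eqs {E : Type*} [NormedAddCommGroup E] [NormedSpace ℝ E] {Ψ : E → ℝ}
    {n : ℕ} (v : Fin n → E) (g : (Fin n → ℝ) →L[ℝ] (E →L[ℝ] E))
    (hd : ∀ i, DifferentiableAt ℝ Ψ (v i))
    (hg : ∀ M : E →L[ℝ] E, g (fun i => fderiv ℝ Ψ (v i) (M (v i))) = M) :
    HasFDerivAt (g ∘ (fun y : E →L[ℝ] E => (fun i => Ψ (y (v i)))))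
      (ContinuousLinearMap.id ℝ (E →L[ℝ] E)) (ContinuousLinearMap.id ℝ E) := by
  let D : Fin n → ((E →L[ℝ] E) →L[ℝ] ℝ) := fun i =>
    (fderiv ℝ Ψ (v i)) ∘L (ContinuousLinearMap.apply ℝ E (v i))
  have h1 : HasFDerivAt (fun y : E →L[ℝ] E => (fun i => Ψ (y (v i))))
      (ContinuousLinearMap.pi D) (ContinuousLinearMap.id ℝ E) := by
    refine hasFDerivAt_pi'' fun i => ?_
    have h3 : HasFDerivAt Ψ (fderiv ℝ Ψ (v i))
      ((ContinuousLinearMap.apply ℝ E (v i)) (ContinuousLinearMap.id ℝ E)) :=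
        (hd i).hasFDerivAt
    exact h3.comp _ (ContinuousLinearMap.apply ℝ E (v i)).hasFDerivAt
  have h2 := g.hasFDerivAt.comp (ContinuousLinearMap.id ℝ E) h1
  refine h2.congr_fderiv ?_
  refine ContinuousLinearMap.ext fun M => ?_
  exact hg M

set_option maxHeartbeats 2000000

/-- Lemma: smooth family of isometries: if `Φ|_H` is not Euclidean,
`ν ∉ H`, and for all `α` in a neighborhood `U₀` of `0` in `H*` the plane
`H_α = ker π_α` (where `π_α|_H = α`, `π_α ν = 1`) carries a linear isometric copy of
`(H, Φ|_H)`, then there is a smaller neighborhood `U` and a `C^∞` family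
`L : U → Hom(H, V)` with `L 0 = inclusion`, each `L α` injective with range `H_α`
and preserving `Φ`. -/
theorem statement9 (V : Type*) [NormedAddCommGroup V] [NormedSpace ℝ V]
    [FiniteDimensional ℝ V] (hdim : Module.finrank ℝ V = 3)
    (Φ : V → ℝ) (hΦ : IsBanachMinkowski Φ)
    (H : Submodule ℝ V) (hHdim : Module.finrank ℝ H = 2)
    (hHnotEucl : ¬ IsEuclideanNorm (fun v : H => Φ (v : V)))
    (ν : V) (hν : ν ∉ H)
    (U₀ : Set (H →L[ℝ] ℝ)) (hU₀ : U₀ ∈ nhds (0 : H →L[ℝ] ℝ))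
    (hiso : ∀ α ∈ U₀, ∀ π : V →ₗ[ℝ] ℝ, (∀ v : H, π (v : V) = α v) → π ν = 1 →
      ∃ A : H ≃ₗ[ℝ] LinearMap.ker π,
        ∀ v : H, Φ ((A v : LinearMap.ker π) : V) = Φ (v : V)) :
    ∃ U : Set (H →L[ℝ] ℝ), U ∈ nhds (0 : H →L[ℝ] ℝ) ∧ U ⊆ U₀ ∧
      ∃ L : (H →L[ℝ] ℝ) → (H →L[ℝ] V),
        ContDiffOn ℝ (⊤ : ℕ∞) L U ∧
        L 0 = Submodule.subtypeL H ∧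
        ∀ α ∈ U, Function.Injective ⇑(L α) ∧
          (∀ π : V →ₗ[ℝ] ℝ, (∀ v : H, π (v : V) = α v) → π ν = 1 →
            Set.range ⇑(L α) = {u : V | π u = 0}) ∧
          ∀ v : H, Φ (L α v) = Φ (v : V) := by
  obtain ⟨h0, hpos, hhom, hsub, hsm, -⟩ := hΦ
  have hΦc : Continuous Φ := phi_continuous hhom hsub
  obtain ⟨C, hC0, hCl, hCu⟩ := phi_lower hhom h0 hpos hΦc
  have hΦat : ∀ v : V, v ≠ 0 → ContDiffAt ℝ (⊤ : ℕ∞) Φ v := fun v hv =>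
    hsm.contDiffAt (isOpen_compl_singleton.mem_nhds hv)
  -- projection along ν
  obtain ⟨q₀, hq₀, hHq₀⟩ := Submodule.exists_le_ker_of_notMem hν
  obtain ⟨q, hqν, hqH⟩ : ∃ q : V →ₗ[ℝ] ℝ, q ν = 1 ∧ ∀ h ∈ H, q h = 0 := by
    refine ⟨(q₀ ν)⁻¹ • q₀, by simp [hq₀], fun h hh => ?_⟩
    have : q₀ h = 0 := hHq₀ hh
    simp [this]
  have hker : H = LinearMap.ker q := by
    refine Submodule.eq_of_le_of_finrank_eq (fun h hh => hqH h hh) ?_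
    have h1 := LinearMap.finrank_range_add_finrank_ker q
    have h2 : LinearMap.range q = ⊤ := by
      refine LinearMap.range_eq_top.2 (fun t => ⟨t • ν, by simp [hqν]⟩)
    rw [h2, finrank_top, hdim] at h1
    simp at h1
    omega
  have hpmem : ∀ v : V, (LinearMap.id - q.smulRight ν : V →ₗ[ℝ] V) v ∈ H := by
    intro v; rw [hker]; simp [hqν]
  let p₀ : V →ₗ[ℝ] H := LinearMap.codRestrict H _ hpmem
  let p : V →L[ℝ] H := LinearMap.toContinuousLinearMap p₀
  have hp : ∀ v : V, ((p v : H) : V) = v - q v • ν := fun v => rfl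
  let P : (H →L[ℝ] ℝ) → (H →L[ℝ] V) := fun α => H.subtypeL - α.smulRight ν
  have hP : ∀ α h, P α h = (h : V) - α h • ν := fun α h => rfl
  have hP0 : ∀ h, P 0 h = (h : V) := fun h => by simp [hP]
  have hPsm : ContDiff ℝ (⊤ : ℕ∞) P := by
    have : ContDiff ℝ (⊤ : ℕ∞) (fun α : H →L[ℝ] ℝ => α.smulRight ν) :=
      ((ContinuousLinearMap.smulRightL ℝ H V).flip ν).contDiff
    exact contDiff_const.sub this
  -- the functional π_α
  let Pf : (H →L[ℝ] ℝ) → (V →ₗ[ℝ] ℝ) := fun α => (α : H →ₗ[ℝ] ℝ) ∘ₗ p₀ + q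
  have hp₀H : ∀ h : H, p₀ (h : V) = h := fun h => by
    apply Subtype.ext
    change (h : V) - q h • ν = h
    rw [hqH h h.2]; simp
  have hPfH : ∀ α (h : H), Pf α (h : V) = α h := fun α h => by
    simp [Pf, hp₀H, hqH h h.2]
  have hPfν : ∀ α, Pf α ν = 1 := fun α => by
    have : p₀ ν = 0 := by
      apply Subtype.ext
      change ν - q ν • ν = 0
      rw [hqν]; simp
    simp [Pf, this, hqν]
  have hkerP : ∀ (α : H →L[ℝ] ℝ) (π : V →ₗ[ℝ] ℝ), (∀ v : H, π (v : V) = α v) → π ν = 1 →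
      ∀ u, π u = 0 → P α (p u) = u := by
    intro α π h1 h2 u hu
    have h3 : u = ((p u : H) : V) + q u • ν := by rw [hp]; abel
    have h4 : α (p u) + q u = 0 := by
      rw [← hu]; conv_rhs => rw [h3]
      rw [map_add, map_smul, h1, h2]; simp
    rw [hP, eq_neg_of_add_eq_zero_left h4, neg_smul, sub_neg_eq_add, ← h3]
  -- Ψ on H
  let Ψ : H → ℝ := fun v => Φ (v : V)
  have hposH : ∀ v : H, v ≠ 0 → 0 < Ψ v := fun v hv => hpos _ (by simpa using hv)
  have hdH : ∀ v : H, v ≠ 0 → DifferentiableAt ℝ Ψ v := fun v hv => by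
    have h1 := (hΦat (v : V) (by simpa using hv)).differentiableAt (by simp)
    exact h1.comp v H.subtypeL.differentiableAt
  obtain ⟨n, v, g, hv0, hg⟩ := exists_vectors hHdim hposH
    (fun t ht v => hhom t ht (v : V)) (fun v w => hsub (v : V) (w : V)) hdH hHnotEucl
  -- the implicit equation
  let G : (H →L[ℝ] ℝ) × (H →L[ℝ] H) → (H →L[ℝ] H) := fun z => g (fun i => Φ (P z.1 (z.2 (v i))))
  let O : Set ((H →L[ℝ] ℝ) × (H →L[ℝ] H)) := {z | ∀ i, P z.1 (z.2 (v i)) ≠ 0}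
  have hev : ∀ i, ContDiff ℝ (⊤ : ℕ∞) (fun z : (H →L[ℝ] ℝ) × (H →L[ℝ] H) => P z.1 (z.2 (v i))) := by
    intro i
    exact (hPsm.comp contDiff_fst).clm_apply (contDiff_snd.clm_apply contDiff_const)
  have hO : IsOpen O := by
    have : O = ⋂ i, {z | P z.1 (z.2 (v i)) ≠ 0} := by ext z; simp [O]
    rw [this]
    exact isOpen_iInter_of_finite fun i =>
      isOpen_compl_singleton.preimage (hev i).continuous
  have hmem : ((0 : H →L[ℝ] ℝ), ContinuousLinearMap.id ℝ H) ∈ O := by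
    intro i
    change P 0 (v i) ≠ 0
    rw [hP0]; simpa using hv0 i
  have hG : ContDiffOn ℝ (⊤ : ℕ∞) G O := by
    intro z hz
    apply ContDiffAt.contDiffWithinAt
    have h1 : ContDiffAt ℝ (⊤ : ℕ∞)
        (fun z : (H →L[ℝ] ℝ) × (H →L[ℝ] H) => fun i => Φ (P z.1 (z.2 (v i)))) z := by
      rw [contDiffAt_pi]
      intro i
      exact (hΦat _ (hz i)).comp z (hev i).contDiffAt
    exact h1.continuousLinearMap_comp g
  have hder : HasFDerivAt (fun y : H →L[ℝ] H => G (0, y)) (ContinuousLinearMap.id ℝ (H →L[ℝ] H))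
      (ContinuousLinearMap.id ℝ H) := by
    have e1 : (fun y : H →L[ℝ] H => G (0, y)) = g ∘ (fun y : H →L[ℝ] H => (fun i => Ψ (y (v i)))) := by
      funext y
      simp only [G, hP0]; rfl
    rw [e1]
    exact hasFDerivAt_eqs v g (fun i => hdH _ (hv0 i)) hg
  obtain ⟨ψ, hψ0, hψsm, hψu⟩ := smooth_implicit (X := H →L[ℝ] ℝ) (Y := H →L[ℝ] H) G O hO 0 (ContinuousLinearMap.id ℝ H) hmem hG hder
  rw [nhds_prod_eq, Filter.eventually_prod_iff] at hψu
  obtain ⟨pa, hpa, pb, hpb, hψu⟩ := hψu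
  have hcomp := compactness_step Φ hΦc hpos h0 P hPsm.continuous
    (fun a b hab => by rw [hP0, hP0] at hab; exact Subtype.ext hab)
    (‖p‖ * (C * C)) Ψ (fun v => by rw [hP0])
    (by
      filter_upwards [hU₀] with α hα
      obtain ⟨A, hA⟩ := hiso α hα (Pf α) (hPfH α) (hPfν α)
      let B : H →L[ℝ] V := LinearMap.toContinuousLinearMap
        ((LinearMap.ker (Pf α)).subtype ∘ₗ (A : H →ₗ[ℝ] LinearMap.ker (Pf α)))
      have hB : ∀ v, B v = ((A v : LinearMap.ker (Pf α)) : V) := fun v => rfl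
      have hBn : ‖B‖ ≤ C * C := by
        refine ContinuousLinearMap.opNorm_le_bound _ (by positivity) fun v => ?_
        refine (hCl _).trans ?_
        rw [hB, hA, mul_assoc]
        exact mul_le_mul_of_nonneg_left (hCu _) hC0
      refine ⟨p ∘L B, (ContinuousLinearMap.opNorm_comp_le _ _).trans
        (mul_le_mul_of_nonneg_left hBn (norm_nonneg _)), fun v => ?_⟩
      rw [ContinuousLinearMap.comp_apply, hkerP α (Pf α) (hPfH α) (hPfν α) (B v) (A v).2, hB, hA])
    {A | pb A} hpb
  have hall : ∀ᶠ α in nhds (0 : H →L[ℝ] ℝ), α ∈ U₀ ∧ ContDiffAt ℝ (⊤ : ℕ∞) ψ α ∧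
      ∀ v, Φ (P α (ψ α v)) = Φ (v : V) := by
    filter_upwards [hU₀, hψsm, hcomp, hpa] with α h1 h2 h3 h4
    refine ⟨h1, h2, ?_⟩
    obtain ⟨A, hAW, hA⟩ := h3
    have h5 : ψ α = A := by
      refine hψu h4 hAW ?_
      simp only [G, hA, hP0, ContinuousLinearMap.id_apply]; rfl
    rw [h5]; exact hA
  refine ⟨_, hall, fun α h => h.1, fun α => P α ∘L ψ α, ?_, ?_, ?_⟩
  · intro α hα
    exact (hPsm.contDiffAt.clm_comp hα.2.1).contDiffWithinAt
  · ext h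
    simp [hψ0, hP0]
  · intro α hα
    have hΦL := hα.2.2
    have hinj : Function.Injective (P α ∘L ψ α) := by
      rw [injective_iff_map_eq_zero]
      intro w hw
      by_contra hw0
      have h1 := hΦL w
      have hw' : P α (ψ α w) = 0 := hw
      rw [hw', h0] at h1
      exact (hposH w hw0).ne h1
    refine ⟨hinj, ?_, hΦL⟩
    intro π h1 h2
    have hinj' : Function.Injective (ψ α : H →ₗ[ℝ] H) := by
      intro a b hab
      apply hinj
      have hab' : ψ α a = ψ α b := hab
      simp [hab']
    have hsurj := LinearMap.injective_iff_surjective.1 hinj'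
    ext u
    constructor
    · rintro ⟨w, rfl⟩
      change π (P α (ψ α w)) = 0
      rw [hP, map_sub, map_smul, h1, h2]; simp
    · intro hu
      obtain ⟨w, hw⟩ := hsurj (p u)
      have hw' : ψ α w = p u := hw
      refine ⟨w, ?_⟩
      change P α (ψ α w) = u
      rw [hw', hkerP α π h1 h2 u hu]
end
end
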